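/- Let q be an odd prime power, let n ≥ 1, and let G = GL_n(𝔽_q). Let χ be an irreducible complex character of G satisfying χ(g⁻¹) = χ(g) for all g ∈ G (i.e. χ is self-dual). Then Σ_{g ∈ G} χ(g²) = |G|; equivalently, the Frobenius–Schur indicator of χ equals 1, so χ is the character of an orthogonal representation. -/

import Mathlib

namespace GLOrthogonal

set_option maxSynthPendingDepth 3
set_option linter.unusedSectionVars false

open Module
open scoped Classical

section FormSpaces

variable {F M N : Type*} [Field F] [AddCommGroup M] [Module F M] [AddCommGroup N] [Module F N]

/-- Symmetric bilinear forms on `M`. -/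
def symmForms (F M : Type*) [Field F] [AddCommGroup M] [Module F M] :
    Submodule F (M →ₗ[F] M →ₗ[F] F) where
  carrier := {g | ∀ v w, g v w = g w v}
  zero_mem' := by simp
  add_mem' := by intro a b ha hb v w; simp [ha v w, hb v w]
  smul_mem' := by intro c a ha v w; simp [ha v w]

/-- Alternating bilinear forms on `M`. -/
def altForms (F M : Type*) [Field F] [AddCommGroup M] [Module F M] :
    Submodule F (M →ₗ[F] M →ₗ[F] F) where
  carrier := {g | ∀ v, g v v = 0}
  zero_mem' := by simp
  add_mem' := by intro a b ha hb v; simp [ha v, hb v]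
  smul_mem' := by intro c a ha v; simp [ha v]

lemma skew_of_alt {a : M →ₗ[F] M →ₗ[F] F} (ha : ∀ v, a v v = 0) (v w : M) :
    a v w = - a w v := by
  have h := ha (v + w)
  simp only [map_add, LinearMap.add_apply, ha, zero_add, add_zero] at h
  exact eq_neg_of_add_eq_zero_right h

lemma isCompl_symm_alt (h2 : (2 : F) ≠ 0) : IsCompl (symmForms F M) (altForms F M) := by
  constructor
  · rw [Submodule.disjoint_def]
    intro g hs ha
    ext v w
    have h1 := skew_of_alt ha v w
    rw [← hs v w] at h1
    have h3 : (2 : F) * g v w = 0 := by linear_combination h1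
    simpa [h2] using h3
  · rw [codisjoint_iff, eq_top_iff]
    intro g _
    rw [Submodule.mem_sup]
    refine ⟨(2 : F)⁻¹ • (g + g.flip), ?_, (2 : F)⁻¹ • (g - g.flip), ?_, ?_⟩
    · intro v w
      simp [add_comm]
    · intro v
      simp
    · ext v w
      simp
      field_simp
      ring

lemma finrank_symmForms [FiniteDimensional F M] :
    finrank F (symmForms F M) = (finrank F M + 1).choose 2 := by
  classical
  let b := finBasis F M
  let e : symmForms F M →ₗ[F] (Sym2 (Fin (finrank F M)) → F) :=
    { toFun := fun g => Sym2.lift ⟨fun i j => g.1 (b i) (b j), fun i j => g.2 _ _⟩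
      map_add' := by
        intro g h; funext s; induction s with | _ i j => simp
      map_smul' := by
        intro c g; funext s; induction s with | _ i j => simp }
  have hinj : Function.Injective e := by
    intro g h hgh
    apply Subtype.ext
    refine b.ext fun i => b.ext fun j => ?_
    simpa [e] using congrFun hgh s(i, j)
  have hsurj : Function.Surjective e := by
    intro c
    have hb : ∀ i j, Matrix.toLinearMap₂ b b (Matrix.of fun i j => c s(i, j)) (b i) (b j)
        = c s(i, j) := by
      intro i j
      have := LinearMap.toMatrix₂_apply b b
        (Matrix.toLinearMap₂ b b (Matrix.of fun i j => c s(i, j))) i j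
      rw [← this, LinearMap.toMatrix₂_toLinearMap₂]
      rfl
    refine ⟨⟨Matrix.toLinearMap₂ b b (Matrix.of fun i j => c s(i, j)), ?_⟩, ?_⟩
    · have : Matrix.toLinearMap₂ b b (Matrix.of fun i j => c s(i, j)) =
          (Matrix.toLinearMap₂ b b (Matrix.of fun i j => c s(i, j))).flip := by
        refine b.ext fun i => b.ext fun j => ?_
        rw [LinearMap.flip_apply, hb, hb, Sym2.eq_swap]
      intro v w
      exact LinearMap.congr_fun₂ this v w
    · funext s
      induction s with | _ i j => exact hb i j
  rw [(LinearEquiv.ofBijective e ⟨hinj, hsurj⟩).finrank_eq, finrank_fintype_fun_eq_card,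
    Sym2.card, Fintype.card_fin]

lemma finrank_altForms [FiniteDimensional F M] (h2 : (2 : F) ≠ 0) :
    finrank F (altForms F M) = (finrank F M).choose 2 := by
  have h := Submodule.finrank_add_eq_of_isCompl (K := F) (V := M →ₗ[F] M →ₗ[F] F)
    (U := symmForms F M) (W := altForms F M) (isCompl_symm_alt h2)
  rw [finrank_symmForms, finrank_linearMap, finrank_linearMap_self] at h
  rw [Nat.choose_two_right] at *
  have e1 : (finrank F M + 1) * (finrank F M + 1 - 1) / 2 + finrank F M * (finrank F M - 1) / 2
    = finrank F M * finrank F M := by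
    generalize finrank F M = l
    rw [← Nat.choose_two_right, ← Nat.choose_two_right]
    induction l with
    | zero => simp
    | succ k ih =>
      rw [Nat.choose_succ_succ' (k + 1) 1, Nat.choose_succ_succ' k 1] at *
      simp at *
      nlinarith
  omega

/-- Pulling back forms along a linear map. -/
def pullForm (p : M →ₗ[F] N) : (N →ₗ[F] N →ₗ[F] F) →ₗ[F] (M →ₗ[F] M →ₗ[F] F) where
  toFun g := g.compl₁₂ p p
  map_add' := by intro g h; ext; simp
  map_smul' := by intro c g; ext; simp

@[simp] lemma pullForm_apply (p : M →ₗ[F] N) (g : N →ₗ[F] N →ₗ[F] F) (v w : M) :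
    pullForm p g v w = g (p v) (p w) := rfl

lemma pullForm_injective {p : M →ₗ[F] N} (hp : Function.Surjective p) :
    Function.Injective (pullForm (F := F) p) := by
  intro g h hgh
  ext v w
  obtain ⟨v, rfl⟩ := hp v
  obtain ⟨w, rfl⟩ := hp w
  exact LinearMap.congr_fun₂ hgh v w

lemma exists_pullForm {p : M →ₗ[F] N} (hp : Function.Surjective p) (g : M →ₗ[F] M →ₗ[F] F)
    (h1 : ∀ v w, p v = 0 → g v w = 0) (h2 : ∀ v w, p v = 0 → g w v = 0) :
    ∃ h, pullForm (F := F) p h = g := by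
  obtain ⟨s, hs⟩ := p.exists_rightInverse_of_surjective (LinearMap.range_eq_top.2 hp)
  have hs' : ∀ v, p (s v) = v := fun v => LinearMap.congr_fun hs v
  refine ⟨pullForm s g, ?_⟩
  ext v w
  have a1 := h1 (v - s (p v)) w (by simp [hs'])
  have a2 := h2 (w - s (p w)) (s (p v)) (by simp [hs'])
  simp only [map_sub, LinearMap.sub_apply] at a1 a2
  simp only [pullForm_apply]
  rw [sub_eq_zero.1 a1, sub_eq_zero.1 a2]

end FormSpaces

section TypeLevel

variable {F M N : Type*} [Field F] [AddCommGroup M] [Module F M] [AddCommGroup N] [Module F N]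

/-- Bilinear forms `g` with `g v w = g w (x v)` where `x = 1 + u`. -/
def twistForms (u : M →ₗ[F] M) : Submodule F (M →ₗ[F] M →ₗ[F] F) where
  carrier := {g | ∀ v w, g v w = g w (v + u v)}
  zero_mem' := by simp
  add_mem' := by intro a b ha hb v w; simp only [LinearMap.add_apply]; rw [ha v w, hb v w]
  smul_mem' := by intro c a ha v w; simp only [LinearMap.smul_apply]; rw [ha v w]

/-- Alternating bilinear forms invariant under `x = 1 + u`. -/
def altInvForms (u : M →ₗ[F] M) : Submodule F (M →ₗ[F] M →ₗ[F] F) where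
  carrier := {g | (∀ v, g v v = 0) ∧ ∀ v w, g (v + u v) (w + u w) = g v w}
  zero_mem' := by simp
  add_mem' := by
    rintro a b ⟨ha, ha'⟩ ⟨hb, hb'⟩
    refine ⟨fun v => by simp [ha v, hb v], fun v w => ?_⟩
    simp only [LinearMap.add_apply]; rw [ha' v w, hb' v w]
  smul_mem' := by
    rintro c a ⟨ha, ha'⟩
    refine ⟨fun v => by simp [ha v], fun v w => ?_⟩
    simp only [LinearMap.smul_apply]; rw [ha' v w]

lemma finrank_of_exact {S T A : Type*} [AddCommGroup S] [Module F S] [AddCommGroup T] [Module F T]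
    [AddCommGroup A] [Module F A] [FiniteDimensional F T] (j : S →ₗ[F] T) (p : T →ₗ[F] A)
    (hj : Function.Injective j) (hp : Function.Surjective p)
    (h : LinearMap.range j = LinearMap.ker p) :
    finrank F T = finrank F S + finrank F A := by
  have h1 := p.finrank_range_add_finrank_ker
  rw [← h, LinearMap.finrank_range_of_inj hj, LinearMap.range_eq_top.2 hp, finrank_top] at h1
  omega

variable [FiniteDimensional F M] (p : M →ₗ[F] N) (i : N →ₗ[F] M)

lemma finrank_quot_range (hp : Function.Surjective p) (hi : Function.Injective i) :
    finrank F (M ⧸ LinearMap.range i) = finrank F (LinearMap.ker p) := by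
  have h1 := p.finrank_range_add_finrank_ker
  rw [LinearMap.range_eq_top.2 hp, finrank_top] at h1
  have h2 := (LinearMap.range i).finrank_quotient_add_finrank
  rw [LinearMap.finrank_range_of_inj hi] at h2
  omega

lemma finrank_twistForms_comp (h2 : (2 : F) ≠ 0) (hp : Function.Surjective p)
    (hi : Function.Injective i) :
    finrank F (twistForms (i ∘ₗ p)) =
      (finrank F (LinearMap.ker p) + 1).choose 2 + finrank F (altInvForms (p ∘ₗ i)) := by
  obtain ⟨s, hs⟩ := p.exists_rightInverse_of_surjective (LinearMap.range_eq_top.2 hp)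
  obtain ⟨r, hr⟩ := i.exists_leftInverse_of_injective (LinearMap.ker_eq_bot.2 hi)
  have hs' : ∀ v, p (s v) = v := fun v => LinearMap.congr_fun hs v
  have hr' : ∀ v, r (i v) = v := fun v => LinearMap.congr_fun hr v
  have key0 : ∀ g ∈ twistForms (i ∘ₗ p), ∀ v z, p v = 0 → g v (i z) = 0 := by
    intro g hg v z hv
    obtain ⟨w, rfl⟩ := hp z
    have e1 := hg v w
    have e2 := hg w v
    simp only [LinearMap.comp_apply, hv, map_zero, add_zero, map_add] at e1 e2
    rw [e1] at e2
    simpa using e2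
  have key : ∀ g ∈ twistForms (i ∘ₗ p), ∀ v z, g (s (p v)) (i z) = g v (i z) := by
    intro g hg v z
    have := key0 g hg (s (p v) - v) z (by simp [hs'])
    simpa [sub_eq_zero] using this
  let Φ : twistForms (i ∘ₗ p) →ₗ[F] altInvForms (p ∘ₗ i) :=
    { toFun := fun g => ⟨g.1.compl₁₂ s i, by
        constructor
        · intro z
          obtain ⟨v, rfl⟩ := hp z
          simp only [LinearMap.compl₁₂_apply]
          rw [key g.1 g.2]
          have := g.2 v v
          simpa using this
        · intro z z'
          obtain ⟨v, rfl⟩ := hp z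
          obtain ⟨w, rfl⟩ := hp z'
          simp only [LinearMap.compl₁₂_apply, LinearMap.comp_apply, ← map_add p]
          rw [key g.1 g.2, key g.1 g.2]
          simp only [map_add p]
          rw [map_add i]
          have e1 := g.2 v (i (p w))
          have e2 := g.2 (i (p w)) (v + i (p v))
          simp only [LinearMap.comp_apply] at e1 e2
          rw [← e2, ← e1]⟩
      map_add' := by intro g h; rfl
      map_smul' := by intro c g; rfl }
  have hΦ : ∀ g v z, (Φ g).1 (p v) z = g.1 v (i z) := fun g v z => key g.1 g.2 v z
  let q := (LinearMap.range i).mkQ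
  have hqi : ∀ z, q (i z) = 0 := fun z => by simp [q]
  have hqx : ∀ v, q (v + (i ∘ₗ p) v) = q v := fun v => by
    rw [map_add, LinearMap.comp_apply, hqi, add_zero]
  let j : symmForms F (M ⧸ LinearMap.range i) →ₗ[F] twistForms (i ∘ₗ p) :=
    LinearMap.codRestrict _ ((pullForm q).domRestrict _) (by
      rintro ⟨g, hg⟩ v w
      simp only [LinearMap.domRestrict_apply, pullForm_apply, hqx]
      exact hg _ _)
  rw [← finrank_quot_range p i hp hi, ← finrank_symmForms]
  refine finrank_of_exact (F := F) (S := symmForms F (M ⧸ LinearMap.range i))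
    (T := twistForms (i ∘ₗ p)) (A := altInvForms (p ∘ₗ i)) j Φ ?_ ?_ ?_
  · intro g h hgh
    apply Subtype.ext
    apply pullForm_injective (Submodule.mkQ_surjective (LinearMap.range i))
    exact congrArg Subtype.val hgh
  · rintro ⟨a, ha, ha'⟩
    have sk := skew_of_alt ha
    let b : M →ₗ[F] N := p - p ∘ₗ i ∘ₗ r
    let x1r : M →ₗ[F] N := r + p ∘ₗ i ∘ₗ r
    refine ⟨⟨a.compl₁₂ p r + (a.compl₁₂ b x1r).flip - (2 : F)⁻¹ • a.compl₁₂ b b, ?_⟩, ?_⟩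
    · intro v w
      have hi1 := ha' (r v) (r w)
      simp only [LinearMap.comp_apply, map_add, LinearMap.add_apply] at hi1
      simp only [LinearMap.add_apply, LinearMap.sub_apply, LinearMap.smul_apply,
        LinearMap.compl₁₂_apply, LinearMap.flip_apply, b, x1r, LinearMap.comp_apply, map_add,
        map_sub, hr', smul_eq_mul]
      set A := p v
      set A' := p w
      set B := r v
      set B' := r w
      set C := p (i B)
      set C' := p (i B')
      set D := p (i A)
      have k1 := sk A' A
      have k2 := sk C' A
      have k3 := sk A' C
      have k4 := sk C' C
      have k5 := sk C' B
      have k6 := sk B' C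
      have k7 := sk B' B
      field_simp
      grind
    · apply Subtype.ext
      ext z z'
      obtain ⟨v, rfl⟩ := hp z
      rw [hΦ]
      simp [b, x1r, hr']
  · apply le_antisymm
    · rintro _ ⟨g, rfl⟩
      rw [LinearMap.mem_ker]
      apply Subtype.ext
      ext z z'
      obtain ⟨v, rfl⟩ := hp z
      rw [hΦ]
      change g.1 (q v) (q (i z')) = 0
      rw [hqi, map_zero]
    · intro g hg
      have hg0 : ∀ v z, g.1 v (i z) = 0 := by
        intro v z
        rw [← hΦ, LinearMap.mem_ker.1 hg]; rfl
      have hsym : ∀ v w, g.1 v w = g.1 w v := by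
        intro v w
        have := g.2 v w
        simpa [hg0] using this
      obtain ⟨h, hh⟩ := exists_pullForm (Submodule.mkQ_surjective (LinearMap.range i)) g.1
        (by
          intro v w hv
          obtain ⟨z, rfl⟩ : v ∈ LinearMap.range i := by simpa using hv
          rw [hsym, hg0])
        (by
          intro v w hv
          obtain ⟨z, rfl⟩ : v ∈ LinearMap.range i := by simpa using hv
          rw [hg0])
      refine ⟨⟨h, ?_⟩, ?_⟩
      · intro v w
        obtain ⟨v, rfl⟩ := Submodule.mkQ_surjective _ v
        obtain ⟨w, rfl⟩ := Submodule.mkQ_surjective _ w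
        have := hsym v w
        rw [← hh] at this
        exact this
      · apply Subtype.ext
        exact hh

lemma finrank_altInvForms_comp (h2 : (2 : F) ≠ 0) (hp : Function.Surjective p)
    (hi : Function.Injective i) :
    finrank F (altInvForms (i ∘ₗ p)) =
      (finrank F (LinearMap.ker p)).choose 2 + finrank F (twistForms (p ∘ₗ i)) := by
  obtain ⟨s, hs⟩ := p.exists_rightInverse_of_surjective (LinearMap.range_eq_top.2 hp)
  obtain ⟨r, hr⟩ := i.exists_leftInverse_of_injective (LinearMap.ker_eq_bot.2 hi)
  have hs' : ∀ v, p (s v) = v := fun v => LinearMap.congr_fun hs v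
  have hr' : ∀ v, r (i v) = v := fun v => LinearMap.congr_fun hr v
  have key0 : ∀ g ∈ altInvForms (i ∘ₗ p), ∀ v z, p v = 0 → g (i z) v = 0 := by
    rintro g ⟨hg, hg'⟩ v z hv
    obtain ⟨w, rfl⟩ := hp z
    have e1 := hg' w v
    simpa [hv] using e1
  have key : ∀ g ∈ altInvForms (i ∘ₗ p), ∀ v z, g (i z) (s (p v)) = g (i z) v := by
    intro g hg v z
    have := key0 g hg (s (p v) - v) z (by simp [hs'])
    simpa [sub_eq_zero] using this
  let Φ : altInvForms (i ∘ₗ p) →ₗ[F] twistForms (p ∘ₗ i) :=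
    { toFun := fun g => ⟨g.1.compl₁₂ i s, by
        intro z z'
        obtain ⟨v, rfl⟩ := hp z
        obtain ⟨w, rfl⟩ := hp z'
        simp only [LinearMap.compl₁₂_apply, LinearMap.comp_apply, ← map_add p]
        rw [key g.1 g.2, key g.1 g.2]
        have e1 := g.2.2 w v
        have sk := skew_of_alt g.2.1
        simp only [LinearMap.comp_apply, map_add, LinearMap.add_apply] at e1 ⊢
        rw [sk w (i (p v))] at e1
        linear_combination -e1⟩
      map_add' := by intro g h; rfl
      map_smul' := by intro c g; rfl }
  have hΦ : ∀ g v z, (Φ g).1 z (p v) = g.1 (i z) v := fun g v z => key g.1 g.2 v z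
  let q := (LinearMap.range i).mkQ
  have hqi : ∀ z, q (i z) = 0 := fun z => by simp [q]
  have hqx : ∀ v, q (v + (i ∘ₗ p) v) = q v := fun v => by
    rw [map_add, LinearMap.comp_apply, hqi, add_zero]
  let j : altForms F (M ⧸ LinearMap.range i) →ₗ[F] altInvForms (i ∘ₗ p) :=
    LinearMap.codRestrict _ ((pullForm q).domRestrict _) (by
      rintro ⟨g, hg⟩
      refine ⟨fun v => hg _, fun v w => ?_⟩
      simp only [LinearMap.domRestrict_apply, pullForm_apply, hqx])
  rw [← finrank_quot_range p i hp hi, ← finrank_altForms h2]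
  refine finrank_of_exact (F := F) (S := altForms F (M ⧸ LinearMap.range i))
    (T := altInvForms (i ∘ₗ p)) (A := twistForms (p ∘ₗ i)) j Φ ?_ ?_ ?_
  · intro g h hgh
    apply Subtype.ext
    apply pullForm_injective (Submodule.mkQ_surjective (LinearMap.range i))
    exact congrArg Subtype.val hgh
  · rintro ⟨g, hg⟩
    let b : M →ₗ[F] N := p - p ∘ₗ i ∘ₗ r
    refine ⟨⟨g.compl₁₂ r p - (g.compl₁₂ r b).flip, ?_, ?_⟩, ?_⟩
    · intro v
      have h1 := hg (r v) (r v)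
      simp only [LinearMap.comp_apply, map_add] at h1
      simp only [LinearMap.sub_apply, LinearMap.compl₁₂_apply, LinearMap.flip_apply, b,
        LinearMap.comp_apply, map_sub]
      linear_combination -h1
    · intro v w
      have h1 := hg (p w) (r v)
      have h2 := hg (p w) (p v)
      have h3 := hg (r v) (p w)
      have h4 := hg (r w) (p v)
      have h5 := hg (p v) (p w)
      have h6 := hg (p v) (r w)
      simp only [LinearMap.comp_apply, map_add] at h1 h2 h3 h4 h5 h6
      simp only [LinearMap.sub_apply, LinearMap.compl₁₂_apply, LinearMap.flip_apply, b,
        LinearMap.comp_apply, map_sub, map_add, LinearMap.add_apply, hr']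
      grind
    · apply Subtype.ext
      ext z z'
      obtain ⟨v, rfl⟩ := hp z'
      rw [hΦ]
      simp [b, hr']
  · apply le_antisymm
    · rintro _ ⟨g, rfl⟩
      rw [LinearMap.mem_ker]
      apply Subtype.ext
      ext z z'
      obtain ⟨v, rfl⟩ := hp z'
      rw [hΦ]
      change g.1 (q (i z)) (q v) = 0
      rw [hqi, map_zero, LinearMap.zero_apply]
    · intro g hg
      have hg0 : ∀ v z, g.1 (i z) v = 0 := by
        intro v z
        rw [← hΦ, LinearMap.mem_ker.1 hg]; rfl
      have sk := skew_of_alt g.2.1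
      obtain ⟨h, hh⟩ := exists_pullForm (Submodule.mkQ_surjective (LinearMap.range i)) g.1
        (by
          intro v w hv
          obtain ⟨z, rfl⟩ : v ∈ LinearMap.range i := by simpa using hv
          rw [hg0])
        (by
          intro v w hv
          obtain ⟨z, rfl⟩ : v ∈ LinearMap.range i := by simpa using hv
          rw [sk, hg0, neg_zero])
      refine ⟨⟨h, ?_⟩, ?_⟩
      · intro v
        obtain ⟨v, rfl⟩ := Submodule.mkQ_surjective _ v
        have := g.2.1 v
        rw [← hh] at this
        exact this
      · apply Subtype.ext
        exact hh

end TypeLevel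

section Moebius

variable {F E : Type*} [Field F] [Finite F] [AddCommGroup E] [Module F E] [Finite E]

noncomputable local instance : Fintype (Submodule F E) := Fintype.ofFinite _
noncomputable local instance : Fintype E := Fintype.ofFinite _

/-- The weight `(-1)^k q^(k choose 2)`. -/
noncomputable def moeb (F : Type*) (k : ℕ) : ℚ := (-1) ^ k * (Nat.card F : ℚ) ^ (k.choose 2)

lemma moeb_succ (k : ℕ) : moeb F (k + 1) = - (Nat.card F : ℚ) ^ k * moeb F k := by
  unfold moeb
  rw [Nat.choose_succ_succ' k 1, Nat.choose_one_right, pow_add, pow_succ]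
  ring

variable (f : E →ₗ[F] F)

lemma sup_span_inf_ker {J : Submodule F E} {v : E} (hJ : J ≤ LinearMap.ker f) (hv : f v = 1) :
    (J ⊔ F ∙ v) ⊓ LinearMap.ker f = J := by
  rw [sup_inf_assoc_of_le _ hJ]
  have : (F ∙ v) ⊓ LinearMap.ker f = ⊥ := by
    rw [eq_bot_iff]
    rintro x ⟨h1, h2⟩
    obtain ⟨c, rfl⟩ := Submodule.mem_span_singleton.1 h1
    have : c = 0 := by simpa [hv] using h2
    simp [this]
  rw [this, sup_bot_eq]

lemma inf_ker_sup_span {J : Submodule F E} {v : E} (hJ : v ∈ J) (hv : f v = 1) :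
    (J ⊓ LinearMap.ker f) ⊔ F ∙ v = J := by
  apply le_antisymm
  · exact sup_le inf_le_left ((Submodule.span_singleton_le_iff_mem _ _).2 hJ)
  · intro x hx
    rw [Submodule.mem_sup]
    refine ⟨x - f x • v, ⟨J.sub_mem hx (J.smul_mem _ hJ), ?_⟩, f x • v,
      Submodule.smul_mem _ _ (Submodule.mem_span_singleton_self v), by simp⟩
    simp [hv]

lemma finrank_inf_ker {J : Submodule F E} {v : E} (hJ : v ∈ J) (hv : f v = 1) :
    finrank F J = finrank F (J ⊓ LinearMap.ker f : Submodule F E) + 1 := by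
  have h := Submodule.finrank_sup_add_finrank_inf_eq (J ⊓ LinearMap.ker f) (F ∙ v)
  rw [inf_ker_sup_span f hJ hv] at h
  have h0 : (J ⊓ LinearMap.ker f) ⊓ (F ∙ v) = ⊥ := by
    rw [eq_bot_iff]
    rintro x ⟨h2, h1⟩
    obtain ⟨c, rfl⟩ := Submodule.mem_span_singleton.1 h1
    have : c = 0 := by simpa [hv] using h2.2
    simp [this]
  have hv0 : v ≠ 0 := by rintro rfl; simp at hv
  rw [h0, finrank_bot, finrank_span_singleton hv0] at h
  omega

lemma card_inf_fiber {J : Submodule F E} {v : E} (hJ : v ∈ J) (hv : f v = 1) :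
    (Finset.univ.filter fun w => w ∈ J ∧ f w = 1).card =
      Nat.card F ^ finrank F (J ⊓ LinearMap.ker f : Submodule F E) := by
  rw [← Module.natCard_eq_pow_finrank, ← Fintype.card_subtype, ← Nat.card_eq_fintype_card]
  refine Nat.card_congr
    { toFun := fun w => ⟨w.1 - v, J.sub_mem w.2.1 hJ, by simp [w.2.2, hv]⟩
      invFun := fun w => ⟨w.1 + v, J.add_mem w.2.1 hJ, by
        have : f w.1 = 0 := w.2.2
        simp [this, hv]⟩
      left_inv := fun w => by simp
      right_inv := fun w => by simp }

/-- Möbius inversion on the lattice of subspaces, summing over the lower variable. -/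
lemma sum_moeb_codim {P Q : Submodule F E} (hPQ : P ≤ Q) :
    ∑ J with P ≤ J ∧ J ≤ Q, moeb F (finrank F Q - finrank F J) = if P = Q then 1 else 0 := by
  have hq : (Nat.card F : ℚ) ≠ 0 := by exact_mod_cast Nat.card_pos.ne'
  split_ifs with h
  · subst h
    rw [Finset.sum_eq_single P]
    · simp [moeb]
    · intro J hJ hne
      simp only [Finset.mem_filter, Finset.mem_univ, true_and] at hJ
      exact absurd (le_antisymm hJ.2 hJ.1) hne
    · simp
  obtain ⟨v, hvQ, hvP⟩ := SetLike.exists_of_lt (lt_of_le_of_ne hPQ h)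
  obtain ⟨f₀, hf₀, hP₀⟩ := Submodule.exists_le_ker_of_notMem hvP
  obtain ⟨f, hf, hP⟩ : ∃ f : E →ₗ[F] F, f v = 1 ∧ P ≤ LinearMap.ker f := by
    refine ⟨(f₀ v)⁻¹ • f₀, by simp [hf₀], fun x hx => ?_⟩
    have : f₀ x = 0 := hP₀ hx
    simp [this]
  have hdQ := finrank_inf_ker f hvQ hf
  set S := Finset.univ.filter fun J : Submodule F E => P ≤ J ∧ J ≤ Q
  rw [← Finset.sum_filter_add_sum_filter_not S (fun J => J ≤ LinearMap.ker f)]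
  have key : ∑ J ∈ S with ¬ J ≤ LinearMap.ker f, moeb F (finrank F Q - finrank F J) =
      ∑ J ∈ S with ¬ J ≤ LinearMap.ker f, ∑ w with w ∈ J ∧ f w = 1,
        moeb F (finrank F Q - finrank F J) / (Nat.card F : ℚ) ^ (finrank F J - 1) := by
    refine Finset.sum_congr rfl fun J hJ => ?_
    obtain ⟨x, hxJ, hx⟩ := Set.not_subset.1 (Finset.mem_filter.1 hJ).2
    have hx0 : f x ≠ 0 := hx
    have h1 : (f x)⁻¹ • x ∈ J := J.smul_mem _ hxJ
    have h2 : f ((f x)⁻¹ • x) = 1 := by simp [hx0]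
    rw [Finset.sum_const, card_inf_fiber f h1 h2, finrank_inf_ker f h1 h2, nsmul_eq_mul]
    push_cast
    rw [mul_div_cancel₀ _ (pow_ne_zero _ hq)]
  rw [key, Finset.sum_comm' (s' := fun w => S.filter fun J => w ∈ J)
    (t' := Finset.univ.filter fun w => w ∈ Q ∧ f w = 1)]
  swap
  · intro J w
    simp only [S, Finset.mem_filter, Finset.mem_univ, true_and]
    constructor
    · rintro ⟨⟨⟨h1, h2⟩, h3⟩, h4, h5⟩
      exact ⟨⟨⟨h1, h2⟩, h4⟩, h2 h4, h5⟩
    · rintro ⟨⟨⟨h1, h2⟩, h4⟩, h5, h6⟩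
      refine ⟨⟨⟨h1, h2⟩, fun h => ?_⟩, h4, h6⟩
      have : f w = 0 := h h4
      simp [this] at h6
  have key2 : ∀ w ∈ (Finset.univ.filter fun w => w ∈ Q ∧ f w = 1),
      ∑ J ∈ S with w ∈ J, moeb F (finrank F Q - finrank F J) /
        (Nat.card F : ℚ) ^ (finrank F J - 1) =
      ∑ J ∈ S with J ≤ LinearMap.ker f, moeb F (finrank F Q - (finrank F J + 1)) /
        (Nat.card F : ℚ) ^ (finrank F J) := by
    intro w hw
    simp only [Finset.mem_filter, Finset.mem_univ, true_and] at hw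
    refine Finset.sum_nbij' (fun J => J ⊓ LinearMap.ker f) (fun J => J ⊔ F ∙ w) ?_ ?_ ?_ ?_ ?_
    · intro J hJ
      simp only [S, Finset.mem_filter, Finset.mem_univ, true_and] at hJ ⊢
      exact ⟨⟨le_inf hJ.1.1 hP, inf_le_left.trans hJ.1.2⟩, inf_le_right⟩
    · intro J hJ
      simp only [S, Finset.mem_filter, Finset.mem_univ, true_and] at hJ ⊢
      exact ⟨⟨hJ.1.1.trans le_sup_left,
        sup_le hJ.1.2 ((Submodule.span_singleton_le_iff_mem _ _).2 hw.1)⟩,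
        Submodule.mem_sup_right (Submodule.mem_span_singleton_self w)⟩
    · intro J hJ
      exact inf_ker_sup_span f (Finset.mem_filter.1 hJ).2 hw.2
    · intro J hJ
      exact sup_span_inf_ker f (Finset.mem_filter.1 hJ).2 hw.2
    · intro J hJ
      rw [finrank_inf_ker f (Finset.mem_filter.1 hJ).2 hw.2, Nat.add_sub_cancel]
  rw [Finset.sum_congr rfl key2, Finset.sum_const, card_inf_fiber f hvQ hf, nsmul_eq_mul,
    Finset.mul_sum, ← Finset.sum_add_distrib]
  refine Finset.sum_eq_zero fun J hJ => ?_
  simp only [S, Finset.mem_filter, Finset.mem_univ, true_and] at hJ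
  have hle : finrank F J ≤ finrank F (Q ⊓ LinearMap.ker f : Submodule F E) :=
    Submodule.finrank_mono (le_inf hJ.1.2 hJ.2)
  obtain ⟨k, hk⟩ := Nat.exists_eq_add_of_le hle
  rw [hdQ, hk, show finrank F J + k + 1 - finrank F J = k + 1 by omega,
    show finrank F J + k + 1 - (finrank F J + 1) = k by omega, moeb_succ]
  push_cast
  field_simp
  ring

/-- Möbius inversion on the lattice of subspaces, summing over the upper variable. -/
lemma sum_moeb_dim (P Q : Submodule F E) :
    ∑ J with P ≤ J ∧ J ≤ Q, moeb F (finrank F J - finrank F P) = if P = Q then 1 else 0 := by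
  let Z : Matrix (Submodule F E) (Submodule F E) ℚ := Matrix.of fun P Q => if P ≤ Q then 1 else 0
  let M : Matrix (Submodule F E) (Submodule F E) ℚ :=
    Matrix.of fun P Q => if P ≤ Q then moeb F (finrank F Q - finrank F P) else 0
  have h1 : Z * M = 1 := by
    ext P Q
    rw [Matrix.mul_apply, Matrix.one_apply]
    by_cases hPQ : P ≤ Q
    · rw [← sum_moeb_codim hPQ, Finset.sum_filter]
      refine Finset.sum_congr rfl fun J _ => ?_
      by_cases a : P ≤ J <;> by_cases b : J ≤ Q <;> simp [Z, M, a, b]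
    · rw [if_neg (fun h => hPQ h.le)]
      refine Finset.sum_eq_zero fun J _ => ?_
      by_cases a : P ≤ J <;> by_cases b : J ≤ Q <;> simp [Z, M, a, b]
      exact absurd (a.trans b) hPQ
  have h1' : M * Z = 1 := mul_eq_one_comm.1 h1
  have h2 := congrFun (congrFun h1' P) Q
  rw [Matrix.mul_apply, Matrix.one_apply] at h2
  rw [← h2, Finset.sum_filter]
  refine Finset.sum_congr rfl fun J _ => ?_
  by_cases a : P ≤ J <;> by_cases b : J ≤ Q <;> simp [Z, M, a, b]

/-- Weisner's theorem for the lattice of subspaces. -/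
lemma sum_moeb_sup_eq {P Q K : Submodule F E} (hPQ : P ≤ Q) (hK : K ≤ Q) :
    ∑ W with (P ≤ W ∧ W ≤ Q) ∧ W ⊔ K = Q, moeb F (finrank F W - finrank F P) =
      if K ≤ P then moeb F (finrank F Q - finrank F P) else 0 := by
  have h1 : ∑ W with (P ≤ W ∧ W ≤ Q) ∧ W ⊔ K = Q, moeb F (finrank F W - finrank F P) =
      ∑ W with P ≤ W ∧ W ≤ Q, ∑ S with W ⊔ K ≤ S ∧ S ≤ Q,
        moeb F (finrank F W - finrank F P) * moeb F (finrank F Q - finrank F S) := by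
    rw [← Finset.filter_filter, Finset.sum_filter]
    refine Finset.sum_congr rfl fun W hW => ?_
    simp only [Finset.mem_filter, Finset.mem_univ, true_and] at hW
    rw [← Finset.mul_sum, sum_moeb_codim (sup_le hW.2 hK)]
    split_ifs <;> simp
  rw [h1, Finset.sum_comm' (t' := Finset.univ.filter fun S => P ⊔ K ≤ S ∧ S ≤ Q)
    (s' := fun S => Finset.univ.filter fun W => P ≤ W ∧ W ≤ S)]
  swap
  · intro W S
    simp only [Finset.mem_filter, Finset.mem_univ, true_and, sup_le_iff]
    constructor
    · rintro ⟨⟨h1, h2⟩, ⟨h3, h4⟩, h5⟩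
      exact ⟨⟨h1, h3⟩, ⟨h1.trans h3, h4⟩, h5⟩
    · rintro ⟨⟨h1, h3⟩, ⟨h2, h4⟩, h5⟩
      exact ⟨⟨h1, h3.trans h5⟩, ⟨h3, h4⟩, h5⟩
  have h2 : ∀ S ∈ Finset.univ.filter (fun S => P ⊔ K ≤ S ∧ S ≤ Q),
      ∑ W with P ≤ W ∧ W ≤ S,
        moeb F (finrank F W - finrank F P) * moeb F (finrank F Q - finrank F S) =
      if P = S then moeb F (finrank F Q - finrank F S) else 0 := by
    intro S hS
    simp only [Finset.mem_filter, Finset.mem_univ, true_and] at hS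
    rw [← Finset.sum_mul, sum_moeb_dim]
    split_ifs <;> simp
  rw [Finset.sum_congr rfl h2, Finset.sum_ite_eq]
  simp [hPQ]

end Moebius

section Ambient

variable {F E : Type*} [Field F] [Finite F] [AddCommGroup E] [Module F E] [Finite E]

noncomputable local instance : Fintype (Submodule F E) := Fintype.ofFinite _

/-- The restriction of `u` to a stable subspace (and `0` on other subspaces). -/
noncomputable def resEnd (u : E →ₗ[F] E) (W : Submodule F E) : W →ₗ[F] W :=
  if h : ∀ v ∈ W, u v ∈ W then u.restrict h else 0

lemma resEnd_apply {u : E →ₗ[F] E} {W : Submodule F E} (h : W.map u ≤ W) (v : W) :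
    (resEnd u W v : E) = u v := by
  have h' : ∀ v ∈ W, u v ∈ W := fun v hv => h ⟨v, hv, rfl⟩
  rw [resEnd, dif_pos h']; rfl

/-- The number of twisted forms on a stable subspace. -/
noncomputable def numTw (u : E →ₗ[F] E) (W : Submodule F E) : ℚ :=
  (Nat.card F : ℚ) ^ finrank F (twistForms (resEnd u W))

/-- The number of invariant alternating forms on a stable subspace. -/
noncomputable def numAlt (u : E →ₗ[F] E) (W : Submodule F E) : ℚ :=
  (Nat.card F : ℚ) ^ finrank F (altInvForms (resEnd u W))

variable (u : E →ₗ[F] E)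

lemma ker_submoduleMap (W : Submodule F E) :
    finrank F (LinearMap.ker (u.submoduleMap W)) =
      finrank F (W ⊓ LinearMap.ker u : Submodule F E) := by
  have : LinearMap.ker (u.submoduleMap W) = (LinearMap.ker u).comap W.subtype := by
    ext v
    simp [Subtype.ext_iff]
  rw [this, ← Submodule.map_comap_subtype]
  exact (Submodule.equivSubtypeMap W _).finrank_eq

lemma finrank_eq_map_add (W : Submodule F E) :
    finrank F W = finrank F (W.map u) + finrank F (W ⊓ LinearMap.ker u : Submodule F E) := by
  have h := (u.submoduleMap W).finrank_range_add_finrank_ker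
  rw [ker_submoduleMap, LinearMap.range_eq_top.2 (u.submoduleMap_surjective W), finrank_top] at h
  exact h.symm

lemma map_map_le {W : Submodule F E} (hW : W.map u ≤ W) : (W.map u).map u ≤ W.map u :=
  Submodule.map_mono hW

lemma resEnd_eq {W : Submodule F E} (hW : W.map u ≤ W) :
    resEnd u W = Submodule.inclusion hW ∘ₗ u.submoduleMap W ∧
    resEnd u (W.map u) = u.submoduleMap W ∘ₗ Submodule.inclusion hW := by
  constructor
  · ext v
    rw [resEnd_apply hW]; rfl
  · apply LinearMap.ext
    intro v
    apply Subtype.ext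
    rw [resEnd_apply (map_map_le u hW)]; rfl

lemma numTw_eq (h2 : (2 : F) ≠ 0) {W : Submodule F E} (hW : W.map u ≤ W) :
    numTw u W = (Nat.card F : ℚ) ^
      ((finrank F W - finrank F (W.map u) + 1).choose 2) * numAlt u (W.map u) := by
  obtain ⟨e1, e2⟩ := resEnd_eq u hW
  rw [numTw, numAlt, e1, e2, finrank_twistForms_comp _ _ h2 (u.submoduleMap_surjective W)
    (Submodule.inclusion_injective hW), pow_add, ker_submoduleMap, finrank_eq_map_add u W,
    Nat.add_sub_cancel_left]

lemma numAlt_eq (h2 : (2 : F) ≠ 0) {W : Submodule F E} (hW : W.map u ≤ W) :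
    numAlt u W = (Nat.card F : ℚ) ^
      ((finrank F W - finrank F (W.map u)).choose 2) * numTw u (W.map u) := by
  obtain ⟨e1, e2⟩ := resEnd_eq u hW
  rw [numTw, numAlt, e1, e2, finrank_altInvForms_comp _ _ h2 (u.submoduleMap_surjective W)
    (Submodule.inclusion_injective hW), pow_add, ker_submoduleMap, finrank_eq_map_add u W,
    Nat.add_sub_cancel_left]

lemma neg_one_pow_sub_eq {a b k : ℕ} (h : b ≤ a) :
    (-1 : ℚ) ^ (a + k - b) * (-1) ^ k = (-1) ^ (a - b) := by
  obtain ⟨c, rfl⟩ := Nat.exists_eq_add_of_le h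
  rw [show b + c + k - b = c + k by omega, show b + c - b = c by omega, pow_add, mul_assoc,
    ← mul_pow]
  simp

variable (R : Submodule F E)

/-- Grouping stable subspaces by their image under `u`. -/
lemma sum_group_image (hR : R.map u = R) {W : Submodule F E} (hW : W.map u ≤ W)
    (g : Submodule F E → ℚ) :
    ∑ V with (R ≤ V ∧ V ≤ W) ∧ V.map u ≤ V, (-1) ^ (finrank F W - finrank F V) *
      (Nat.card F : ℚ) ^ ((finrank F V - finrank F (V.map u)).choose 2) * g (V.map u) =
    (Nat.card F : ℚ) ^ ((finrank F (W ⊓ LinearMap.ker u : Submodule F E)).choose 2) *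
    ∑ V with (R ⊔ (W ⊓ LinearMap.ker u) ≤ V ∧ V ≤ W.map u) ∧ V.map u ≤ V,
      (-1) ^ (finrank F (W.map u) - finrank F V) * g V := by
  set K := W ⊓ LinearMap.ker u with hK
  rw [← Finset.sum_fiberwise_of_maps_to (g := fun V : Submodule F E => V.map u)
    (t := Finset.univ.filter fun V : Submodule F E => (R ≤ V ∧ V ≤ W.map u) ∧ V.map u ≤ V)]
  swap
  · intro V hV
    simp only [Finset.mem_filter, Finset.mem_univ, true_and] at hV ⊢
    exact ⟨⟨hR.symm.le.trans (Submodule.map_mono hV.1.1), Submodule.map_mono hV.1.2⟩,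
      Submodule.map_mono hV.2⟩
  have key : ∀ V₁ ∈ (Finset.univ.filter fun V : Submodule F E =>
      (R ≤ V ∧ V ≤ W.map u) ∧ V.map u ≤ V),
      ∑ V ∈ (Finset.univ.filter fun V : Submodule F E => (R ≤ V ∧ V ≤ W) ∧ V.map u ≤ V) with
        V.map u = V₁, (-1) ^ (finrank F W - finrank F V) *
        (Nat.card F : ℚ) ^ ((finrank F V - finrank F (V.map u)).choose 2) * g (V.map u) =
      if K ≤ V₁ then (Nat.card F : ℚ) ^ ((finrank F K).choose 2) *
        ((-1) ^ (finrank F (W.map u) - finrank F V₁) * g V₁) else 0 := by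
    intro V₁ hV₁
    simp only [Finset.mem_filter, Finset.mem_univ, true_and] at hV₁
    obtain ⟨⟨h1, h2⟩, h3⟩ := hV₁
    set Y := W ⊓ V₁.comap u with hY
    have hV₁Y : V₁ ≤ Y := le_inf (h2.trans hW) (Submodule.map_le_iff_le_comap.1 h3)
    have hKY : K ≤ Y := le_inf inf_le_left fun x hx => by
      have : u x = 0 := hx.2
      simp [this]
    have hYmap : Y.map u = V₁ := by
      apply le_antisymm
      · exact Submodule.map_le_iff_le_comap.2 inf_le_right
      · intro z hz
        obtain ⟨w, hw, rfl⟩ := h2 hz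
        exact ⟨w, ⟨hw, hz⟩, rfl⟩
    have hYker : Y ⊓ LinearMap.ker u = K := by
      apply le_antisymm
      · exact inf_le_inf_right _ inf_le_left
      · exact le_inf hKY inf_le_right
    have hdY := finrank_eq_map_add u Y
    rw [hYmap, hYker] at hdY
    have hdW := finrank_eq_map_add u W
    rw [← hK] at hdW
    have hset : (Finset.univ.filter fun V : Submodule F E =>
        (R ≤ V ∧ V ≤ W) ∧ V.map u ≤ V).filter (fun V => V.map u = V₁) =
        Finset.univ.filter fun V : Submodule F E => (V₁ ≤ V ∧ V ≤ Y) ∧ V ⊔ K = Y := by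
      ext V
      simp only [Finset.mem_filter, Finset.mem_univ, true_and]
      constructor
      · rintro ⟨⟨⟨a1, a2⟩, a3⟩, rfl⟩
        have hVY : V ≤ Y := le_inf a2 (Submodule.le_comap_map u V)
        refine ⟨⟨a3, hVY⟩, le_antisymm (sup_le hVY hKY) ?_⟩
        rintro y ⟨hyW, v, hv, hvy⟩
        have hy : y = v + (y - v) := by abel
        rw [hy]
        refine Submodule.add_mem_sup hv ⟨W.sub_mem hyW (a2 hv), ?_⟩
        simp [hvy]
      · rintro ⟨⟨a1, a2⟩, a3⟩
        have : V.map u = V₁ := by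
          rw [← hYmap, ← a3, Submodule.map_sup]
          have : K.map u = ⊥ := by
            rw [eq_bot_iff, Submodule.map_le_iff_le_comap]
            exact inf_le_right
          rw [this, sup_bot_eq]
        exact ⟨⟨⟨h1.trans a1, a2.trans inf_le_left⟩, this.le.trans a1⟩, this⟩
    rw [hset]
    have e1 : ∀ V ∈ (Finset.univ.filter fun V : Submodule F E =>
        (V₁ ≤ V ∧ V ≤ Y) ∧ V ⊔ K = Y), (-1 : ℚ) ^ (finrank F W - finrank F V) *
        (Nat.card F : ℚ) ^ ((finrank F V - finrank F (V.map u)).choose 2) * g (V.map u) =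
        moeb F (finrank F V - finrank F V₁) *
          ((-1) ^ (finrank F W - finrank F V₁) * g V₁) := by
      intro V hV
      rw [← hset] at hV
      simp only [Finset.mem_filter, Finset.mem_univ, true_and] at hV
      obtain ⟨⟨⟨a1, a2⟩, a3⟩, a4⟩ := hV
      have b1 : finrank F V₁ ≤ finrank F V := by
        rw [← a4]; exact Submodule.finrank_mono a3
      have b2 : finrank F V ≤ finrank F W := Submodule.finrank_mono a2
      rw [a4, moeb]
      obtain ⟨c, hc⟩ := Nat.exists_eq_add_of_le b1
      obtain ⟨e, he⟩ := Nat.exists_eq_add_of_le b2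
      rw [he, hc, show finrank F V₁ + c + e - (finrank F V₁ + c) = e by omega,
        show finrank F V₁ + c + e - finrank F V₁ = c + e by omega,
        show finrank F V₁ + c - finrank F V₁ = c by omega, pow_add]
      have : (-1 : ℚ) ^ c * (-1) ^ c = 1 := by rw [← mul_pow]; simp
      linear_combination (-(-1) ^ e * (Nat.card F : ℚ) ^ (c.choose 2) * g V₁) * this
    rw [Finset.sum_congr rfl e1, ← Finset.sum_mul, sum_moeb_sup_eq hV₁Y hKY]
    split_ifs with hc
    · rw [hdY, Nat.add_sub_cancel_left, moeb, hdW,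
        ← neg_one_pow_sub_eq (k := finrank F K) (Submodule.finrank_mono h2)]
      ring
    · simp
  rw [Finset.sum_congr rfl key, ← Finset.sum_filter, Finset.filter_filter, Finset.mul_sum]
  refine Finset.sum_congr ?_ fun _ _ => rfl
  ext V
  simp only [Finset.mem_filter, Finset.mem_univ, true_and, sup_le_iff]
  tauto

/-- Grouping by image when all subspaces contain the relevant part of the kernel. -/
lemma sum_group_image_of_ker_le (hR : R.map u = R) {W : Submodule F E} (hW : W.map u ≤ W)
    (hRW : R ≤ W) (h : Submodule F E → ℚ) :
    ∑ V with (R ⊔ (W ⊓ LinearMap.ker u) ≤ V ∧ V ≤ W.map u) ∧ V.map u ≤ V,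
      (-1) ^ (finrank F (W.map u) - finrank F V) * h (V.map u) =
    if W ⊓ LinearMap.ker u ≤ W.map u then
      ∑ V with (R ≤ V ∧ V ≤ (W.map u).map u) ∧ V.map u ≤ V,
        (-1) ^ (finrank F ((W.map u).map u) - finrank F V) * h V
    else 0 := by
  set K := W ⊓ LinearMap.ker u with hK
  split_ifs with hc
  swap
  · refine Finset.sum_eq_zero fun V hV => ?_
    simp only [Finset.mem_filter, Finset.mem_univ, true_and] at hV
    exact absurd ((le_sup_right.trans hV.1.1).trans hV.1.2) hc
  have hker : ∀ V, K ≤ V → V ≤ W.map u → V ⊓ LinearMap.ker u = K := by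
    intro V h1 h2
    apply le_antisymm
    · exact inf_le_inf_right _ (h2.trans hW)
    · exact le_inf h1 inf_le_right
  have hmapc : ∀ V, V ≤ (W.map u).map u → (W.map u ⊓ V.comap u).map u = V := by
    intro V hV
    apply le_antisymm
    · exact Submodule.map_le_iff_le_comap.2 inf_le_right
    · intro z hz
      obtain ⟨w, hw, rfl⟩ := hV hz
      exact ⟨w, ⟨hw, hz⟩, rfl⟩
  refine Finset.sum_nbij' (fun V => V.map u) (fun V => W.map u ⊓ V.comap u) ?_ ?_ ?_ ?_ ?_
  · intro V hV
    simp only [Finset.mem_filter, Finset.mem_univ, true_and] at hV ⊢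
    exact ⟨⟨hR.symm.le.trans (Submodule.map_mono (le_sup_left.trans hV.1.1)),
      Submodule.map_mono hV.1.2⟩, Submodule.map_mono hV.2⟩
  · intro V hV
    simp only [Finset.mem_filter, Finset.mem_univ, true_and] at hV ⊢
    obtain ⟨⟨h1, h2⟩, h3⟩ := hV
    refine ⟨⟨sup_le (le_inf ?_ ?_) (le_inf hc ?_), inf_le_left⟩, ?_⟩
    · exact hR.symm.le.trans (Submodule.map_mono hRW)
    · exact Submodule.map_le_iff_le_comap.1 (hR.le.trans h1)
    · intro x hx
      have : u x = 0 := hx.2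
      simp [this]
    · rw [hmapc V h2]
      exact le_inf (h2.trans (Submodule.map_mono hW)) (Submodule.map_le_iff_le_comap.1 h3)
  · intro V hV
    simp only [Finset.mem_filter, Finset.mem_univ, true_and] at hV
    apply le_antisymm
    · rintro x ⟨hx, v, hv, hvx⟩
      have : x - v ∈ V := by
        refine (le_sup_right.trans hV.1.1) ⟨W.sub_mem (hW hx) (hW (hV.1.2 hv)), ?_⟩
        simp [hvx]
      simpa using V.add_mem this hv
    · exact le_inf hV.1.2 (Submodule.le_comap_map u V)
  · intro V hV
    simp only [Finset.mem_filter, Finset.mem_univ, true_and] at hV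
    exact hmapc V hV.1.2
  · intro V hV
    simp only [Finset.mem_filter, Finset.mem_univ, true_and] at hV
    have e1 := finrank_eq_map_add u V
    have e2 := finrank_eq_map_add u (W.map u)
    rw [hker V (le_sup_right.trans hV.1.1) hV.1.2] at e1
    rw [hker _ hc le_rfl] at e2
    rw [e1, e2, Nat.add_sub_add_right]

/-- Alternating sum of numbers of alternating forms over stable subspaces. -/
noncomputable def altSum (W : Submodule F E) : ℚ :=
  ∑ V with (R ≤ V ∧ V ≤ W) ∧ V.map u ≤ V, (-1) ^ (finrank F W - finrank F V) * numAlt u V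

/-- Alternating sum of numbers of twisted forms over stable subspaces. -/
noncomputable def twSum (W : Submodule F E) : ℚ :=
  ∑ V with (R ≤ V ∧ V ≤ W) ∧ V.map u ≤ V,
    (-1) ^ (finrank F W - finrank F V) * (Nat.card F : ℚ) ^ (finrank F W - finrank F V) *
      numTw u V

lemma altSum_rec (h2 : (2 : F) ≠ 0) (hR : R.map u = R) {W : Submodule F E} (hW : W.map u ≤ W)
    (hRW : R ≤ W) :
    altSum u R W = if W ⊓ LinearMap.ker u ≤ W.map u then
      (Nat.card F : ℚ) ^ ((finrank F (W ⊓ LinearMap.ker u : Submodule F E)).choose 2 +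
        (finrank F (W ⊓ LinearMap.ker u : Submodule F E) + 1).choose 2) *
        altSum u R ((W.map u).map u) else 0 := by
  have e1 : altSum u R W = ∑ V with (R ≤ V ∧ V ≤ W) ∧ V.map u ≤ V,
      (-1) ^ (finrank F W - finrank F V) *
      (Nat.card F : ℚ) ^ ((finrank F V - finrank F (V.map u)).choose 2) * numTw u (V.map u) := by
    refine Finset.sum_congr rfl fun V hV => ?_
    simp only [Finset.mem_filter, Finset.mem_univ, true_and] at hV
    rw [numAlt_eq u h2 hV.2, mul_assoc]
  rw [e1, sum_group_image u R hR hW]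
  have e2 : ∀ V ∈ (Finset.univ.filter fun V : Submodule F E =>
      (R ⊔ (W ⊓ LinearMap.ker u) ≤ V ∧ V ≤ W.map u) ∧ V.map u ≤ V),
      (-1 : ℚ) ^ (finrank F (W.map u) - finrank F V) * numTw u V =
      (-1) ^ (finrank F (W.map u) - finrank F V) * ((Nat.card F : ℚ) ^
        ((finrank F (W ⊓ LinearMap.ker u : Submodule F E) + 1).choose 2) * numAlt u (V.map u)) := by
    intro V hV
    simp only [Finset.mem_filter, Finset.mem_univ, true_and] at hV
    have hk : V ⊓ LinearMap.ker u = W ⊓ LinearMap.ker u := by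
      apply le_antisymm
      · exact inf_le_inf_right _ (hV.1.2.trans hW)
      · exact le_inf (le_sup_right.trans hV.1.1) inf_le_right
    rw [numTw_eq u h2 hV.2, finrank_eq_map_add u V, hk, Nat.add_sub_cancel_left]
  rw [Finset.sum_congr rfl e2, sum_group_image_of_ker_le u R hR hW hRW
    (fun V => (Nat.card F : ℚ) ^
        ((finrank F (W ⊓ LinearMap.ker u : Submodule F E) + 1).choose 2) * numAlt u V)]
  split_ifs
  · rw [pow_add, mul_assoc, altSum]
    congr 1
    rw [Finset.mul_sum]
    refine Finset.sum_congr rfl fun V _ => ?_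
    ring
  · simp

lemma twSum_rec (h2 : (2 : F) ≠ 0) (hR : R.map u = R) {W : Submodule F E} (hW : W.map u ≤ W)
    (hRW : R ≤ W) :
    twSum u R W = if W ⊓ LinearMap.ker u ≤ W.map u then
      (Nat.card F : ℚ) ^ ((finrank F (W ⊓ LinearMap.ker u : Submodule F E)).choose 2 +
        (finrank F (W ⊓ LinearMap.ker u : Submodule F E) + 1).choose 2) *
        twSum u R ((W.map u).map u) else 0 := by
  have hdW := finrank_eq_map_add u W
  have e1 : twSum u R W = ∑ V with (R ≤ V ∧ V ≤ W) ∧ V.map u ≤ V,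
      (-1) ^ (finrank F W - finrank F V) *
      (Nat.card F : ℚ) ^ ((finrank F V - finrank F (V.map u)).choose 2) *
      ((Nat.card F : ℚ) ^ (finrank F W - finrank F (V.map u)) * numAlt u (V.map u)) := by
    refine Finset.sum_congr rfl fun V hV => ?_
    simp only [Finset.mem_filter, Finset.mem_univ, true_and] at hV
    have b1 : finrank F (V.map u) ≤ finrank F V := Submodule.finrank_mono hV.2
    have b2 : finrank F V ≤ finrank F W := Submodule.finrank_mono hV.1.2
    rw [numTw_eq u h2 hV.2, Nat.choose_succ_succ' _ 1, Nat.choose_one_right,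
      show finrank F W - finrank F (V.map u) = (finrank F W - finrank F V) +
        (finrank F V - finrank F (V.map u)) by omega, pow_add, pow_add]
    ring
  rw [e1, sum_group_image u R hR hW (fun V => (Nat.card F : ℚ) ^ (finrank F W - finrank F V) *
    numAlt u V)]
  have e2 : ∀ V ∈ (Finset.univ.filter fun V : Submodule F E =>
      (R ⊔ (W ⊓ LinearMap.ker u) ≤ V ∧ V ≤ W.map u) ∧ V.map u ≤ V),
      (-1 : ℚ) ^ (finrank F (W.map u) - finrank F V) *
        ((Nat.card F : ℚ) ^ (finrank F W - finrank F V) * numAlt u V) =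
      (-1) ^ (finrank F (W.map u) - finrank F V) * ((Nat.card F : ℚ) ^
        ((finrank F (W ⊓ LinearMap.ker u : Submodule F E) + 1).choose 2) *
        ((Nat.card F : ℚ) ^ (finrank F ((W.map u).map u) +
          finrank F (W ⊓ LinearMap.ker u : Submodule F E) - 
          (finrank F (V.map u) + finrank F (W ⊓ LinearMap.ker u : Submodule F E))) *
        numTw u (V.map u))) := by
    intro V hV
    simp only [Finset.mem_filter, Finset.mem_univ, true_and] at hV
    have hk : V ⊓ LinearMap.ker u = W ⊓ LinearMap.ker u := by
      apply le_antisymm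
      · exact inf_le_inf_right _ (hV.1.2.trans hW)
      · exact le_inf (le_sup_right.trans hV.1.1) inf_le_right
    have hk' : W.map u ⊓ LinearMap.ker u = W ⊓ LinearMap.ker u := by
      apply le_antisymm
      · exact inf_le_inf_right _ hW
      · exact le_inf ((le_sup_right.trans hV.1.1).trans hV.1.2) inf_le_right
    have d1 := finrank_eq_map_add u V
    have d2 := finrank_eq_map_add u (W.map u)
    rw [hk] at d1
    rw [hk'] at d2
    have b2 : finrank F V ≤ finrank F (W.map u) := Submodule.finrank_mono hV.1.2
    rw [numAlt_eq u h2 hV.2, Nat.choose_succ_succ' _ 1, Nat.choose_one_right,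
      show finrank F W - finrank F V = finrank F (W ⊓ LinearMap.ker u : Submodule F E) +
        (finrank F ((W.map u).map u) +
          finrank F (W ⊓ LinearMap.ker u : Submodule F E) - 
          (finrank F (V.map u) + finrank F (W ⊓ LinearMap.ker u : Submodule F E))) by omega,
      show finrank F V - finrank F (V.map u) = finrank F (W ⊓ LinearMap.ker u : Submodule F E) by
        omega, pow_add, pow_add]
    ring
  rw [Finset.sum_congr rfl e2, sum_group_image_of_ker_le u R hR hW hRW
    (fun V => (Nat.card F : ℚ) ^
        ((finrank F (W ⊓ LinearMap.ker u : Submodule F E) + 1).choose 2) *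
        ((Nat.card F : ℚ) ^ (finrank F ((W.map u).map u) +
          finrank F (W ⊓ LinearMap.ker u : Submodule F E) - 
          (finrank F V + finrank F (W ⊓ LinearMap.ker u : Submodule F E))) * numTw u V))]
  split_ifs
  · rw [pow_add, mul_assoc, twSum]
    congr 1
    rw [Finset.mul_sum]
    refine Finset.sum_congr rfl fun V _ => ?_
    rw [Nat.add_sub_add_right]
    ring
  · simp

variable {N : ℕ}

lemma le_of_le_map (hN : ∀ v, (u ^ N) v ∈ R) {W : Submodule F E} (hW : W ≤ W.map u) : W ≤ R := by
  have : ∀ k, W ≤ W.map (u ^ k) := by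
    intro k
    induction k with
    | zero => simp [Module.End.one_eq_id]
    | succ k ih =>
      refine ih.trans ?_
      rw [pow_succ, Module.End.mul_eq_comp, Submodule.map_comp]
      exact Submodule.map_mono hW
  intro w hw
  obtain ⟨v, _, rfl⟩ := this N hw
  exact hN v

lemma altSum_eq_twSum (h2 : (2 : F) ≠ 0) (hR : R.map u = R) (hN : ∀ v, (u ^ N) v ∈ R)
    {W : Submodule F E} (hW : W.map u ≤ W) (hRW : R ≤ W) : altSum u R W = twSum u R W := by
  induction hd : finrank F W using Nat.strong_induction_on generalizing W with
  | _ d ih =>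
  by_cases hK : W ⊓ LinearMap.ker u = ⊥
  · have h1 := finrank_eq_map_add u W
    rw [hK, finrank_bot, add_zero] at h1
    have h3 : W.map u = W := Submodule.eq_of_le_of_finrank_eq hW h1.symm
    have h4 : W = R := le_antisymm (le_of_le_map u R hN h3.symm.le) hRW
    subst h4
    have hs : (Finset.univ.filter fun V : Submodule F E => (W ≤ V ∧ V ≤ W) ∧ V.map u ≤ V) =
        {W} := by
      ext V
      simp only [Finset.mem_filter, Finset.mem_univ, true_and, Finset.mem_singleton]
      constructor
      · rintro ⟨⟨a, b⟩, _⟩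
        exact le_antisymm b a
      · rintro rfl
        exact ⟨⟨le_rfl, le_rfl⟩, hW⟩
    rw [altSum, twSum, hs, Finset.sum_singleton, Finset.sum_singleton, numTw_eq u h2 hW, h3]
    simp
  · rw [altSum_rec u R h2 hR hW hRW, twSum_rec u R h2 hR hW hRW]
    have hpos : finrank F (W ⊓ LinearMap.ker u : Submodule F E) ≠ 0 := by
      rwa [Ne, Submodule.finrank_eq_zero]
    have h1 := finrank_eq_map_add u W
    have h3 := finrank_eq_map_add u (W.map u)
    rw [ih (finrank F ((W.map u).map u)) (by omega) (Submodule.map_mono (Submodule.map_mono hW))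
      (by
        calc R = (R.map u).map u := by rw [hR, hR]
          _ ≤ _ := Submodule.map_mono (Submodule.map_mono hRW)) rfl]

lemma eq_of_sup_map_eq (hN : ∀ v, (u ^ N) v ∈ R) {W Y : Submodule F E} (hW : W.map u ≤ W)
    (hRW : R ≤ W) (h : W ⊔ Y.map u = Y) : W = Y := by
  have hk : ∀ k, Y ≤ W ⊔ Y.map (u ^ k) := by
    intro k
    induction k with
    | zero => simp [Module.End.one_eq_id]
    | succ k ih =>
      refine ih.trans (sup_le le_sup_left ?_)
      conv_lhs => rw [← h]
      rw [Submodule.map_sup, pow_succ, Module.End.mul_eq_comp, Submodule.map_comp]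
      refine sup_le_sup_right ?_ _
      clear ih
      induction k with
      | zero => simp [Module.End.one_eq_id]
      | succ k ih =>
        rw [pow_succ, Module.End.mul_eq_comp, Submodule.map_comp]
        exact (Submodule.map_mono hW).trans ih
  apply le_antisymm
  · rw [← h]; exact le_sup_left
  · refine (hk N).trans (sup_le le_rfl ?_)
    rintro _ ⟨v, _, rfl⟩
    exact hRW (hN v)

/-- The value at `1 + u` of the (degenerate) Gelfand–Graev type character on `Y / W`. -/
noncomputable def gg (Y W : Submodule F E) (r : E) : ℚ :=
  (-1) ^ (finrank F Y - finrank F W) * ∑ J with (W ⊔ Y.map u ≤ J ∧ J ≤ Y) ∧ r ∈ J,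
    (-1) ^ (finrank F Y - finrank F J) *
      (Nat.card F : ℚ) ^ ((finrank F Y - finrank F J + 1).choose 2)

lemma numTw_eq_sum (h2 : (2 : F) ≠ 0) (hR : R.map u = R) (hN : ∀ v, (u ^ N) v ∈ R) :
    numTw u (⊤ : Submodule F E) = ∑ W with R ≤ W ∧ W.map u ≤ W, numAlt u W * gg u ⊤ W 0 := by
  have hRu : R ≤ (⊤ : Submodule F E).map u := hR.symm.le.trans (Submodule.map_mono le_top)
  have e1 : ∑ W with R ≤ W ∧ W.map u ≤ W, numAlt u W * gg u ⊤ W 0 =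
      ∑ J with (⊤ : Submodule F E).map u ≤ J,
        (Nat.card F : ℚ) ^ ((finrank F E - finrank F J + 1).choose 2) * altSum u R J := by
    simp only [gg, altSum, Finset.mul_sum]
    rw [Finset.sum_comm' (t' := Finset.univ.filter fun J : Submodule F E =>
      (⊤ : Submodule F E).map u ≤ J) (s' := fun J => Finset.univ.filter fun V : Submodule F E =>
        (R ≤ V ∧ V ≤ J) ∧ V.map u ≤ V)]
    · refine Finset.sum_congr rfl fun J hJ => Finset.sum_congr rfl fun V hV => ?_
      simp only [Finset.mem_filter, Finset.mem_univ, true_and] at hV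
      have b1 : finrank F V ≤ finrank F J := Submodule.finrank_mono hV.1.2
      have b2 : finrank F J ≤ finrank F E := Submodule.finrank_le J
      rw [finrank_top, show finrank F E - finrank F V = (finrank F E - finrank F J) +
        (finrank F J - finrank F V) by omega, pow_add]
      have : (-1 : ℚ) ^ (finrank F E - finrank F J) * (-1) ^ (finrank F E - finrank F J) = 1 := by
        rw [← mul_pow]; simp
      linear_combination (numAlt u V * (-1) ^ (finrank F J - finrank F V) *
        (Nat.card F : ℚ) ^ ((finrank F E - finrank F J + 1).choose 2)) * this
    · intro W J
      simp only [Finset.mem_filter, Finset.mem_univ, true_and, sup_le_iff, le_top, and_true,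
        Submodule.zero_mem]
      tauto
  have e2 : ∑ J with (⊤ : Submodule F E).map u ≤ J,
        (Nat.card F : ℚ) ^ ((finrank F E - finrank F J + 1).choose 2) * twSum u R J =
      ∑ W with R ≤ W ∧ W.map u ≤ W, numTw u W * ((-1) ^ (finrank F E - finrank F W) *
        (Nat.card F : ℚ) ^ (finrank F E - finrank F W) *
        ∑ J with W ⊔ (⊤ : Submodule F E).map u ≤ J ∧ J ≤ ⊤,
          moeb F (finrank F (⊤ : Submodule F E) - finrank F J)) := by
    simp only [twSum, Finset.mul_sum]
    symm
    rw [Finset.sum_comm' (t' := Finset.univ.filter fun J : Submodule F E =>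
      (⊤ : Submodule F E).map u ≤ J) (s' := fun J => Finset.univ.filter fun V : Submodule F E =>
        (R ≤ V ∧ V ≤ J) ∧ V.map u ≤ V)]
    · refine Finset.sum_congr rfl fun J hJ => Finset.sum_congr rfl fun V hV => ?_
      simp only [Finset.mem_filter, Finset.mem_univ, true_and] at hV
      have b1 : finrank F V ≤ finrank F J := Submodule.finrank_mono hV.1.2
      have b2 : finrank F J ≤ finrank F E := Submodule.finrank_le J
      rw [finrank_top, show finrank F E - finrank F V = (finrank F E - finrank F J) +
        (finrank F J - finrank F V) by omega, pow_add, pow_add, moeb, Nat.choose_succ_succ' _ 1,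
        Nat.choose_one_right, pow_add]
      have : (-1 : ℚ) ^ (finrank F E - finrank F J) * (-1) ^ (finrank F E - finrank F J) = 1 := by
        rw [← mul_pow]; simp
      linear_combination (numTw u V * (-1) ^ (finrank F J - finrank F V) *
        (Nat.card F : ℚ) ^ (finrank F J - finrank F V) *
        (Nat.card F : ℚ) ^ (finrank F E - finrank F J) *
        (Nat.card F : ℚ) ^ ((finrank F E - finrank F J).choose 2)) * this
    · intro W J
      simp only [Finset.mem_filter, Finset.mem_univ, true_and, sup_le_iff, le_top, and_true]
      tauto
  rw [e1]
  have e3 : ∀ J ∈ (Finset.univ.filter fun J : Submodule F E => (⊤ : Submodule F E).map u ≤ J),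
      (Nat.card F : ℚ) ^ ((finrank F E - finrank F J + 1).choose 2) * altSum u R J =
      (Nat.card F : ℚ) ^ ((finrank F E - finrank F J + 1).choose 2) * twSum u R J := by
    intro J hJ
    simp only [Finset.mem_filter, Finset.mem_univ, true_and] at hJ
    rw [altSum_eq_twSum u R h2 hR hN ((Submodule.map_mono le_top).trans hJ) (hRu.trans hJ)]
  rw [Finset.sum_congr rfl e3, e2, Finset.sum_eq_single ⊤]
  · rw [sum_moeb_codim (sup_le le_top le_top)]
    simp
  · intro W hW hne
    simp only [Finset.mem_filter, Finset.mem_univ, true_and] at hW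
    rw [sum_moeb_codim le_top, if_neg, mul_zero, mul_zero]
    intro h
    exact hne (eq_of_sup_map_eq u R hN hW.2 hW.1 h)
  · intro h
    exact absurd (by simp) h

end Ambient

section Transfer

variable {F M N : Type*} [Field F] [AddCommGroup M] [Module F M] [AddCommGroup N] [Module F N]

lemma card_altInvForms_of_surjective (u : M →ₗ[F] M) (u' : N →ₗ[F] N) (p : M →ₗ[F] N)
    (hp : Function.Surjective p) (hu : ∀ v, p (u v) = u' (p v)) :
    Nat.card (altInvForms u') =
      Nat.card {a : M →ₗ[F] M →ₗ[F] F // a ∈ altInvForms u ∧ LinearMap.ker p ≤ LinearMap.ker a} := by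
  refine Nat.card_congr (Equiv.ofBijective (fun a => ⟨pullForm p a.1, ⟨⟨?_, ?_⟩, ?_⟩⟩) ⟨?_, ?_⟩)
  · intro v
    exact a.2.1 _
  · intro v w
    change a.1 (p (v + u v)) (p (w + u w)) = a.1 (p v) (p w)
    rw [p.map_add, p.map_add, hu, hu]
    exact a.2.2 _ _
  · intro v hv
    rw [LinearMap.mem_ker] at hv ⊢
    ext w
    simp [pullForm_apply, hv]
  · intro a b h
    exact Subtype.ext (pullForm_injective hp (Subtype.ext_iff.1 h))
  · rintro ⟨a, ⟨h1, h2⟩, h3⟩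
    have k1 : ∀ v w, p v = 0 → a v w = 0 := fun v w hv => by
      have : a v = 0 := h3 hv
      rw [this]; rfl
    obtain ⟨h, rfl⟩ := exists_pullForm hp a k1 (fun v w hv => by
      rw [skew_of_alt h1, k1 v w hv, neg_zero])
    refine ⟨⟨h, ?_, ?_⟩, rfl⟩
    · intro v
      obtain ⟨v, rfl⟩ := hp v
      exact h1 v
    · intro v w
      obtain ⟨v, rfl⟩ := hp v
      obtain ⟨w, rfl⟩ := hp w
      have := h2 v w
      change h (p (v + u v)) (p (w + u w)) = h (p v) (p w) at this
      rwa [p.map_add, p.map_add, hu, hu] at this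

lemma exists_preimage_of_stable [Finite M] {u : M →ₗ[F] M} (hx : ∀ v, v + u v = 0 → v = 0)
    {W : Submodule F M} (hW : W.map u ≤ W) {v : M} (hv : v ∈ W) : ∃ w ∈ W, w + u w = v := by
  have hW' : ∀ v ∈ W, ((LinearMap.id : M →ₗ[F] M) + u) v ∈ W := fun v hv =>
    W.add_mem hv (hW ⟨v, hv, rfl⟩)
  let y : W →ₗ[F] W := (LinearMap.id + u).restrict hW'
  have hinj : Function.Injective y := by
    rw [injective_iff_map_eq_zero]
    intro a ha
    exact Subtype.ext (hx a (Subtype.ext_iff.1 ha))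
  obtain ⟨w, hw⟩ := Finite.surjective_of_injective hinj ⟨v, hv⟩
  exact ⟨w, w.2, Subtype.ext_iff.1 hw⟩

lemma card_twistForms_of_surjective [Finite M] (u : M →ₗ[F] M) (u' : N →ₗ[F] N) (p : M →ₗ[F] N)
    (hx : ∀ v, v + u v = 0 → v = 0)
    (hp : Function.Surjective p) (hu : ∀ v, p (u v) = u' (p v)) :
    Nat.card (twistForms u') =
      Nat.card {a : M →ₗ[F] M →ₗ[F] F // a ∈ twistForms u ∧ LinearMap.ker p ≤ LinearMap.ker a} := by
  refine Nat.card_congr (Equiv.ofBijective (fun a => ⟨pullForm p a.1, ⟨?_, ?_⟩⟩) ⟨?_, ?_⟩)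
  · intro v w
    change a.1 (p v) (p w) = a.1 (p w) (p (v + u v))
    rw [p.map_add, hu]
    exact a.2 _ _
  · intro v hv
    rw [LinearMap.mem_ker] at hv ⊢
    ext w
    simp [pullForm_apply, hv]
  · intro a b h
    exact Subtype.ext (pullForm_injective hp (Subtype.ext_iff.1 h))
  · rintro ⟨a, h2, h3⟩
    have k1 : ∀ v w, p v = 0 → a v w = 0 := fun v w hv => by
      have : a v = 0 := h3 hv
      rw [this]; rfl
    have hst : (LinearMap.ker p).map u ≤ LinearMap.ker p := by
      rw [Submodule.map_le_iff_le_comap]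
      intro v hv
      rw [LinearMap.mem_ker] at hv
      simp [hu, hv]
    obtain ⟨h, rfl⟩ := exists_pullForm hp a k1 (fun v w hv => by
      obtain ⟨v', hv', rfl⟩ := exists_preimage_of_stable hx hst (v := v) hv
      rw [← h2 v' w, k1 v' w hv'])
    refine ⟨⟨h, ?_⟩, rfl⟩
    intro v w
    obtain ⟨v, rfl⟩ := hp v
    obtain ⟨w, rfl⟩ := hp w
    have := h2 v w
    change h (p v) (p w) = h (p w) (p (v + u v)) at this
    rwa [p.map_add, hu] at this

end Transfer

section Ambient

variable {F E : Type*} [Field F] [Finite F] [AddCommGroup E] [Module F E] [Finite E]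

noncomputable local instance : Fintype (Submodule F E) := Fintype.ofFinite _

lemma finite_forms (M : Type*) [AddCommGroup M] [Module F M] [Finite M] :
    Finite (M →ₗ[F] M →ₗ[F] F) :=
  Finite.of_injective (fun a (v : M × M) => a v.1 v.2) fun a b h => by
    ext v w
    exact congrFun h (v, w)

noncomputable local instance (M : Type*) [AddCommGroup M] [Module F M] [Finite M] :
    Fintype (M →ₗ[F] M →ₗ[F] F) := @Fintype.ofFinite _ (finite_forms M)

variable (u : E →ₗ[F] E)

/-- The number of nondegenerate twisted forms. -/
noncomputable def numTwNondeg : ℚ :=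
  Nat.card {a : E →ₗ[F] E →ₗ[F] F // a ∈ twistForms u ∧ LinearMap.ker a = ⊥}

/-- The number of nondegenerate invariant alternating forms on a stable subspace. -/
noncomputable def numAltNondeg (W : Submodule F E) : ℚ :=
  Nat.card {a : W →ₗ[F] W →ₗ[F] F // a ∈ altInvForms (resEnd u W) ∧ LinearMap.ker a = ⊥}

section Quot

local instance (W : Submodule F E) : Finite (E ⧸ W) :=
  Finite.of_surjective _ W.mkQ_surjective

noncomputable local instance (W : Submodule F E) : Fintype (Submodule F (E ⧸ W)) :=
  Fintype.ofFinite _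

variable (W₀ : Submodule F E) (hW₀ : W₀.map u ≤ W₀)

/-- The endomorphism induced on the quotient by a stable subspace. -/
noncomputable def quotEnd : (E ⧸ W₀) →ₗ[F] (E ⧸ W₀) :=
  W₀.mapQ W₀ u (Submodule.map_le_iff_le_comap.1 hW₀)

lemma quotEnd_mkQ (v : E) : W₀.mkQ (u v) = quotEnd u W₀ hW₀ (W₀.mkQ v) := rfl

lemma quotEnd_pow_mkQ (k : ℕ) (v : E) :
    W₀.mkQ ((u ^ k) v) = (quotEnd u W₀ hW₀ ^ k) (W₀.mkQ v) := by
  induction k generalizing v with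
  | zero => rfl
  | succ k ih =>
    rw [pow_succ, pow_succ, Module.End.mul_apply, Module.End.mul_apply, ih, quotEnd_mkQ u W₀ hW₀]

lemma finrank_comap_mkQ (J : Submodule F (E ⧸ W₀)) :
    finrank F (J.comap W₀.mkQ) = finrank F J + finrank F W₀ := by
  let p : J.comap W₀.mkQ →ₗ[F] J := W₀.mkQ.restrict fun v hv => hv
  have hp : Function.Surjective p := by
    rintro ⟨w, hw⟩
    obtain ⟨v, rfl⟩ := W₀.mkQ_surjective w
    exact ⟨⟨v, hw⟩, rfl⟩
  have hk : W₀ ≤ J.comap W₀.mkQ := fun v hv => by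
    have : W₀.mkQ v = 0 := by simpa using hv
    rw [Submodule.mem_comap, this]
    exact J.zero_mem
  have hker : LinearMap.ker p = W₀.comap (J.comap W₀.mkQ).subtype := by
    ext v
    simp [p, Subtype.ext_iff]
  have h := p.finrank_range_add_finrank_ker
  rw [LinearMap.range_eq_top.2 hp, finrank_top, hker,
    (Submodule.comapSubtypeEquivOfLe hk).finrank_eq] at h
  exact h.symm

lemma map_quotEnd_comap (J : Submodule F (E ⧸ W₀)) :
    (J.map (quotEnd u W₀ hW₀)).comap W₀.mkQ = (J.comap W₀.mkQ).map u ⊔ W₀ := by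
  have h : J.map (quotEnd u W₀ hW₀) = ((J.comap W₀.mkQ).map u).map W₀.mkQ := by
    conv_lhs => rw [← Submodule.map_comap_eq_of_surjective W₀.mkQ_surjective J]
    rw [← Submodule.map_comp, ← Submodule.map_comp]
    rfl
  rw [h, Submodule.comap_map_eq, Submodule.ker_mkQ]

lemma gg_quotEnd (W : Submodule F (E ⧸ W₀)) :
    gg (quotEnd u W₀ hW₀) ⊤ W 0 = gg u ⊤ (W.comap W₀.mkQ) 0 := by
  have hf := finrank_comap_mkQ W₀ ⊤
  rw [Submodule.comap_top, finrank_top, finrank_top] at hf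
  unfold gg
  rw [finrank_top, finrank_top, hf, finrank_comap_mkQ, Nat.add_sub_add_right]
  congr 1
  refine Finset.sum_bij' (fun J _ => J.comap W₀.mkQ) (fun J _ => J.map W₀.mkQ) ?_ ?_ ?_ ?_ ?_
  · intro J hJ
    simp only [Finset.mem_filter, Finset.mem_univ, true_and, sup_le_iff, le_top, and_true,
      Submodule.zero_mem] at hJ ⊢
    refine ⟨Submodule.comap_mono hJ.1, ?_⟩
    have := Submodule.comap_mono (f := W₀.mkQ) hJ.2
    rw [map_quotEnd_comap, Submodule.comap_top] at this
    exact le_sup_left.trans this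
  · intro J hJ
    simp only [Finset.mem_filter, Finset.mem_univ, true_and, sup_le_iff, le_top, and_true,
      Submodule.zero_mem] at hJ ⊢
    refine ⟨?_, ?_⟩
    · have := Submodule.map_mono (f := W₀.mkQ) hJ.1
      rwa [Submodule.map_comap_eq_of_surjective W₀.mkQ_surjective] at this
    · have := Submodule.map_mono (f := W₀.mkQ) hJ.2
      refine le_trans ?_ this
      rw [← Submodule.map_comp]
      rintro _ ⟨v, -, rfl⟩
      obtain ⟨v, rfl⟩ := W₀.mkQ_surjective v
      exact ⟨v, trivial, rfl⟩
  · intro J hJ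
    exact Submodule.map_comap_eq_of_surjective W₀.mkQ_surjective J
  · intro J hJ
    simp only [Finset.mem_filter, Finset.mem_univ, true_and, sup_le_iff, le_top, and_true,
      Submodule.zero_mem] at hJ
    rw [Submodule.comap_map_eq, Submodule.ker_mkQ, sup_eq_left]
    refine le_trans ?_ hJ.1
    intro v hv
    have : W₀.mkQ v = 0 := by simpa using hv
    rw [Submodule.mem_comap, this]
    exact W.zero_mem
  · intro J hJ
    rw [finrank_comap_mkQ, Nat.add_sub_add_right]

lemma map_quotEnd_le_iff (J : Submodule F (E ⧸ W₀)) :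
    J.map (quotEnd u W₀ hW₀) ≤ J ↔ (J.comap W₀.mkQ).map u ≤ J.comap W₀.mkQ := by
  constructor
  · rintro h _ ⟨v, hv, rfl⟩
    exact h ⟨_, hv, rfl⟩
  · rintro h _ ⟨v, hv, rfl⟩
    obtain ⟨v, rfl⟩ := W₀.mkQ_surjective v
    exact h ⟨v, hv, rfl⟩

lemma numTw_quotEnd (hx : ∀ v, v + u v = 0 → v = 0) :
    numTw (quotEnd u W₀ hW₀) ⊤ =
      Nat.card {a : E →ₗ[F] E →ₗ[F] F // a ∈ twistForms u ∧ W₀ ≤ LinearMap.ker a} := by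
  let e : (E ⧸ W₀) ≃ₗ[F] (⊤ : Submodule F (E ⧸ W₀)) := Submodule.topEquiv.symm
  have hs : (⊤ : Submodule F (E ⧸ W₀)).map (quotEnd u W₀ hW₀) ≤ ⊤ := le_top
  have := card_twistForms_of_surjective u (resEnd (quotEnd u W₀ hW₀) ⊤)
    (e.toLinearMap ∘ₗ W₀.mkQ) hx (e.surjective.comp W₀.mkQ_surjective) (fun v => by
      apply Subtype.ext
      rw [resEnd_apply hs]
      rfl)
  rw [LinearEquiv.ker_comp, Submodule.ker_mkQ] at this
  rw [numTw, ← this, Module.natCard_eq_pow_finrank (K := F)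
    (V := twistForms (resEnd (quotEnd u W₀ hW₀) ⊤))]
  norm_cast

lemma numAlt_quotEnd {W : Submodule F (E ⧸ W₀)} (hW : W.map (quotEnd u W₀ hW₀) ≤ W) :
    numAlt (quotEnd u W₀ hW₀) W =
      Nat.card {a : W.comap W₀.mkQ →ₗ[F] W.comap W₀.mkQ →ₗ[F] F //
        a ∈ altInvForms (resEnd u (W.comap W₀.mkQ)) ∧
        W₀ ≤ (LinearMap.ker a).map (W.comap W₀.mkQ).subtype} := by
  let p : W.comap W₀.mkQ →ₗ[F] W := W₀.mkQ.restrict fun v hv => hv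
  have hp : Function.Surjective p := by
    rintro ⟨w, hw⟩
    obtain ⟨v, rfl⟩ := W₀.mkQ_surjective w
    exact ⟨⟨v, hw⟩, rfl⟩
  have hk : W₀ ≤ W.comap W₀.mkQ := fun v hv => by
    have : W₀.mkQ v = 0 := by simpa using hv
    rw [Submodule.mem_comap, this]
    exact W.zero_mem
  have hker : LinearMap.ker p = W₀.comap (W.comap W₀.mkQ).subtype := by
    ext v
    simp [p, Subtype.ext_iff]
  have h := card_altInvForms_of_surjective (resEnd u (W.comap W₀.mkQ))
    (resEnd (quotEnd u W₀ hW₀) W) p hp (fun v => by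
      apply Subtype.ext
      rw [resEnd_apply hW]
      exact congrArg W₀.mkQ (resEnd_apply ((map_quotEnd_le_iff u W₀ hW₀ W).1 hW) v))
  have hiff : ∀ a : W.comap W₀.mkQ →ₗ[F] W.comap W₀.mkQ →ₗ[F] F,
      W₀ ≤ (LinearMap.ker a).map (W.comap W₀.mkQ).subtype ↔ LinearMap.ker p ≤ LinearMap.ker a := by
    intro a
    rw [hker]
    constructor
    · rintro h v hv
      obtain ⟨w, hw, hwv⟩ := h hv
      rwa [← Subtype.ext hwv]
    · intro h v hv
      exact ⟨⟨v, hk hv⟩, h hv, rfl⟩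
  simp only [hiff]
  rw [numAlt, ← h, Module.natCard_eq_pow_finrank (K := F)
    (V := altInvForms (resEnd (quotEnd u W₀ hW₀) W))]
  norm_cast

/-- Counting twisted forms whose kernel contains a given stable subspace. -/
lemma card_twist_ge (hW₀ : W₀.map u ≤ W₀) (h2 : (2 : F) ≠ 0) {R : Submodule F E} {N : ℕ} (hR : R.map u = R)
    (hN : ∀ v, (u ^ N) v ∈ R) (hx : ∀ v, v + u v = 0 → v = 0) :
    (Nat.card {a : E →ₗ[F] E →ₗ[F] F // a ∈ twistForms u ∧ W₀ ≤ LinearMap.ker a} : ℚ) =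
    ∑ W with R ≤ W ∧ W.map u ≤ W, Nat.card {a : W →ₗ[F] W →ₗ[F] F //
        a ∈ altInvForms (resEnd u W) ∧ W₀ ≤ (LinearMap.ker a).map W.subtype} * gg u ⊤ W 0 := by
  rw [← numTw_quotEnd u W₀ hW₀ hx, numTw_eq_sum (quotEnd u W₀ hW₀) (R.map W₀.mkQ) (N := N) h2]
  · symm
    rw [← Finset.sum_subset (s₁ := Finset.univ.filter fun W : Submodule F E =>
      (R ≤ W ∧ W.map u ≤ W) ∧ W₀ ≤ W)]
    · refine Finset.sum_bij' (fun J _ => J.map W₀.mkQ) (fun J _ => J.comap W₀.mkQ) ?_ ?_ ?_ ?_ ?_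
      · intro J hJ
        simp only [Finset.mem_filter, Finset.mem_univ, true_and] at hJ ⊢
        refine ⟨Submodule.map_mono hJ.1.1, ?_⟩
        rw [map_quotEnd_le_iff, Submodule.comap_map_eq, Submodule.ker_mkQ,
          sup_eq_left.2 hJ.2]
        exact hJ.1.2
      · intro J hJ
        simp only [Finset.mem_filter, Finset.mem_univ, true_and] at hJ ⊢
        refine ⟨⟨Submodule.map_le_iff_le_comap.1 hJ.1, (map_quotEnd_le_iff u W₀ hW₀ J).1 hJ.2⟩, ?_⟩
        intro v hv
        have : W₀.mkQ v = 0 := by simpa using hv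
        rw [Submodule.mem_comap, this]
        exact J.zero_mem
      · intro J hJ
        simp only [Finset.mem_filter, Finset.mem_univ, true_and] at hJ
        rw [Submodule.comap_map_eq, Submodule.ker_mkQ, sup_eq_left.2 hJ.2]
      · intro J hJ
        exact Submodule.map_comap_eq_of_surjective W₀.mkQ_surjective J
      · intro J hJ
        simp only [Finset.mem_filter, Finset.mem_univ, true_and] at hJ
        have hJ' : (J.map W₀.mkQ).comap W₀.mkQ = J := by
          rw [Submodule.comap_map_eq, Submodule.ker_mkQ, sup_eq_left.2 hJ.2]
        rw [numAlt_quotEnd, gg_quotEnd, hJ']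
        rw [map_quotEnd_le_iff, hJ']
        exact hJ.1.2
    · intro W hW
      simp only [Finset.mem_filter, Finset.mem_univ, true_and] at hW ⊢
      exact hW.1
    · intro W hW hW'
      simp only [Finset.mem_filter, Finset.mem_univ, true_and] at hW hW'
      have : IsEmpty {a : W →ₗ[F] W →ₗ[F] F //
          a ∈ altInvForms (resEnd u W) ∧ W₀ ≤ (LinearMap.ker a).map W.subtype} :=
        ⟨fun a => hW' ⟨hW, a.2.2.trans (Submodule.map_subtype_le W _)⟩⟩
      simp
  · rw [← Submodule.map_comp]
    conv_rhs => rw [← hR, ← Submodule.map_comp]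
    rfl
  · intro v
    obtain ⟨v, rfl⟩ := W₀.mkQ_surjective v
    rw [← quotEnd_pow_mkQ]
    exact ⟨_, hN v, rfl⟩

end Quot

lemma card_ge_eq_sum {α : Type*} [Finite α] (P : α → Prop) (k : α → Submodule F E)
    (W₀ : Submodule F E) :
    (Nat.card {a // P a ∧ W₀ ≤ k a} : ℚ) =
      ∑ W with W₀ ≤ W, (Nat.card {a // P a ∧ k a = W} : ℚ) := by
  have := Fintype.ofFinite α
  simp only [Nat.card_eq_fintype_card, Fintype.card_subtype]
  rw [Finset.card_eq_sum_card_fiberwise (f := k)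
    (t := Finset.univ.filter fun W : Submodule F E => W₀ ≤ W)]
  · push_cast
    refine Finset.sum_congr rfl fun W hW => ?_
    congr 2
    ext a
    simp only [Finset.mem_filter, Finset.mem_univ, true_and] at hW ⊢
    constructor
    · rintro ⟨⟨a, -⟩, b⟩
      exact ⟨a, b⟩
    · rintro ⟨a, b⟩
      exact ⟨⟨a, b.symm ▸ hW⟩, b⟩
  · intro a ha
    simpa using (Finset.mem_filter.1 ha).2.2

lemma ker_twist_stable (hx : ∀ v, v + u v = 0 → v = 0) {a : E →ₗ[F] E →ₗ[F] F}
    (ha : a ∈ twistForms u) : (LinearMap.ker a).map u ≤ LinearMap.ker a := by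
  rintro _ ⟨v, hv, rfl⟩
  have hv' : a v = 0 := hv
  rw [LinearMap.mem_ker]
  ext w
  obtain ⟨w, -, rfl⟩ := exists_preimage_of_stable hx (W := ⊤) le_top (v := w) trivial
  have h1 := ha v w
  have h2 := ha w (v + u v)
  rw [hv'] at h1
  rw [← h1, a.map_add v, hv', zero_add] at h2
  rw [← h2]
  rfl

lemma ker_altInv_stable (hx : ∀ v, v + u v = 0 → v = 0) {W : Submodule F E} (hW : W.map u ≤ W)
    {a : W →ₗ[F] W →ₗ[F] F} (ha : a ∈ altInvForms (resEnd u W)) :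
    ((LinearMap.ker a).map W.subtype).map u ≤ (LinearMap.ker a).map W.subtype := by
  rintro _ ⟨_, ⟨v, hv, rfl⟩, rfl⟩
  have hv' : a v = 0 := hv
  refine ⟨resEnd u W v, ?_, resEnd_apply hW v⟩
  rw [SetLike.mem_coe, LinearMap.mem_ker]
  ext w
  have hx' : ∀ v, v + resEnd u W v = 0 → v = 0 := fun v hv => by
    apply Subtype.ext
    apply hx
    rw [← resEnd_apply hW]
    exact Subtype.ext_iff.1 hv
  obtain ⟨w, -, rfl⟩ := exists_preimage_of_stable hx' (W := ⊤) le_top (v := w) trivial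
  have h1 := ha.2 v w
  rw [a.map_add v, hv', zero_add] at h1
  exact h1

/-- Nondegenerate twisted forms in terms of nondegenerate invariant alternating forms. -/
theorem numTwNondeg_eq_sum (h2 : (2 : F) ≠ 0) {R : Submodule F E} {N : ℕ} (hR : R.map u = R)
    (hN : ∀ v, (u ^ N) v ∈ R) (hx : ∀ v, v + u v = 0 → v = 0) :
    numTwNondeg u = ∑ W with R ≤ W ∧ W.map u ≤ W, numAltNondeg u W * gg u ⊤ W 0 := by
  have key : ∀ W₁ : Submodule F E,
      (Nat.card {a : E →ₗ[F] E →ₗ[F] F // a ∈ twistForms u ∧ LinearMap.ker a = W₁} : ℚ) =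
      ∑ W with R ≤ W ∧ W.map u ≤ W, Nat.card {a : W →ₗ[F] W →ₗ[F] F //
        a ∈ altInvForms (resEnd u W) ∧ (LinearMap.ker a).map W.subtype = W₁} * gg u ⊤ W 0 := by
    have hns : ∀ W₁ : Submodule F E, ¬ W₁.map u ≤ W₁ →
        (Nat.card {a : E →ₗ[F] E →ₗ[F] F // a ∈ twistForms u ∧ LinearMap.ker a = W₁} : ℚ) =
        ∑ W with R ≤ W ∧ W.map u ≤ W, Nat.card {a : W →ₗ[F] W →ₗ[F] F //
          a ∈ altInvForms (resEnd u W) ∧ (LinearMap.ker a).map W.subtype = W₁} * gg u ⊤ W 0 := by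
      intro W₁ hs
      have : IsEmpty {a : E →ₗ[F] E →ₗ[F] F // a ∈ twistForms u ∧ LinearMap.ker a = W₁} :=
        ⟨fun a => hs (by rw [← a.2.2]; exact ker_twist_stable u hx a.2.1)⟩
      rw [Nat.card_of_isEmpty, Nat.cast_zero]
      symm
      refine Finset.sum_eq_zero fun W hW => ?_
      simp only [Finset.mem_filter, Finset.mem_univ, true_and] at hW
      have : IsEmpty {a : W →ₗ[F] W →ₗ[F] F //
          a ∈ altInvForms (resEnd u W) ∧ (LinearMap.ker a).map W.subtype = W₁} :=
        ⟨fun a => hs (by rw [← a.2.2]; exact ker_altInv_stable u hx hW.2 a.2.1)⟩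
      simp
    intro W₁
    by_cases hs : W₁.map u ≤ W₁
    swap
    · exact hns W₁ hs
    induction hd : finrank F E - finrank F W₁ using Nat.strong_induction_on generalizing W₁ with
    | _ d ih =>
    have h := card_twist_ge u W₁ hs h2 hR hN hx
    rw [card_ge_eq_sum (fun a => a ∈ twistForms u) LinearMap.ker] at h
    have h' : ∀ W : Submodule F E, (Nat.card {a : W →ₗ[F] W →ₗ[F] F //
        a ∈ altInvForms (resEnd u W) ∧ W₁ ≤ (LinearMap.ker a).map W.subtype} : ℚ) =
        ∑ W₂ with W₁ ≤ W₂, (Nat.card {a : W →ₗ[F] W →ₗ[F] F //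
        a ∈ altInvForms (resEnd u W) ∧ (LinearMap.ker a).map W.subtype = W₂} : ℚ) := fun W =>
      card_ge_eq_sum (fun a => a ∈ altInvForms (resEnd u W)) (fun a => (LinearMap.ker a).map W.subtype) W₁
    simp only [h', Finset.sum_mul] at h
    rw [Finset.sum_comm] at h
    have hmem : W₁ ∈ Finset.univ.filter fun W : Submodule F E => W₁ ≤ W := by simp
    rw [← Finset.add_sum_erase _ _ hmem, ← Finset.add_sum_erase _ _ hmem] at h
    refine add_right_cancel (h.trans ?_)
    congr 1
    refine Finset.sum_congr rfl fun W₂ hW₂ => ?_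
    simp only [Finset.mem_erase, Finset.mem_filter, Finset.mem_univ, true_and] at hW₂
    by_cases hs₂ : W₂.map u ≤ W₂
    · have h1 : finrank F W₁ < finrank F W₂ :=
        Submodule.finrank_lt_finrank_of_lt (lt_of_le_of_ne hW₂.2 (Ne.symm hW₂.1))
      have h3 : finrank F W₂ ≤ finrank F E := Submodule.finrank_le W₂
      exact (ih (finrank F E - finrank F W₂) (by omega) W₂ hs₂ rfl).symm
    · exact (hns W₂ hs₂).symm
  have := key ⊥
  rw [numTwNondeg, this]
  refine Finset.sum_congr rfl fun W _ => ?_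
  rw [numAltNondeg]
  have hbot : ∀ a : W →ₗ[F] W →ₗ[F] F,
      (LinearMap.ker a).map W.subtype = ⊥ ↔ LinearMap.ker a = ⊥ := fun a =>
    by rw [← (Submodule.map_injective_of_injective W.subtype_injective).eq_iff, Submodule.map_bot]
  simp only [hbot]

end Ambient

section Towers

variable {F E : Type*} [Field F] [Finite F] [AddCommGroup E] [Module F E] [Finite E]

noncomputable local instance : Fintype (Submodule F E) := Fintype.ofFinite _
noncomputable local instance : Fintype E := Fintype.ofFinite _
noncomputable local instance : Fintype F := Fintype.ofFinite _

/-- Nonzero linear functionals on a subspace, extended by zero. -/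
def IsFunc (K : Submodule F E) (ξ : E → F) : Prop :=
  (∃ f : E →ₗ[F] F, ∀ v ∈ K, ξ v = f v) ∧ (∀ v, v ∉ K → ξ v = 0) ∧ ∃ v ∈ K, ξ v ≠ 0

/-- Nondegenerate alternating forms on a subspace, extended by zero. -/
def IsForm (K : Submodule F E) (a : E → E → F) : Prop :=
  (∃ f : K →ₗ[F] K →ₗ[F] F, (∀ v w : K, a v w = f v w) ∧ (∀ v, f v v = 0) ∧
    LinearMap.ker f = ⊥) ∧ ∀ v w, ¬ (v ∈ K ∧ w ∈ K) → a v w = 0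

/-- The kernel of a functional on `K`. -/
def kerOn (K : Submodule F E) (ξ : E → F) : Submodule F E :=
  Submodule.span F {v | v ∈ K ∧ ξ v = 0}

/-- Towers of functionals ending with an alternating form. -/
def IsTower : (m : ℕ) → Submodule F E → (Fin m → E → F) → (E → E → F) → Prop
  | 0, K, _, a => IsForm K a
  | m + 1, K, ξ, a => IsFunc K (ξ 0) ∧ IsTower m (kerOn K (ξ 0)) (Fin.tail ξ) a

/-- A vector at which the functional takes the value `1`. -/
noncomputable def unitVec (K : Submodule F E) (ξ : E → F) : E :=
  if h : ∃ v ∈ K, ξ v = 1 then h.choose else 0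

/-- The phase of a tower. -/
noncomputable def phase (u : E → E) : (m : ℕ) → Submodule F E → (Fin m → E → F) → E → F
  | 0, _, _, _ => 0
  | m + 1, K, ξ, r => ξ 0 r + phase u m (kerOn K (ξ 0)) (Fin.tail ξ) (u (unitVec K (ξ 0)))

variable {K : Submodule F E} {ξ : E → F}

lemma mem_kerOn (h : IsFunc K ξ) {v : E} : v ∈ kerOn K ξ ↔ v ∈ K ∧ ξ v = 0 := by
  obtain ⟨⟨f, hf⟩, -, -⟩ := h
  have : {v | v ∈ K ∧ ξ v = 0} = ((K ⊓ LinearMap.ker f : Submodule F E) : Set E) := by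
    ext v
    simp only [Set.mem_ofPred_eq, SetLike.mem_coe, Submodule.mem_inf, LinearMap.mem_ker]
    constructor
    · rintro ⟨a, b⟩
      exact ⟨a, by rw [← hf v a, b]⟩
    · rintro ⟨a, b⟩
      exact ⟨a, by rw [hf v a, b]⟩
  rw [kerOn, this, Submodule.span_eq, ← SetLike.mem_coe, ← this]
  rfl

lemma kerOn_le (h : IsFunc K ξ) : kerOn K ξ ≤ K := fun _ hv => ((mem_kerOn h).1 hv).1

lemma unitVec_spec (h : IsFunc K ξ) : unitVec K ξ ∈ K ∧ ξ (unitVec K ξ) = 1 := by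
  have h' : ∃ v ∈ K, ξ v = 1 := by
    obtain ⟨⟨f, hf⟩, -, ⟨v, hv, hv'⟩⟩ := h
    refine ⟨(ξ v)⁻¹ • v, K.smul_mem _ hv, ?_⟩
    rw [hf _ (K.smul_mem _ hv), map_smul, ← hf v hv, smul_eq_mul, inv_mul_cancel₀ hv']
  rw [unitVec, dif_pos h']
  exact h'.choose_spec

lemma finrank_kerOn (h : IsFunc K ξ) : finrank F K = finrank F (kerOn K ξ) + 1 := by
  obtain ⟨h1, h2⟩ := unitVec_spec h
  obtain ⟨f, hf⟩ := h.1
  have hk : kerOn K ξ = K ⊓ LinearMap.ker f := by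
    ext v
    rw [mem_kerOn h]
    simp only [Submodule.mem_inf, LinearMap.mem_ker]
    constructor
    · rintro ⟨a, b⟩
      exact ⟨a, by rw [← hf v a, b]⟩
    · rintro ⟨a, b⟩
      exact ⟨a, by rw [hf v a, b]⟩
  rw [hk]
  exact finrank_inf_ker f h1 (by rw [← hf _ h1, h2])

lemma sup_map_kerOn_le_iff (h : IsFunc K ξ) (u : E →ₗ[F] E) (W J : Submodule F E) :
    (W ⊔ (kerOn K ξ).map u ≤ J ∧ u (unitVec K ξ) ∈ J) ↔ W ⊔ K.map u ≤ J := by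
  obtain ⟨h1, h2⟩ := unitVec_spec h
  obtain ⟨f, hf⟩ := h.1
  simp only [sup_le_iff]
  constructor
  · rintro ⟨⟨a, b⟩, c⟩
    refine ⟨a, ?_⟩
    rintro _ ⟨v, hv, rfl⟩
    have : v = (v - ξ v • unitVec K ξ) + ξ v • unitVec K ξ := by abel
    rw [this, map_add, map_smul]
    refine J.add_mem (b ⟨_, (mem_kerOn h).2 ⟨K.sub_mem hv (K.smul_mem _ h1), ?_⟩, rfl⟩)
      (J.smul_mem _ c)
    rw [hf _ (K.sub_mem hv (K.smul_mem _ h1)), map_sub, map_smul, ← hf v hv, ← hf _ h1, h2]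
    simp
  · rintro ⟨a, b⟩
    exact ⟨⟨a, (Submodule.map_mono (kerOn_le h)).trans b⟩, b ⟨_, h1, rfl⟩⟩

lemma sum_char_dual {Q : Type*} [AddCommGroup Q] [Module F Q] [Finite Q] [Fintype (Q →ₗ[F] F)]
    {ψ : AddChar F ℂ} (hψ : ψ ≠ 1) (z : Q) :
    ∑ f : Q →ₗ[F] F, ψ (f z) = if z = 0 then (Nat.card Q : ℂ) else 0 := by
  let θ : AddChar (Q →ₗ[F] F) ℂ :=
    { toFun := fun f => ψ (f z)
      map_zero_eq_one' := by simp
      map_add_eq_mul' := fun f g => by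
        rw [LinearMap.add_apply, AddChar.map_add_eq_mul] }
  have h := AddChar.sum_eq_ite θ
  have hz : θ = 0 ↔ z = 0 := by
    constructor
    · intro h0
      by_contra hne
      obtain ⟨c, hc⟩ := AddChar.ne_one_iff.1 hψ
      rw [← Module.forall_dual_apply_eq_zero_iff F] at hne
      push Not at hne
      obtain ⟨f, hf⟩ := hne
      apply hc
      have h1 := DFunLike.congr_fun h0 ((c * (f z)⁻¹) • f)
      change ψ (((c * (f z)⁻¹) • f) z) = 1 at h1
      rwa [LinearMap.smul_apply, smul_eq_mul, mul_assoc, inv_mul_cancel₀ hf, mul_one] at h1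
    · rintro rfl
      ext f
      simp [θ]
  simp only [hz] at h
  have hc : Fintype.card (Q →ₗ[F] F) = Nat.card Q := by
    rw [← Nat.card_eq_fintype_card, Module.natCard_eq_pow_finrank (K := F) (V := Q →ₗ[F] F),
      Module.natCard_eq_pow_finrank (K := F) (V := Q)]
    congr 1
    exact Subspace.dual_finrank_eq
  rw [← hc]
  exact h

/-- Summing a character over the functionals on `K` vanishing on `J`. -/
lemma sum_isFunc {ψ : AddChar F ℂ} (hψ : ψ ≠ 1) {J : Submodule F E} (hJ : J ≤ K) {r : E}
    (hr : r ∈ K) :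
    ∑ ξ : E → F with IsFunc K ξ ∧ ∀ v ∈ J, ξ v = 0, ψ (ξ r) =
      (if r ∈ J then (Nat.card F : ℂ) ^ (finrank F K - finrank F J) else 0) - 1 := by
  let J' : Submodule F K := J.comap K.subtype
  have hfin : Finite (K ⧸ J') := Finite.of_surjective _ J'.mkQ_surjective
  have hfin' : Finite ((K ⧸ J') →ₗ[F] F) := 
    Finite.of_injective (fun f (v : K ⧸ J') => f v) fun a b h => LinearMap.ext (congrFun h)
  let _ : Fintype ((K ⧸ J') →ₗ[F] F) := Fintype.ofFinite _
  let e : ((K ⧸ J') →ₗ[F] F) → E → F := fun f v =>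
    if h : v ∈ K then f (J'.mkQ ⟨v, h⟩) else 0
  have he : ∀ f v (hv : v ∈ K), e f v = f (J'.mkQ ⟨v, hv⟩) := fun f v hv => dif_pos hv
  have hinj : Function.Injective e := by
    intro f g h
    apply LinearMap.ext
    intro v
    obtain ⟨v, rfl⟩ := J'.mkQ_surjective v
    have := congrFun h v
    rwa [he f v v.2, he g v v.2] at this
  have hr0 : J'.mkQ ⟨r, hr⟩ = 0 ↔ r ∈ J := by
    rw [Submodule.mkQ_apply, Submodule.Quotient.mk_eq_zero]
    rfl
  have hset : (Finset.univ.filter fun ξ : E → F => IsFunc K ξ ∧ ∀ v ∈ J, ξ v = 0) =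
      (Finset.univ.erase (0 : (K ⧸ J') →ₗ[F] F)).image e := by
    ext ξ
    simp only [Finset.mem_filter, Finset.mem_univ, true_and, Finset.mem_image, Finset.mem_erase,
      and_true]
    constructor
    · rintro ⟨⟨⟨f, hf⟩, h0, ⟨v, hv, hv'⟩⟩, hJ0⟩
      have hk : J' ≤ LinearMap.ker (f ∘ₗ K.subtype) := fun v hv => by
        rw [LinearMap.mem_ker]
        change f v = 0
        rw [← hf v v.2, hJ0 v hv]
      have hee : e (J'.liftQ _ hk) = ξ := by
        ext v
        by_cases hv : v ∈ K
        · rw [he _ v hv, hf v hv]; rfl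
        · rw [h0 v hv]
          exact dif_neg hv
      refine ⟨J'.liftQ _ hk, ?_, hee⟩
      rintro h
      rw [h] at hee
      apply hv'
      rw [← hee, he _ v hv]
      rfl
    · rintro ⟨f, hf, rfl⟩
      refine ⟨⟨?_, fun v hv => dif_neg hv, ?_⟩, ?_⟩
      · obtain ⟨g, hg⟩ := LinearMap.exists_extend (f ∘ₗ J'.mkQ)
        refine ⟨g, fun v hv => ?_⟩
        rw [he _ v hv]
        exact (LinearMap.congr_fun hg ⟨v, hv⟩).symm
      · by_contra! hcon
        apply hf
        apply LinearMap.ext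
        intro v
        obtain ⟨v, rfl⟩ := J'.mkQ_surjective v
        have := hcon v v.2
        rwa [he _ v v.2] at this
      · intro v hv
        rw [he _ v (hJ hv)]
        have : J'.mkQ ⟨v, hJ hv⟩ = 0 := by
          rw [Submodule.mkQ_apply, Submodule.Quotient.mk_eq_zero]
          exact hv
        rw [this, map_zero]
  rw [hset, Finset.sum_image hinj.injOn]
  have h1 := Finset.add_sum_erase Finset.univ (fun f => ψ (e f r))
    (Finset.mem_univ (0 : (K ⧸ J') →ₗ[F] F))
  simp only [he _ r hr] at h1 ⊢
  rw [sum_char_dual hψ, LinearMap.zero_apply, AddChar.map_zero_eq_one] at h1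
  rw [eq_sub_iff_add_eq', h1]
  simp only [hr0]
  split_ifs
  · rw [Module.natCard_eq_pow_finrank (K := F) (V := K ⧸ J')]
    have := J'.finrank_quotient_add_finrank
    rw [(Submodule.comapSubtypeEquivOfLe hJ).finrank_eq] at this
    rw [← this, Nat.add_sub_cancel]
    push_cast
    rfl
  · rfl

end Towers

section TowerSums

variable {F E : Type*} [Field F] [Finite F] [AddCommGroup E] [Module F E] [Finite E]

noncomputable local instance : Fintype (Submodule F E) := Fintype.ofFinite _
noncomputable local instance : Fintype E := Fintype.ofFinite _
noncomputable local instance : Fintype F := Fintype.ofFinite _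

variable {K : Submodule F E} {ξ : E → F} (u : E →ₗ[F] E) {R : Submodule F E} {N : ℕ}

lemma gg_kerOn (h : IsFunc K ξ) {W : Submodule F E} (hW : W ≤ kerOn K ξ) :
    (gg u (kerOn K ξ) W (u (unitVec K ξ)) : ℚ) = ∑ J with (W ⊔ K.map u ≤ J ∧ J ≤ K) ∧
      ∀ v ∈ J, ξ v = 0, (-1) ^ (finrank F K - finrank F W) *
        moeb F (finrank F K - finrank F J) := by
  rw [gg, Finset.mul_sum]
  refine Finset.sum_congr ?_ ?_
  · ext J
    simp only [Finset.mem_filter, Finset.mem_univ, true_and]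
    rw [← sup_map_kerOn_le_iff h u W J]
    have : J ≤ kerOn K ξ ↔ J ≤ K ∧ ∀ v ∈ J, ξ v = 0 := by
      constructor
      · intro hJ
        exact ⟨hJ.trans (kerOn_le h), fun v hv => ((mem_kerOn h).1 (hJ hv)).2⟩
      · rintro ⟨a, b⟩ v hv
        exact (mem_kerOn h).2 ⟨a hv, b v hv⟩
    rw [this]
    tauto
  · intro J hJ
    simp only [Finset.mem_filter, Finset.mem_univ, true_and] at hJ
    have hJk : J ≤ kerOn K ξ := fun v hv => (mem_kerOn h).2 ⟨hJ.1.2 hv, hJ.2 v hv⟩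
    have e1 := finrank_kerOn h
    have e2 : finrank F J ≤ finrank F (kerOn K ξ) := Submodule.finrank_mono hJk
    have e3 : finrank F W ≤ finrank F (kerOn K ξ) := Submodule.finrank_mono hW
    rw [e1, Nat.sub_add_comm e2, Nat.sub_add_comm e3, moeb, pow_succ, pow_succ]
    ring

lemma sum_gg_kerOn {ψ : AddChar F ℂ} (hψ : ψ ≠ 1) (hN : ∀ v, (u ^ N) v ∈ R)
    {W : Submodule F E} (hW : W.map u ≤ W) (hRW : R ≤ W) (hWK : W ≤ K) (hne : W ≠ K)
    (hK : K.map u ≤ K) {r : E} (hr : r ∈ K) :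
    ∑ ξ : E → F with (IsFunc K ξ ∧ ∀ v ∈ K, ξ (u v) = 0) ∧ W ≤ kerOn K ξ,
      ψ (ξ r) * ((gg u (kerOn K ξ) W (u (unitVec K ξ)) : ℚ) : ℂ) = ((gg u K W r : ℚ) : ℂ) := by
  have e1 : ∀ ξ ∈ (Finset.univ.filter fun ξ : E → F =>
      (IsFunc K ξ ∧ ∀ v ∈ K, ξ (u v) = 0) ∧ W ≤ kerOn K ξ),
      ψ (ξ r) * ((gg u (kerOn K ξ) W (u (unitVec K ξ)) : ℚ) : ℂ) =
      ∑ J with (W ⊔ K.map u ≤ J ∧ J ≤ K) ∧ ∀ v ∈ J, ξ v = 0,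
        (((-1) ^ (finrank F K - finrank F W) * moeb F (finrank F K - finrank F J) : ℚ) : ℂ) *
          ψ (ξ r) := by
    intro ξ hξ
    simp only [Finset.mem_filter, Finset.mem_univ, true_and] at hξ
    rw [gg_kerOn u hξ.1.1 hξ.2, Rat.cast_sum, Finset.mul_sum]
    exact Finset.sum_congr rfl fun J _ => mul_comm _ _
  rw [Finset.sum_congr rfl e1]
  rw [Finset.sum_comm' (t' := Finset.univ.filter fun J : Submodule F E =>
      W ⊔ K.map u ≤ J ∧ J ≤ K) (s' := fun J => Finset.univ.filter fun ξ : E → F =>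
        IsFunc K ξ ∧ ∀ v ∈ J, ξ v = 0)]
  swap
  · intro ξ J
    simp only [Finset.mem_filter, Finset.mem_univ, true_and]
    constructor
    · rintro ⟨⟨⟨a, b⟩, c⟩, ⟨d, e⟩⟩
      exact ⟨⟨a, e⟩, d⟩
    · rintro ⟨⟨a, e⟩, d⟩
      refine ⟨⟨⟨a, fun v hv => e _ (d.1 (le_sup_right (a := W) ⟨v, hv, rfl⟩))⟩, ?_⟩, d, e⟩
      intro v hv
      exact (mem_kerOn a).2 ⟨hWK hv, e v (d.1 ((le_sup_left : W ≤ W ⊔ K.map u) hv))⟩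
  have e2 : ∀ J ∈ (Finset.univ.filter fun J : Submodule F E => W ⊔ K.map u ≤ J ∧ J ≤ K),
      ∑ ξ : E → F with IsFunc K ξ ∧ ∀ v ∈ J, ξ v = 0,
        (((-1) ^ (finrank F K - finrank F W) * moeb F (finrank F K - finrank F J) : ℚ) : ℂ) *
          ψ (ξ r) =
      (((-1) ^ (finrank F K - finrank F W) * (moeb F (finrank F K - finrank F J) *
        (if r ∈ J then (Nat.card F : ℚ) ^ (finrank F K - finrank F J) else 0) -
        moeb F (finrank F K - finrank F J)) : ℚ) : ℂ) := by
    intro J hJ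
    simp only [Finset.mem_filter, Finset.mem_univ, true_and] at hJ
    rw [← Finset.mul_sum, sum_isFunc hψ hJ.2 hr]
    split_ifs <;> push_cast <;> ring
  rw [Finset.sum_congr rfl e2, ← Rat.cast_sum, ← Finset.mul_sum, Finset.sum_sub_distrib,
    sum_moeb_codim (sup_le hWK hK), if_neg, sub_zero, gg]
  · congr 2
    simp only [mul_ite, mul_zero]
    rw [← Finset.sum_filter, Finset.filter_filter]
    refine Finset.sum_congr rfl fun J _ => ?_
    rw [moeb, Nat.choose_succ_succ' _ 1, Nat.choose_one_right, pow_add]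
    ring
  · intro h
    exact hne (eq_of_sup_map_eq u R hN hW hRW h)

/-- The sum of the phases of all towers on `K` fixed by `1 + u`. -/
noncomputable def towerSum (ψ : AddChar F ℂ) (m : ℕ) (K : Submodule F E) (r : E) : ℂ :=
  ∑ ξ : Fin m → E → F, ∑ a : E → E → F,
    if IsTower m K ξ a ∧ (∀ i v, ξ i (v + u v) = ξ i v) ∧
      ∀ v w, a (v + u v) (w + u w) = a v w then ψ (phase u m K ξ r) else 0

lemma fixed_func_iff (hx : ∀ v, v + u v = 0 → v = 0) (hK : K.map u ≤ K) (h : IsFunc K ξ) :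
    (∀ v, ξ (v + u v) = ξ v) ↔ ∀ v ∈ K, ξ (u v) = 0 := by
  obtain ⟨⟨f, hf⟩, h0, -⟩ := h
  constructor
  · intro h v hv
    have h1 := h v
    have huv : u v ∈ K := hK ⟨v, hv, rfl⟩
    rw [hf _ (K.add_mem hv huv), map_add, hf v hv] at h1
    rw [hf _ huv]
    simpa using h1
  · intro h v
    by_cases hv : v ∈ K
    · have huv : u v ∈ K := hK ⟨v, hv, rfl⟩
      rw [hf _ (K.add_mem hv huv), map_add, hf v hv, ← hf _ huv, h v hv, add_zero]
    · rw [h0 v hv, h0]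
      intro hv'
      obtain ⟨w, hw, hwv⟩ := exists_preimage_of_stable hx hK hv'
      have : w - v = 0 := hx _ (by rw [map_sub, sub_add_sub_comm, hwv, sub_self])
      rw [sub_eq_zero] at this
      exact hv (this ▸ hw)

lemma towerSum_succ (hx : ∀ v, v + u v = 0 → v = 0) (hK : K.map u ≤ K) (ψ : AddChar F ℂ)
    (m : ℕ) (r : E) :
    towerSum u ψ (m + 1) K r = ∑ ξ : E → F with IsFunc K ξ ∧ ∀ v ∈ K, ξ (u v) = 0,
      ψ (ξ r) * towerSum u ψ m (kerOn K ξ) (u (unitVec K ξ)) := by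
  rw [towerSum, ← (Fin.consEquiv fun _ : Fin (m + 1) => E → F).sum_comp, Fintype.sum_prod_type,
    Finset.sum_filter]
  refine Finset.sum_congr rfl fun ξ _ => ?_
  split_ifs with h
  · rw [towerSum, Finset.mul_sum]
    refine Finset.sum_congr rfl fun η _ => ?_
    rw [Finset.mul_sum]
    refine Finset.sum_congr rfl fun a _ => ?_
    rw [mul_ite, mul_zero]
    have hfix := (fixed_func_iff u hx hK h.1).2 h.2
    refine if_congr ?_ ?_ rfl
    · simp only [Fin.consEquiv, Equiv.coe_fn_mk, IsTower, Fin.cons_zero, Fin.tail_cons,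
        Fin.forall_fin_succ, Fin.cons_succ, h.1, true_and]
      tauto
    · simp only [Fin.consEquiv, Equiv.coe_fn_mk, phase, Fin.cons_zero, Fin.tail_cons]
      rw [AddChar.map_add_eq_mul]
  · refine Finset.sum_eq_zero fun η _ => Finset.sum_eq_zero fun a _ => if_neg ?_
    rintro ⟨⟨h1, -⟩, h2, -⟩
    simp only [Fin.consEquiv, Equiv.coe_fn_mk, Fin.cons_zero] at h1
    have h2 := h2 0
    simp only [Fin.consEquiv, Equiv.coe_fn_mk, Fin.cons_zero] at h2
    exact h ⟨h1, (fixed_func_iff u hx hK h1).1 h2⟩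

lemma towerSum_zero (hx : ∀ v, v + u v = 0 → v = 0) (hK : K.map u ≤ K) (ψ : AddChar F ℂ)
    (r : E) :
    towerSum u ψ 0 K r = ((numAltNondeg u K : ℚ) : ℂ) := by
  have hfin := finite_forms (F := F) K
  let _ : Fintype (K →ₗ[F] K →ₗ[F] F) := Fintype.ofFinite _
  let e : (K →ₗ[F] K →ₗ[F] F) → E → E → F := fun f v w =>
    if h : v ∈ K ∧ w ∈ K then f ⟨v, h.1⟩ ⟨w, h.2⟩ else 0
  have he : ∀ f (v w : K), e f v w = f v w := fun f v w => dif_pos ⟨v.2, w.2⟩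
  have hinj : Function.Injective e := by
    intro f g h
    refine LinearMap.ext₂ fun v w => ?_
    rw [← he f, ← he g, h]
  have hstab : ∀ v, v + u v ∈ K ↔ v ∈ K := by
    intro v
    constructor
    · intro hv'
      obtain ⟨w, hw, hwv⟩ := exists_preimage_of_stable hx hK hv'
      have : w - v = 0 := hx _ (by rw [map_sub, sub_add_sub_comm, hwv, sub_self])
      rw [sub_eq_zero] at this
      exact this ▸ hw
    · exact fun hv => K.add_mem hv (hK ⟨v, hv, rfl⟩)
  have hres : ∀ v : K, ((v + resEnd u K v : K) : E) = v + u v := fun v => by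
    rw [Submodule.coe_add, resEnd_apply hK]
  have hset : (Finset.univ.filter fun a : E → E → F => IsForm K a ∧
      ∀ v w, a (v + u v) (w + u w) = a v w) = (Finset.univ.filter fun a : K →ₗ[F] K →ₗ[F] F =>
        a ∈ altInvForms (resEnd u K) ∧ LinearMap.ker a = ⊥).image e := by
    ext a
    simp only [Finset.mem_filter, Finset.mem_univ, true_and, Finset.mem_image]
    constructor
    · rintro ⟨⟨⟨f, hf, h1, h2⟩, h3⟩, h4⟩
      refine ⟨f, ⟨⟨h1, fun v w => ?_⟩, h2⟩, ?_⟩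
      · rw [← hf, ← hf, hres, hres, h4]
      · ext v w
        by_cases h : v ∈ K ∧ w ∈ K
        · rw [he f ⟨v, h.1⟩ ⟨w, h.2⟩, ← hf]
        · rw [h3 v w h]
          exact dif_neg h
    · rintro ⟨f, ⟨⟨h1, h2⟩, h3⟩, rfl⟩
      refine ⟨⟨⟨f, he f, h1, h3⟩, fun v w h => dif_neg h⟩, fun v w => ?_⟩
      by_cases h : v ∈ K ∧ w ∈ K
      · obtain ⟨hv, hw⟩ := h
        have := h2 ⟨v, hv⟩ ⟨w, hw⟩
        rw [← he, ← he, hres, hres] at this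
        exact this
      · change dite _ _ _ = dite _ _ _
        rw [dif_neg h, dif_neg]
        rwa [hstab, hstab]
  rw [towerSum, Fintype.sum_unique, ← Finset.sum_filter]
  have : ∀ ξ : Fin 0 → E → F, (Finset.univ.filter fun a : E → E → F => IsTower 0 K ξ a ∧
      (∀ i v, ξ i (v + u v) = ξ i v) ∧ ∀ v w, a (v + u v) (w + u w) = a v w) =
      (Finset.univ.filter fun a : E → E → F => IsForm K a ∧
      ∀ v w, a (v + u v) (w + u w) = a v w) := fun ξ => by
    ext a
    simp [IsTower]
  rw [this, hset, Finset.sum_image hinj.injOn]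
  simp only [phase, AddChar.map_zero_eq_one]
  rw [Finset.sum_const, nsmul_eq_mul, mul_one, numAltNondeg, Nat.card_eq_fintype_card,
    Fintype.card_subtype]
  push_cast
  rfl

/-- Closed form for the sums over towers. -/
lemma towerSum_eq (hx : ∀ v, v + u v = 0 → v = 0) {ψ : AddChar F ℂ} (hψ : ψ ≠ 1)
    (hR : R.map u = R) (hN : ∀ v, (u ^ N) v ∈ R) (m : ℕ) :
    ∀ K : Submodule F E, R ≤ K → K.map u ≤ K → ∀ r ∈ K,
    towerSum u ψ m K r = ((∑ W with ((R ≤ W ∧ W.map u ≤ W) ∧ W ≤ K) ∧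
      finrank F K = finrank F W + m, numAltNondeg u W * gg u K W r : ℚ) : ℂ) := by
  induction m with
  | zero =>
    intro K hRK hK r hr
    rw [towerSum_zero u hx hK, Finset.sum_eq_single K]
    · have : gg u K K r = 1 := by
        rw [gg, Finset.sum_eq_single K]
        · simp
        · intro J hJ hne
          simp only [Finset.mem_filter, Finset.mem_univ, true_and, sup_le_iff] at hJ
          exact absurd (le_antisymm hJ.1.2 hJ.1.1.1) hne
        · intro h
          exact absurd (by simp [hK, hr]) h
      rw [this, mul_one]
    · intro W hW hne
      simp only [Finset.mem_filter, Finset.mem_univ, true_and] at hW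
      exact absurd (Submodule.eq_of_le_of_finrank_eq hW.1.2 hW.2.symm) hne
    · intro h
      exact absurd (by simp [hK, hRK]) h
  | succ m ih =>
    intro K hRK hK r hr
    rw [towerSum_succ u hx hK]
    have e1 : ∀ ξ ∈ (Finset.univ.filter fun ξ : E → F => IsFunc K ξ ∧ ∀ v ∈ K, ξ (u v) = 0),
        ψ (ξ r) * towerSum u ψ m (kerOn K ξ) (u (unitVec K ξ)) =
        ∑ W with ((R ≤ W ∧ W.map u ≤ W) ∧ W ≤ kerOn K ξ) ∧ finrank F K = finrank F W + (m + 1),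
          ((numAltNondeg u W : ℚ) : ℂ) *
            (ψ (ξ r) * ((gg u (kerOn K ξ) W (u (unitVec K ξ)) : ℚ) : ℂ)) := by
      intro ξ hξ
      simp only [Finset.mem_filter, Finset.mem_univ, true_and] at hξ
      obtain ⟨h1, h2⟩ := hξ
      have hs : K.map u ≤ kerOn K ξ := by
        rintro _ ⟨v, hv, rfl⟩
        exact (mem_kerOn h1).2 ⟨hK ⟨v, hv, rfl⟩, h2 v hv⟩
      rw [ih (kerOn K ξ) (hR.symm.le.trans ((Submodule.map_mono hRK).trans hs))
        ((Submodule.map_mono (kerOn_le h1)).trans hs) _ (hs ⟨_, (unitVec_spec h1).1, rfl⟩),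
        Rat.cast_sum, Finset.mul_sum]
      refine Finset.sum_congr ?_ fun W _ => ?_
      · rw [finrank_kerOn h1]
        simp only [← add_assoc, add_left_inj]
      · push_cast; ring
    rw [Finset.sum_congr rfl e1]
    rw [Finset.sum_comm' (t' := Finset.univ.filter fun W : Submodule F E =>
      ((R ≤ W ∧ W.map u ≤ W) ∧ W ≤ K) ∧ finrank F K = finrank F W + (m + 1))
      (s' := fun W => Finset.univ.filter fun ξ : E → F =>
        (IsFunc K ξ ∧ ∀ v ∈ K, ξ (u v) = 0) ∧ W ≤ kerOn K ξ)]
    · rw [Rat.cast_sum]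
      refine Finset.sum_congr rfl fun W hW => ?_
      simp only [Finset.mem_filter, Finset.mem_univ, true_and] at hW
      obtain ⟨⟨⟨h1, h2⟩, h3⟩, h4⟩ := hW
      rw [← Finset.mul_sum, sum_gg_kerOn u hψ hN h2 h1 h3 _ hK hr, Rat.cast_mul]
      rintro rfl
      omega
    · intro ξ W
      simp only [Finset.mem_filter, Finset.mem_univ, true_and]
      constructor
      · rintro ⟨a, ⟨⟨b, c⟩, d⟩⟩
        exact ⟨⟨a, c⟩, ⟨⟨b, c.trans (kerOn_le a.1)⟩, d⟩⟩
      · rintro ⟨⟨a, c⟩, ⟨⟨b, -⟩, d⟩⟩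
        exact ⟨a, ⟨⟨b, c⟩, d⟩⟩

end TowerSums

section Combine

variable {F E : Type*} [Field F] [Finite F] [AddCommGroup E] [Module F E] [Finite E]

noncomputable local instance : Fintype (Submodule F E) := Fintype.ofFinite _
noncomputable local instance : Fintype E := Fintype.ofFinite _
noncomputable local instance : Fintype F := Fintype.ofFinite _

lemma exists_stable_range (u : E →ₗ[F] E) :
    ∃ (R : Submodule F E) (N : ℕ), R.map u = R ∧ ∀ v, (u ^ N) v ∈ R := by
  obtain ⟨N, hN⟩ := IsArtinian.monotone_stabilizes (LinearMap.iterateRange u)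
  refine ⟨LinearMap.range (u ^ N), N, ?_, fun v => ⟨v, rfl⟩⟩
  have h := hN (N + 1) (Nat.le_succ N)
  have h' : LinearMap.range (u ^ N) = LinearMap.range (u ^ (N + 1)) := h
  rw [← LinearMap.range_comp, ← Module.End.mul_eq_comp, ← pow_succ', ← h']

/-- Nondegenerate twisted forms are counted by the phases of the fixed towers. -/
lemma numTwNondeg_eq_sum_towerSum (u : E →ₗ[F] E) (h2 : (2 : F) ≠ 0)
    (hx : ∀ v, v + u v = 0 → v = 0) {ψ : AddChar F ℂ} (hψ : ψ ≠ 1) :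
    ((numTwNondeg u : ℚ) : ℂ) = ∑ m ∈ Finset.range (finrank F E + 1), towerSum u ψ m ⊤ 0 := by
  obtain ⟨R, N, hR, hN⟩ := exists_stable_range u
  rw [numTwNondeg_eq_sum u h2 hR hN hx]
  have e1 : ∀ m ∈ Finset.range (finrank F E + 1), towerSum u ψ m ⊤ 0 =
      ∑ W : Submodule F E with R ≤ W ∧ W.map u ≤ W, if finrank F E = finrank F W + m then
        ((numAltNondeg u W * gg u ⊤ W 0 : ℚ) : ℂ) else 0 := by
    intro m _
    rw [towerSum_eq u hx hψ hR hN m ⊤ le_top le_top 0 (Submodule.zero_mem _), Rat.cast_sum,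
      ← Finset.sum_filter, Finset.filter_filter]
    refine Finset.sum_congr ?_ fun _ _ => rfl
    ext W
    simp
  rw [Finset.sum_congr rfl e1, Finset.sum_comm, Rat.cast_sum]
  refine Finset.sum_congr rfl fun W _ => ?_
  have hW : finrank F W ≤ finrank F E := Submodule.finrank_le W
  rw [Finset.sum_eq_single (finrank F E - finrank F W), if_pos (by omega)]
  · intro m _ hm
    exact if_neg (by omega)
  · intro h
    exact absurd (Finset.mem_range.2 (by omega)) h

end Combine

section Transport

variable {F E : Type*} [Field F] [Finite F] [AddCommGroup E] [Module F E] [Finite E]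

lemma isFunc_transport (g : E ≃ₗ[F] E) {K K' : Submodule F E} {ξ ξ' : E → F}
    (hK : ∀ v, g v ∈ K' ↔ v ∈ K) (hξ : ∀ v, ξ' (g v) = ξ v) (h : IsFunc K ξ) :
    IsFunc K' ξ' := by
  obtain ⟨⟨f, hf⟩, h0, v, hv, hv'⟩ := h
  refine ⟨⟨f ∘ₗ g.symm.toLinearMap, fun v hv => ?_⟩, fun v hv => ?_, g v, (hK v).2 hv, ?_⟩
  · obtain ⟨v, rfl⟩ := g.surjective v
    simp [hξ, hf v ((hK v).1 hv)]
  · obtain ⟨v, rfl⟩ := g.surjective v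
    rw [hξ, h0 v ((hK v).not.1 hv)]
  · rwa [hξ]

lemma isForm_transport (g : E ≃ₗ[F] E) {K K' : Submodule F E} {a a' : E → E → F}
    (hK : ∀ v, g v ∈ K' ↔ v ∈ K) (ha : ∀ v w, a' (g v) (g w) = a v w) (h : IsForm K a) :
    IsForm K' a' := by
  obtain ⟨⟨f, hf, h1, h2⟩, h0⟩ := h
  have hs : ∀ v ∈ K', g.symm v ∈ K := fun v hv => by rw [← hK, g.apply_symm_apply]; exact hv
  let j : K' →ₗ[F] K := g.symm.toLinearMap.restrict hs
  have hj : ∀ v : K', g (j v) = v := fun v => g.apply_symm_apply _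
  refine ⟨⟨f.compl₁₂ j j, fun v w => ?_, fun v => h1 _, ?_⟩, fun v w hvw => ?_⟩
  · rw [LinearMap.compl₁₂_apply, ← hf, ← hj v, ← hj w, ha]
  · rw [eq_bot_iff]
    intro v hv
    have h3 : j v ∈ LinearMap.ker f := by
      rw [LinearMap.mem_ker]
      ext w
      have h4 : j ⟨g w, (hK w).2 w.2⟩ = w := Subtype.ext (g.symm_apply_apply _)
      have := LinearMap.congr_fun (LinearMap.mem_ker.1 hv) ⟨g w, (hK w).2 w.2⟩
      rw [LinearMap.compl₁₂_apply, h4] at this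
      exact this
    rw [h2, Submodule.mem_bot] at h3
    rw [Submodule.mem_bot, ← Submodule.coe_eq_zero, ← hj v, h3]
    simp
  · obtain ⟨v, rfl⟩ := g.surjective v
    obtain ⟨w, rfl⟩ := g.surjective w
    rw [ha, h0]
    rwa [← hK, ← hK]

lemma mem_kerOn_transport (g : E ≃ₗ[F] E) {K K' : Submodule F E} {ξ ξ' : E → F} {c : F}
    (hc : c * c = 1) (hK : ∀ v, g v ∈ K' ↔ v ∈ K) (hξ : ∀ v, ξ' (g v) = c * ξ v)
    (h : IsFunc K ξ) (h' : IsFunc K' ξ') (v : E) : g v ∈ kerOn K' ξ' ↔ v ∈ kerOn K ξ := by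
  have hc0 : c ≠ 0 := left_ne_zero_of_mul_eq_one hc
  rw [mem_kerOn h, mem_kerOn h', hK, hξ]
  simp [hc0]

lemma isTower_transport (g : E ≃ₗ[F] E) {a a' : E → E → F}
    (ha : ∀ v w, a' (g v) (g w) = a v w) {m : ℕ} :
    ∀ {K K' : Submodule F E} {ξ ξ' : Fin m → E → F}, (∀ v, g v ∈ K' ↔ v ∈ K) →
      (∀ i v, ξ' i (g v) = ξ i v) → IsTower m K ξ a → IsTower m K' ξ' a' := by
  induction m with
  | zero => exact fun hK _ h => isForm_transport g hK ha h
  | succ m ih =>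
    intro K K' ξ ξ' hK hξ h
    have h' := isFunc_transport g hK (hξ 0) h.1
    exact ⟨h', ih (mem_kerOn_transport g (c := 1) (by ring) hK (by simpa using hξ 0) h.1 h')
      (fun i v => hξ _ v) h.2⟩

lemma isTower_func {a : E → E → F} {m : ℕ} {K : Submodule F E} {ξ : Fin m → E → F}
    (h : IsTower m K ξ a) (i : Fin m) (hi : i.val = 0) : IsFunc K (ξ i) := by
  cases m with
  | zero => exact i.elim0
  | succ m =>
    have : i = 0 := Fin.ext hi
    subst this
    exact h.1

/-- The functionals and the form of a tower on `K` are supported on `K`. -/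
lemma isTower_support {a : E → E → F} {m : ℕ} :
    ∀ {K : Submodule F E} {ξ : Fin m → E → F}, IsTower m K ξ a →
      (∀ i v, v ∉ K → ξ i v = 0) ∧ ∀ v w, ¬ (v ∈ K ∧ w ∈ K) → a v w = 0 := by
  induction m with
  | zero => exact fun h => ⟨fun i => i.elim0, h.2⟩
  | succ m ih =>
    intro K ξ h
    obtain ⟨h1, h2⟩ := ih h.2
    have hle := kerOn_le h.1
    refine ⟨fun i => ?_, fun v w hvw => h2 v w fun hh => hvw ⟨hle hh.1, hle hh.2⟩⟩
    refine Fin.cases ?_ (fun i => ?_) i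
    · exact h.1.2.1
    · exact fun v hv => h1 i v fun hh => hv (hle hh)

lemma phase_transport (g : E ≃ₗ[F] E) (u u' : E →ₗ[F] E) (hu : ∀ v, u' (g v) = g (u v))
    {δ : F} (hδ : δ * δ = 1) {a a' : E → E → F} {m : ℕ} :
    ∀ {K K' : Submodule F E} {ξ ξ' : Fin m → E → F} {c : F} {r r' : E}, c * c = 1 →
      IsTower m K ξ a → IsTower m K' ξ' a' → (∀ v, g v ∈ K' ↔ v ∈ K) →
      (∀ i v, ξ' i (g v) = c * δ ^ i.val * ξ i v) → (∀ i v, ξ i (v + u v) = ξ i v) →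
      (∀ v ∈ K, v + u v ∈ K) → (∀ i, i.val = 0 → ξ' i r' = δ * ξ i r) →
      phase u' m K' ξ' r' = δ * phase u m K ξ r := by
  induction m with
  | zero => intros; simp [phase]
  | succ m ih =>
    intro K K' ξ ξ' c r r' hc h h' hK hξ hfix hst hr
    have hc0 : c ≠ 0 := left_ne_zero_of_mul_eq_one hc
    have hξ0 : ∀ v, ξ' 0 (g v) = c * ξ 0 v := fun v => by simpa using hξ 0 v
    have hker := mem_kerOn_transport g hc hK hξ0 h.1 h'.1
    obtain ⟨e1, e2⟩ := unitVec_spec h.1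
    obtain ⟨e1', e2'⟩ := unitVec_spec h'.1
    have hst' : ∀ v ∈ kerOn K (ξ 0), v + u v ∈ kerOn K (ξ 0) := fun v hv => by
      rw [mem_kerOn h.1] at hv ⊢
      exact ⟨hst v hv.1, by rw [hfix, hv.2]⟩
    rw [phase, phase, hr 0 rfl, mul_add]
    congr 1
    refine ih (c := c * δ) (by rw [mul_mul_mul_comm, hc, hδ, one_mul]) h.2 h'.2 hker ?_
      (fun i v => hfix _ v) hst' ?_
    · intro i v
      change ξ' i.succ (g v) = c * δ * δ ^ i.val * ξ i.succ v
      rw [hξ, Fin.val_succ, pow_succ']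
      ring
    · intro i hi
      have hT := isTower_func h.2 i hi
      have hT' := isTower_func h'.2 i hi
      obtain ⟨f, hf⟩ := hT.1
      obtain ⟨f', hf'⟩ := hT'.1
      have hi' : ∀ v, Fin.tail ξ' i (g v) = c * δ * Fin.tail ξ i v := fun v => by
        change ξ' i.succ (g v) = _
        rw [hξ, Fin.val_succ, hi]
        simp [Fin.tail]
      obtain ⟨w, hw⟩ := g.surjective (unitVec K' (ξ' 0))
      have hw0 : w ∈ K := by rw [← hK, hw]; exact e1'
      have hw1 : ξ 0 w = c := by
        have := hξ0 w
        rw [hw, e2'] at this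
        calc ξ 0 w = (c * c) * ξ 0 w := by rw [hc, one_mul]
          _ = c := by rw [mul_assoc, ← this, mul_one]
      obtain ⟨f0, hf0⟩ := h.1.1
      have hk : w - c • unitVec K (ξ 0) ∈ kerOn K (ξ 0) := by
        rw [mem_kerOn h.1]
        have := K.sub_mem hw0 (K.smul_mem c e1)
        refine ⟨this, ?_⟩
        rw [hf0 _ this, map_sub, map_smul, ← hf0 _ hw0, ← hf0 _ e1, hw1, e2]
        simp
      have hu1 : ∀ v ∈ K, u v ∈ kerOn K (ξ 0) := fun v hv => by
        have h3 := K.sub_mem (hst v hv) hv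
        have h4 : v + u v - v = u v := by abel
        rw [mem_kerOn h.1]
        refine ⟨h4 ▸ h3, ?_⟩
        rw [← h4, hf0 _ h3, map_sub, ← hf0 _ (hst v hv), ← hf0 _ hv, hfix, sub_self]
      have h5 : ∀ v ∈ kerOn K (ξ 0), Fin.tail ξ i (u v) = 0 := fun v hv => by
        have h3 := (kerOn K (ξ 0)).sub_mem (hst' v hv) hv
        have h4 : v + u v - v = u v := by abel
        rw [← h4, hf _ h3, map_sub, ← hf _ (hst' v hv), ← hf _ hv]
        change ξ i.succ _ - ξ i.succ _ = 0
        rw [hfix, sub_self]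
      rw [← hw, hu, hi']
      have h6 : u w = u (w - c • unitVec K (ξ 0)) + c • u (unitVec K (ξ 0)) := by
        rw [map_sub, map_smul]; abel
      have h7 := h5 _ hk
      have h8 := hu1 _ (kerOn_le h.1 hk)
      have h9 := hu1 _ e1
      rw [h6, hf _ ((kerOn K (ξ 0)).add_mem h8 ((kerOn K (ξ 0)).smul_mem c h9)), map_add, map_smul,
        ← hf _ h8, h7, ← hf _ h9, smul_eq_mul, zero_add]
      linear_combination (δ * Fin.tail ξ i (u (unitVec K (ξ 0)))) * hc

lemma phase_mul (u u' u'' : E →ₗ[F] E) (hu : ∀ v, u'' v = u v + u' v + u (u' v))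
    {a : E → E → F} {m : ℕ} :
    ∀ {K : Submodule F E} {ξ : Fin m → E → F} {r r' r'' : E},
      IsTower m K ξ a → (∀ i v, ξ i (v + u v) = ξ i v) → (∀ i v, ξ i (v + u' v) = ξ i v) →
      (∀ v ∈ K, v + u v ∈ K) → (∀ v ∈ K, v + u' v ∈ K) →
      (∀ i, i.val = 0 → ξ i r'' = ξ i r + ξ i r') →
      phase u'' m K ξ r'' = phase u m K ξ r + phase u' m K ξ r' := by
  induction m with
  | zero => intros; simp [phase]
  | succ m ih =>
    intro K ξ r r' r'' h hfix hfix' hst hst' hr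
    obtain ⟨e1, e2⟩ := unitVec_spec h.1
    obtain ⟨f0, hf0⟩ := h.1.1
    have key : ∀ (y : E →ₗ[F] E), (∀ i v, ξ i (v + y v) = ξ i v) → (∀ v ∈ K, v + y v ∈ K) →
        (∀ v ∈ kerOn K (ξ 0), v + y v ∈ kerOn K (ξ 0)) ∧ ∀ v ∈ K, y v ∈ kerOn K (ξ 0) := by
      intro y hy hy'
      refine ⟨fun v hv => ?_, fun v hv => ?_⟩
      · rw [mem_kerOn h.1] at hv ⊢
        exact ⟨hy' v hv.1, by rw [hy, hv.2]⟩
      · have h3 := K.sub_mem (hy' v hv) hv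
        have h4 : v + y v - v = y v := by abel
        rw [mem_kerOn h.1]
        refine ⟨h4 ▸ h3, ?_⟩
        rw [← h4, hf0 _ h3, map_sub, ← hf0 _ (hy' v hv), ← hf0 _ hv, hy, sub_self]
    obtain ⟨k1, k2⟩ := key u hfix hst
    obtain ⟨k1', k2'⟩ := key u' hfix' hst'
    rw [phase, phase, phase, hr 0 rfl, add_add_add_comm]
    congr 1
    refine ih h.2 (fun i v => hfix _ v) (fun i v => hfix' _ v) k1 k1' ?_
    intro i hi
    obtain ⟨f, hf⟩ := (isTower_func h.2 i hi).1
    set e := unitVec K (ξ 0)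
    have h1 := k2 e e1
    have h2 := k2' e e1
    have h3 := k2 _ (kerOn_le h.1 h2)
    have h4 : u (u' e) = (u' e + u (u' e)) - u' e := by abel
    have h5 : f (u (u' e)) = 0 := by
      rw [h4, map_sub, ← hf _ (k1 _ h2), ← hf _ h2]
      change ξ i.succ _ - ξ i.succ _ = 0
      rw [hfix, sub_self]
    rw [hu, hf _ ((kerOn K (ξ 0)).add_mem ((kerOn K (ξ 0)).add_mem h1 h2) h3), map_add, map_add,
      h5, add_zero, ← hf _ h1, ← hf _ h2]

/-- Every tower is respected, up to alternating signs, by an involution. -/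
lemma exists_involution {a : E → E → F} {m : ℕ} :
    ∀ {K : Submodule F E} {ξ : Fin m → E → F} {c : F}, c * c = 1 → IsTower m K ξ a →
      ∃ s : E →ₗ[F] E, (∀ v ∈ K, s v ∈ K) ∧ (∀ v ∈ K, s (s v) = v) ∧
        (∀ i, ∀ v ∈ K, ξ i (s v) = c * (-1) ^ i.val * ξ i v) ∧
        ∀ v ∈ K, ∀ w ∈ K, a (s v) (s w) = a v w := by
  induction m with
  | zero =>
    intro K ξ c _ _
    exact ⟨LinearMap.id, fun v hv => hv, fun _ _ => rfl, fun i => i.elim0, fun _ _ _ _ => rfl⟩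
  | succ m ih =>
    intro K ξ c hc h
    have hc0 : c ≠ 0 := left_ne_zero_of_mul_eq_one hc
    obtain ⟨s', h1, h2, h3, h4⟩ := ih (c := -c) (by rw [neg_mul_neg, hc]) h.2
    obtain ⟨f, hf⟩ := h.1.1
    obtain ⟨e1, e2⟩ := unitVec_spec h.1
    set e := unitVec K (ξ 0)
    have hle := kerOn_le h.1
    let s : E →ₗ[F] E := s' ∘ₗ (LinearMap.id - f.smulRight e) + c • f.smulRight e
    have hs : ∀ v, s v = s' (v - f v • e) + c • f v • e := fun v => rfl
    have hk : ∀ v ∈ K, v - f v • e ∈ kerOn K (ξ 0) := fun v hv => by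
      rw [mem_kerOn h.1]
      have := K.sub_mem hv (K.smul_mem (f v) e1)
      refine ⟨this, ?_⟩
      rw [hf _ this, map_sub, map_smul, ← hf e e1, e2, smul_eq_mul, mul_one, sub_self]
    have hfk : ∀ v ∈ kerOn K (ξ 0), f v = 0 := fun v hv => by
      rw [← hf v (hle hv), ((mem_kerOn h.1).1 hv).2]
    have hsk : ∀ v ∈ kerOn K (ξ 0), s v = s' v := fun v hv => by
      rw [hs, hfk v hv]; simp
    have hsK : ∀ v ∈ K, s v ∈ K := fun v hv => by
      rw [hs]
      exact K.add_mem (hle (h1 _ (hk v hv))) (K.smul_mem _ (K.smul_mem _ e1))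
    have hfs : ∀ v ∈ K, f (s v) = c * f v := fun v hv => by
      rw [hs, map_add, hfk _ (h1 _ (hk v hv)), map_smul, map_smul, ← hf e e1, e2]
      simp
    have hmem : ∀ v ∈ K, (s v ∈ kerOn K (ξ 0) ↔ v ∈ kerOn K (ξ 0)) := fun v hv => by
      rw [mem_kerOn h.1, mem_kerOn h.1, hf _ (hsK v hv), hfs v hv, hf v hv]
      simp [hc0, hv, hsK v hv]
    obtain ⟨z1, z2⟩ := isTower_support h.2
    refine ⟨s, hsK, fun v hv => ?_, fun i => ?_, fun v hv w hw => ?_⟩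
    · rw [hs (s v), hfs v hv]
      have : s v - (c * f v) • e = s' (v - f v • e) := by
        rw [hs, mul_smul]; abel
      rw [this, h2 _ (hk v hv), smul_smul, ← mul_assoc, hc, one_mul]
      abel
    · refine Fin.cases (fun v hv => ?_) (fun i v hv => ?_) i
      · rw [hf _ (hsK v hv), hfs v hv, hf v hv]
        simp
      · by_cases hvk : v ∈ kerOn K (ξ 0)
        · rw [hsk v hvk]
          have := h3 i v hvk
          change ξ i.succ (s' v) = _ * ξ i.succ v at this
          rw [this, Fin.val_succ, pow_succ]
          ring
        · have y1 : ξ i.succ v = 0 := z1 i v hvk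
          have y2 : ξ i.succ (s v) = 0 := z1 i _ ((hmem v hv).not.2 hvk)
          rw [y1, y2, mul_zero]
    · by_cases hh : v ∈ kerOn K (ξ 0) ∧ w ∈ kerOn K (ξ 0)
      · rw [hsk v hh.1, hsk w hh.2, h4 v hh.1 w hh.2]
      · rw [z2 v w hh, z2]
        rwa [hmem v hv, hmem w hw]

end Transport

section Schur

variable {G V : Type*} [Group G] [Fintype G] [AddCommGroup V] [Module ℂ V] [FiniteDimensional ℂ V]

lemma ker_eq_bot_of_invariant (ρ : Representation ℂ G V) (τ : G →* G)
    (hirr : ∀ W : Submodule ℂ V, (∀ g, ∀ v ∈ W, ρ g v ∈ W) → W = ⊥ ∨ W = ⊤)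
    {B : V →ₗ[ℂ] V →ₗ[ℂ] ℂ} (hB : ∀ g v w, B (ρ g v) (ρ (τ g) w) = B v w) (h0 : B ≠ 0) :
    LinearMap.ker B = ⊥ := by
  refine (hirr _ fun g v hv => ?_).resolve_right fun h => h0 (LinearMap.ker_eq_top.1 h)
  rw [LinearMap.mem_ker] at hv ⊢
  ext w
  have h1 : w = ρ (τ g) (ρ (τ g⁻¹) w) := by
    rw [← Module.End.mul_apply, ← map_mul, ← map_mul, mul_inv_cancel, map_one, map_one]
    rfl
  rw [h1, hB, hv, LinearMap.zero_apply, LinearMap.zero_apply]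

lemma exists_smul_of_invariant [Nontrivial V] (ρ : Representation ℂ G V) (τ : G →* G)
    (hirr : ∀ W : Submodule ℂ V, (∀ g, ∀ v ∈ W, ρ g v ∈ W) → W = ⊥ ∨ W = ⊤)
    {B C : V →ₗ[ℂ] V →ₗ[ℂ] ℂ} (hB : ∀ g v w, B (ρ g v) (ρ (τ g) w) = B v w) (h0 : B ≠ 0)
    (hC : ∀ g v w, C (ρ g v) (ρ (τ g) w) = C v w) : ∃ c : ℂ, C = c • B := by
  have hk := ker_eq_bot_of_invariant ρ τ hirr hB h0
  let e : V ≃ₗ[ℂ] Module.Dual ℂ V := LinearMap.linearEquivOfInjective B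
    (LinearMap.ker_eq_bot.1 hk) Subspace.dual_finrank_eq.symm
  obtain ⟨c, hc⟩ := Module.End.exists_eigenvalue (e.symm.toLinearMap ∘ₗ C)
  obtain ⟨v, hv⟩ := hc.exists_hasEigenvector
  refine ⟨c, ?_⟩
  by_contra hne
  have hD : ∀ g v w, (C - c • B) (ρ g v) (ρ (τ g) w) = (C - c • B) v w := fun g v w => by
    simp [hB, hC]
  have hker := ker_eq_bot_of_invariant ρ τ hirr hD (sub_ne_zero.2 hne)
  have h1 : e.symm (C v) = c • v := hv.apply_eq_smul
  have h2 : C v = c • B v := by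
    rw [LinearEquiv.symm_apply_eq, map_smul] at h1
    exact h1
  have h3 : v ∈ LinearMap.ker (C - c • B) := by
    rw [LinearMap.mem_ker, LinearMap.sub_apply, h2]
    simp
  rw [hker, Submodule.mem_bot] at h3
  exact hv.2 h3

/-- The twisted Frobenius-Schur theorem for irreducible representations `ρ` whose dual is the
twist of `ρ` by an involutive automorphism `τ`. -/
theorem twisted_frobeniusSchur (ρ : Representation ℂ G V) (τ : G →* G) (hτ : ∀ g, τ (τ g) = g)
    (hirr : ∀ W : Submodule ℂ V, (∀ g, ∀ v ∈ W, ρ g v ∈ W) → W = ⊥ ∨ W = ⊤)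
    (hnorm : ∑ g, LinearMap.trace ℂ V (ρ g) * LinearMap.trace ℂ V (ρ g⁻¹) = Nat.card G)
    (hχ : ∀ g, LinearMap.trace ℂ V (ρ (τ g)) = LinearMap.trace ℂ V (ρ g⁻¹)) :
    ∃ ε : ℂ, (ε = 1 ∨ ε = -1) ∧ (∃ B : V →ₗ[ℂ] V →ₗ[ℂ] ℂ, LinearMap.ker B = ⊥ ∧
      (∀ g v w, B (ρ g v) (ρ (τ g) w) = B v w) ∧ ∀ v w, B w v = ε * B v w) ∧
      ∑ g, LinearMap.trace ℂ V (ρ (g * τ g)) = ε * Nat.card G := by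
  have hG : (Nat.card G : ℂ) ≠ 0 := Nat.cast_ne_zero.2 Nat.card_pos.ne'
  have hnt : Nontrivial V := by
    by_contra h
    rw [not_nontrivial_iff_subsingleton] at h
    have h1 : ∀ g, LinearMap.trace ℂ V (ρ g) = 0 := fun g => by
      rw [Subsingleton.elim (ρ g) 0, map_zero]
    rw [Finset.sum_eq_zero fun g _ => by rw [h1, zero_mul]] at hnorm
    exact hG hnorm.symm
  let b := Module.finBasis ℂ V
  let A : G → Matrix _ _ ℂ := fun g => LinearMap.toMatrix b b (ρ g)
  have htr : ∀ g, LinearMap.trace ℂ V (ρ g) = ∑ i, A g i i := fun g => by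
    rw [LinearMap.trace_eq_matrix_trace ℂ b]; rfl
  have hA : ∀ g i k, A g i k = b.coord i (ρ g (b k)) := fun g i k => by
    simp [A, LinearMap.toMatrix_apply]
  let T : (V →ₗ[ℂ] V →ₗ[ℂ] ℂ) → (V →ₗ[ℂ] V →ₗ[ℂ] ℂ) := fun B => ∑ g, B.compl₁₂ (ρ g) (ρ (τ g))
  have hT : ∀ B v w, T B v w = ∑ g, B (ρ g v) (ρ (τ g) w) := fun B v w => by
    simp [T, LinearMap.sum_apply]
  have hTinv : ∀ B g v w, T B (ρ g v) (ρ (τ g) w) = T B v w := fun B g v w => by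
    rw [hT, hT, ← Equiv.sum_comp (Equiv.mulRight g) fun x => B (ρ x v) (ρ (τ x) w)]
    refine Finset.sum_congr rfl fun x _ => ?_
    simp only [Equiv.coe_mulRight, map_mul]
    rfl
  let Z : Fin (finrank ℂ V) → Fin (finrank ℂ V) → (V →ₗ[ℂ] V →ₗ[ℂ] ℂ) := fun i j =>
    (LinearMap.mul ℂ ℂ).compl₁₂ (b.coord i) (b.coord j)
  have hTZ : ∀ i j k l, T (Z i j) (b k) (b l) = ∑ g, A g i k * A (τ g) j l := fun i j k l => by
    rw [hT]
    refine Finset.sum_congr rfl fun g _ => ?_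
    rw [hA, hA]; rfl
  have hsum : ∑ i, ∑ k, T (Z i k) (b i) (b k) = Nat.card G := by
    rw [← hnorm]
    simp only [hTZ]
    rw [Finset.sum_congr rfl fun i _ => Finset.sum_comm, Finset.sum_comm]
    refine Finset.sum_congr rfl fun g _ => ?_
    rw [← hχ, htr, htr, Finset.sum_mul_sum]
  have hex : ∃ i k, T (Z i k) ≠ 0 := by
    by_contra! h
    apply hG
    rw [← hsum]
    simp [h]
  obtain ⟨i0, k0, hB0⟩ := hex
  set B := T (Z i0 k0) with hBdef
  have hB : ∀ g v w, B (ρ g v) (ρ (τ g) w) = B v w := hTinv _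
  have hBker := ker_eq_bot_of_invariant ρ τ hirr hB hB0
  obtain ⟨ε, hε⟩ := exists_smul_of_invariant (C := B.flip) ρ τ hirr hB hB0 fun g v w => by
    rw [LinearMap.flip_apply, LinearMap.flip_apply]
    conv_lhs => rw [← hτ g]
    rw [hτ (τ g)]
    exact hB (τ g) w v
  have hε' : ∀ v w, B w v = ε * B v w := fun v w => by
    rw [← LinearMap.flip_apply B, hε]; rfl
  have hε1 : ε = 1 ∨ ε = -1 := by
    have h1 : ε * ε = 1 := by
      by_contra hne
      apply hB0
      ext v w
      have h2 := hε' v w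
      rw [hε' w v, ← mul_assoc] at h2
      have h3 : (ε * ε - 1) * B w v = 0 := by linear_combination -h2
      rw [LinearMap.zero_apply, LinearMap.zero_apply, hε' w v,
        (mul_eq_zero.1 h3).resolve_left (sub_ne_zero.2 hne), mul_zero]
    exact mul_self_eq_one_iff.1 h1
  have hc : ∀ i k, ∃ c : ℂ, T (Z i k) = c • B := fun i k =>
    exists_smul_of_invariant ρ τ hirr hB hB0 (hTinv _)
  choose c hc using hc
  refine ⟨ε, hε1, ⟨B, hBker, hB, hε'⟩, ?_⟩
  have h1 : ∑ g, LinearMap.trace ℂ V (ρ (g * τ g)) = ∑ i, ∑ k, T (Z i k) (b k) (b i) := by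
    simp only [hTZ]
    rw [Finset.sum_congr rfl fun i _ => Finset.sum_comm, Finset.sum_comm]
    refine Finset.sum_congr rfl fun g _ => ?_
    rw [map_mul, LinearMap.trace_eq_matrix_trace ℂ b, LinearMap.toMatrix_mul]
    rfl
  rw [h1, ← hsum, Finset.mul_sum]
  refine Finset.sum_congr rfl fun i _ => ?_
  rw [Finset.mul_sum]
  refine Finset.sum_congr rfl fun k _ => ?_
  rw [hc]
  simp only [LinearMap.smul_apply, smul_eq_mul]
  rw [hε' (b i) (b k)]
  ring

end Schur

section Simple

open CategoryTheory

lemma stable_of_simple {G : Type} [Group G] (V : FDRep ℂ G) (hV : Simple V)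
    (W : Submodule ℂ V) (hW : ∀ g, ∀ v ∈ W, V.ρ g v ∈ W) : W = ⊥ ∨ W = ⊤ := by
  let σ : Representation ℂ G W :=
    { toFun := fun g => (V.ρ g).restrict (hW g)
      map_one' := by ext v; simp
      map_mul' := fun g h => by ext v; simp }
  let f : FDRep.of σ ⟶ V := FDRep.forget₂HomLinearEquiv _ _ (Rep.ofHom ⟨W.subtype, fun g => rfl⟩)
  have hf : ∀ w : W, f.hom.hom w = (w : V) := fun w => rfl
  have hmono : Mono f := ConcreteCategory.mono_of_injective f fun a b h => Subtype.ext h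
  by_cases h0 : f = 0
  · left
    rw [eq_bot_iff]
    intro v hv
    have := hf ⟨v, hv⟩
    rw [h0] at this
    exact this.symm
  · right
    have := isIso_of_mono_of_nonzero h0
    rw [eq_top_iff]
    intro v _
    have h1 := (FDRep.isoToLinearEquiv (asIso f)).apply_symm_apply v
    have h2 := hf ((FDRep.isoToLinearEquiv (asIso f)).symm v)
    have h3 : ((FDRep.isoToLinearEquiv (asIso f)).symm v : W).1 = v := h2.symm.trans h1
    rw [← h3]
    exact Subtype.prop _

end Simple

section Multiplicity

lemma even_finrank_of_skew {U : Type*} [AddCommGroup U] [Module ℂ U] [FiniteDimensional ℂ U]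
    (c : U →ₗ[ℂ] U →ₗ[ℂ] ℂ) (hc : LinearMap.ker c = ⊥) (hskew : ∀ v w, c w v = -c v w) :
    Even (finrank ℂ U) := by
  let b := Module.finBasis ℂ U
  let A := LinearMap.toMatrix₂ b b c
  have h1 : A.det ≠ 0 := (LinearMap.separatingLeft_iff_det_ne_zero b).1
    (LinearMap.separatingLeft_iff_ker_eq_bot.2 hc)
  have h2 : A.transpose = -A := by
    ext i j
    rw [Matrix.transpose_apply, Matrix.neg_apply]
    change LinearMap.toMatrix₂ b b c j i = -LinearMap.toMatrix₂ b b c i j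
    rw [LinearMap.toMatrix₂_apply, LinearMap.toMatrix₂_apply, hskew]
  have h3 := congrArg Matrix.det h2
  rw [Matrix.det_transpose, Matrix.det_neg, Fintype.card_fin] at h3
  by_contra h
  rw [Nat.not_even_iff_odd] at h
  rw [h.neg_one_pow] at h3
  apply h1
  linear_combination h3 / 2

variable {H V : Type*} [Group H] [Fintype H] [AddCommGroup V] [Module ℂ V] [FiniteDimensional ℂ V]

lemma exists_multiplicity (ρ : Representation ℂ H V) (θ : H →* ℂ) :
    ∃ k : ℕ, ∑ h, θ h * LinearMap.trace ℂ V (ρ h) = Nat.card H * (k : ℂ) ∧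
    (∀ (b : V →ₗ[ℂ] V →ₗ[ℂ] ℂ), LinearMap.ker b = ⊥ →
      (∀ h v w, b (ρ h v) (ρ h w) = b v w) → (∀ v w, b w v = -b v w) →
      ∀ (S : V →ₗ[ℂ] V) (σ : H ≃ H), (∀ v, S (S v) = v) → (∀ v w, b (S v) (S w) = b v w) →
      (∀ h v, S (ρ h v) = ρ (σ h) (S v)) → (∀ h, θ (σ h) = θ h⁻¹) → Even k) := by
  have hH : (Nat.card H : ℂ) ≠ 0 := Nat.cast_ne_zero.2 Nat.card_pos.ne'
  let _ : Invertible (Nat.card H : ℂ) := invertibleOfNonzero hH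
  let π : Representation ℂ H V :=
    { toFun := fun h => θ h • ρ h
      map_one' := by simp
      map_mul' := fun g h => by
        rw [map_mul, map_mul, smul_mul_smul_comm] }
  have hπ : ∀ h v, π h v = θ h • ρ h v := fun h v => rfl
  refine ⟨finrank ℂ π.invariants, ?_, ?_⟩
  · rw [← Representation.card_inv_mul_sum_char_eq_finrank, mul_inv_cancel_left₀ hH]
    refine Finset.sum_congr rfl fun h _ => ?_
    change _ = LinearMap.trace ℂ V (θ h • ρ h)
    rw [map_smul, smul_eq_mul]
  · intro b hb hinv hskew S σ hSS hbS hS hθ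
    let U := π.invariants
    refine even_finrank_of_skew (U := U) (b.compl₁₂ U.subtype (S ∘ₗ U.subtype)) ?_ ?_
    · rw [eq_bot_iff]
      intro v hv
      have hv' : ∀ u : U, b v (S u) = 0 := fun u => LinearMap.congr_fun (LinearMap.mem_ker.1 hv) u
      have hvU : ∀ h, θ h • ρ h (v : V) = v := fun h => v.2 h
      have key : ∀ w, b (v : V) w = 0 := by
        intro w
        have hP : ∑ h, π h (S w) ∈ U := by
          intro g
          rw [map_sum, ← Equiv.sum_comp (Equiv.mulLeft g) fun h => π h (S w)]
          refine Finset.sum_congr rfl fun h _ => ?_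
          rw [← Module.End.mul_apply, ← map_mul]
          rfl
        have h1 : ∑ h, b (v : V) (θ h⁻¹ • ρ h w) = 0 := by
          rw [← map_sum, ← hSS (∑ h, θ h⁻¹ • ρ h w)]
          have h2 : S (∑ h, θ h⁻¹ • ρ h w) = ∑ h, π h (S w) := by
            rw [map_sum, ← Equiv.sum_comp σ fun h => π h (S w)]
            refine Finset.sum_congr rfl fun h _ => ?_
            rw [hπ, map_smul, hS, hθ]
          rw [h2]
          exact hv' ⟨_, hP⟩
        have h3 : ∀ h, b (v : V) (θ h⁻¹ • ρ h w) = b (v : V) w := fun h => by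
          have h4 : ρ h (ρ h⁻¹ (v : V)) = v := by
            rw [← Module.End.mul_apply, ← map_mul, mul_inv_cancel, map_one]; rfl
          rw [map_smul]
          conv_lhs => rw [← h4]
          rw [hinv, ← LinearMap.smul_apply, ← map_smul, hvU]
        simp only [h3, Finset.sum_const, Finset.card_univ, nsmul_eq_mul] at h1
        rw [← Nat.card_eq_fintype_card] at h1
        exact (mul_eq_zero.1 h1).resolve_left hH
      have h5 : (v : V) ∈ LinearMap.ker b := LinearMap.mem_ker.2 (LinearMap.ext key)
      rw [hb, Submodule.mem_bot] at h5
      exact (Submodule.mem_bot ℂ).2 (Subtype.ext h5)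
    · intro v w
      change b (w : V) (S v) = -b (v : V) (S w)
      rw [← hbS, hSS, hskew]

end Multiplicity

section Orbits

lemma card_dvd_sum_card_stabilizer {G X : Type*} [Group G] [Finite G] [Fintype X] [MulAction G X]
    (φ : X → ℕ) (hφ : ∀ (g : G) x, φ (g • x) = φ x) :
    Nat.card G ∣ ∑ x, Nat.card (MulAction.stabilizer G x) * φ x := by
  rw [← Finset.sum_fiberwise Finset.univ
    (fun x => (Quotient.mk (MulAction.orbitRel G X) x : MulAction.orbitRel.Quotient G X))]
  refine Finset.dvd_sum fun ω _ => ?_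
  obtain ⟨x0, rfl⟩ := Quotient.exists_rep ω
  have h1 : ∀ x ∈ Finset.univ.filter (fun x => (Quotient.mk (MulAction.orbitRel G X) x :
      MulAction.orbitRel.Quotient G X) = Quotient.mk _ x0),
      Nat.card (MulAction.stabilizer G x) * φ x = Nat.card (MulAction.stabilizer G x0) * φ x0 := by
    intro x hx
    rw [Finset.mem_filter, Quotient.eq] at hx
    have h2 : MulAction.orbitRel G X x x0 := hx.2
    rw [Nat.card_congr (MulAction.stabilizerEquivStabilizerOfOrbitRel h2).toEquiv]
    obtain ⟨g, rfl⟩ := h2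
    exact congrArg _ (hφ g x0)
  rw [Finset.sum_congr rfl h1, Finset.sum_const, smul_eq_mul, ← mul_assoc]
  refine Dvd.dvd.mul_right (dvd_of_eq ?_) _
  let _ : Fintype G := Fintype.ofFinite G
  rw [Nat.card_eq_fintype_card, ← MulAction.card_orbit_mul_card_stabilizer_eq_card_group G x0]
  simp only [Nat.card_eq_fintype_card]
  congr 1
  rw [Fintype.card_subtype]
  congr 1
  ext x
  simp only [Finset.mem_filter, Finset.mem_univ, true_and]
  rw [Quotient.eq]
  rfl

end Orbits

section GroupAction

variable {F E : Type*} [Field F] [Finite F] [AddCommGroup E] [Module F E] [Finite E]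

noncomputable local instance : Fintype E := Fintype.ofFinite _
noncomputable local instance : Fintype F := Fintype.ofFinite _

/-- The difference of an automorphism and the identity. -/
def subOne (x : E ≃ₗ[F] E) : E →ₗ[F] E := x.toLinearMap - LinearMap.id

lemma add_subOne (x : E ≃ₗ[F] E) (v : E) : v + subOne x v = x v := by
  simp [subOne]

/-- The action of linear automorphisms on families of functions. -/
local instance towerAction (F E : Type*) [Field F] [AddCommGroup E] [Module F E] (m : ℕ) :
    MulAction (E ≃ₗ[F] E) ((Fin m → E → F) × (E → E → F)) where
  smul g D := (fun i v => D.1 i (g⁻¹ v), fun v w => D.2 (g⁻¹ v) (g⁻¹ w))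
  one_smul _ := rfl
  mul_smul g h D := by
    change ((fun i v => _, fun v w => _) : (Fin m → E → F) × (E → E → F)) = (fun i v => _, fun v w => _)
    simp only [mul_inv_rev]
    rfl

lemma smul_tower_fst {m : ℕ} (g : E ≃ₗ[F] E) (D : (Fin m → E → F) × (E → E → F)) (i : Fin m)
    (v : E) : (g • D).1 i (g v) = D.1 i v :=
  congrArg (D.1 i) (g.symm_apply_apply v)

lemma smul_tower_snd {m : ℕ} (g : E ≃ₗ[F] E) (D : (Fin m → E → F) × (E → E → F))
    (v w : E) : (g • D).2 (g v) (g w) = D.2 v w :=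
  congrArg₂ D.2 (g.symm_apply_apply v) (g.symm_apply_apply w)

lemma smul_tower_eq_iff {m : ℕ} (g : E ≃ₗ[F] E) (D D' : (Fin m → E → F) × (E → E → F)) :
    g • D = D' ↔ (∀ i v, D'.1 i (g v) = D.1 i v) ∧ ∀ v w, D'.2 (g v) (g w) = D.2 v w := by
  constructor
  · rintro rfl
    exact ⟨smul_tower_fst g D, smul_tower_snd g D⟩
  · rintro ⟨h1, h2⟩
    refine Prod.ext ?_ ?_
    · ext i v
      obtain ⟨v, rfl⟩ := g.surjective v
      rw [smul_tower_fst, h1]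
    · ext v w
      obtain ⟨v, rfl⟩ := g.surjective v
      obtain ⟨w, rfl⟩ := g.surjective w
      rw [smul_tower_snd, h2]

lemma isTower_smul {m : ℕ} (g : E ≃ₗ[F] E) {D : (Fin m → E → F) × (E → E → F)}
    (h : IsTower m ⊤ D.1 D.2) : IsTower m ⊤ (g • D).1 (g • D).2 :=
  isTower_transport g (smul_tower_snd g D) (by simp) (smul_tower_fst g D) h

lemma isTower_smul_iff {m : ℕ} (g : E ≃ₗ[F] E) (D : (Fin m → E → F) × (E → E → F)) :
    IsTower m ⊤ (g • D).1 (g • D).2 ↔ IsTower m ⊤ D.1 D.2 := by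
  refine ⟨fun h => ?_, isTower_smul g⟩
  have := isTower_smul g⁻¹ h
  rwa [inv_smul_smul] at this

/-- The phase of a group element at a tower. -/
noncomputable def phaseAt {m : ℕ} (D : (Fin m → E → F) × (E → E → F)) (x : E ≃ₗ[F] E) : F :=
  phase (subOne x) m ⊤ D.1 0

lemma isTower_zero {m : ℕ} {D : (Fin m → E → F) × (E → E → F)} (h : IsTower m ⊤ D.1 D.2)
    (i : Fin m) (hi : i.val = 0) : D.1 i 0 = 0 := by
  obtain ⟨f, hf⟩ := (isTower_func h i hi).1
  rw [hf 0 (Submodule.zero_mem _), map_zero]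

lemma phaseAt_mul {m : ℕ} {D : (Fin m → E → F) × (E → E → F)} (h : IsTower m ⊤ D.1 D.2)
    {x y : E ≃ₗ[F] E} (hx : x • D = D) (hy : y • D = D) :
    phaseAt D (x * y) = phaseAt D x + phaseAt D y := by
  refine phase_mul (subOne x) (subOne y) (subOne (x * y)) (fun v => ?_) h (fun i v => ?_)
    (fun i v => ?_) (fun _ _ => Submodule.mem_top) (fun _ _ => Submodule.mem_top) fun i hi => ?_
  · simp only [subOne, LinearMap.sub_apply, LinearMap.id_apply, map_sub]
    change x (y v) - v = x v - v + (y v - v) + (x (y v) - y v - (x v - v))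
    abel
  · rw [add_subOne]
    exact ((smul_tower_eq_iff x D D).1 hx).1 i v
  · rw [add_subOne]
    exact ((smul_tower_eq_iff y D D).1 hy).1 i v
  · rw [isTower_zero h i hi, add_zero]

lemma subOne_conj (g x : E ≃ₗ[F] E) (v : E) : subOne (g * x * g⁻¹) (g v) = g (subOne x v) := by
  have h : (g * x * g⁻¹) (g v) = g (x v) := by
    change g (x (g.symm (g v))) = _
    rw [g.symm_apply_apply]
  simp only [subOne, LinearMap.sub_apply, LinearMap.id_apply, map_sub]
  exact congrArg (· - g v) h

lemma phaseAt_smul {m : ℕ} {D : (Fin m → E → F) × (E → E → F)} (h : IsTower m ⊤ D.1 D.2)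
    (g : E ≃ₗ[F] E) {x : E ≃ₗ[F] E} (hx : x • D = D) :
    phaseAt (g • D) (g * x * g⁻¹) = phaseAt D x := by
  have h' := isTower_smul g h
  refine (phase_transport g (subOne x) (subOne (g * x * g⁻¹)) (subOne_conj g x) (δ := 1) (c := 1)
    (by ring) (by ring) h h' (by simp) (fun i v => ?_) (fun i v => ?_)
    (fun _ _ => Submodule.mem_top) fun i hi => ?_).trans (one_mul _)
  · rw [smul_tower_fst]; simp
  · rw [add_subOne]
    exact ((smul_tower_eq_iff x D D).1 hx).1 i v
  · rw [isTower_zero h i hi, isTower_zero h' i hi, mul_zero]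

/-- An involution inverting the phases at a tower. -/
lemma exists_inverting {m : ℕ} {D : (Fin m → E → F) × (E → E → F)} (h : IsTower m ⊤ D.1 D.2) :
    ∃ s : E ≃ₗ[F] E, s * s = 1 ∧ ∀ x : E ≃ₗ[F] E, x • D = D →
      (s * x * s⁻¹) • D = D ∧ phaseAt D (s * x * s⁻¹) = -phaseAt D x := by
  obtain ⟨s0, -, h2, h3, h4⟩ := exists_involution (c := 1) (by ring) h
  have hs : s0 ∘ₗ s0 = LinearMap.id := LinearMap.ext fun v => h2 v Submodule.mem_top
  let s : E ≃ₗ[F] E := LinearEquiv.ofLinearMap s0 s0 hs hs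
  have hs1 : ∀ i v, D.1 i (s v) = 1 * (-1) ^ i.val * D.1 i v := fun i v =>
    h3 i v Submodule.mem_top
  have hs2 : ∀ v w, D.2 (s v) (s w) = D.2 v w := fun v w =>
    h4 v Submodule.mem_top w Submodule.mem_top
  refine ⟨s, LinearEquiv.ext fun v => h2 v Submodule.mem_top, fun x hx => ?_⟩
  obtain ⟨hx1, hx2⟩ := (smul_tower_eq_iff x D D).1 hx
  have hconj : ∀ v, (s * x * s⁻¹) (s v) = s (x v) := fun v => by
    change s (x (s.symm (s v))) = _
    rw [s.symm_apply_apply]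
  constructor
  · rw [smul_tower_eq_iff]
    refine ⟨fun i v => ?_, fun v w => ?_⟩
    · obtain ⟨v, rfl⟩ := s.surjective v
      rw [hconj, hs1, hs1, hx1]
    · obtain ⟨v, rfl⟩ := s.surjective v
      obtain ⟨w, rfl⟩ := s.surjective w
      rw [hconj, hconj, hs2, hs2, hx2]
  · refine (phase_transport s (subOne x) (subOne (s * x * s⁻¹)) (subOne_conj s x) (δ := -1) (c := 1)
      (by ring) (by ring) h h (by simp) hs1 (fun i v => ?_)
      (fun _ _ => Submodule.mem_top) fun i hi => ?_).trans (neg_one_mul _)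
    · rw [add_subOne, hx1]
    · rw [isTower_zero h i hi, mul_zero]

variable {V : Type*} [AddCommGroup V] [Module ℂ V] [FiniteDimensional ℂ V]

local instance : Finite (E ≃ₗ[F] E) := DFunLike.finite _
noncomputable local instance : Fintype (E ≃ₗ[F] E) := Fintype.ofFinite _

lemma exists_tower_multiplicity (ρ : Representation ℂ (E ≃ₗ[F] E) V) (ψ : AddChar F ℂ)
    {m : ℕ} (D : (Fin m → E → F) × (E → E → F)) (h : IsTower m ⊤ D.1 D.2) :
    ∃ k : ℕ, (∑ x : E ≃ₗ[F] E, if x • D = D then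
      ψ (phaseAt D x) * LinearMap.trace ℂ V (ρ x) else 0) =
        Nat.card (MulAction.stabilizer (E ≃ₗ[F] E) D) * (k : ℂ) ∧
    (∀ (b : V →ₗ[ℂ] V →ₗ[ℂ] ℂ), LinearMap.ker b = ⊥ →
      (∀ x v w, b (ρ x v) (ρ x w) = b v w) → (∀ v w, b w v = -b v w) → Even k) := by
  let H := MulAction.stabilizer (E ≃ₗ[F] E) D
  have hH : ∀ x : H, (x : E ≃ₗ[F] E) • D = D := fun x => x.2
  let θ : H →* ℂ :=
    { toFun := fun x => ψ (phaseAt D x)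
      map_one' := by
        have := phaseAt_mul h (one_smul _ D) (one_smul _ D)
        rw [mul_one, left_eq_add] at this
        change ψ (phaseAt D 1) = 1
        rw [this, AddChar.map_zero_eq_one]
      map_mul' := fun x y => by
        rw [Subgroup.coe_mul, phaseAt_mul h (hH x) (hH y), AddChar.map_add_eq_mul] }
  have hθ : ∀ x : H, θ x = ψ (phaseAt D x) := fun x => rfl
  obtain ⟨k, hk, hev⟩ := exists_multiplicity (ρ.comp H.subtype) θ
  refine ⟨k, ?_, fun b hb hinv hskew => ?_⟩
  · rw [← hk, ← Finset.sum_filter, Finset.sum_subtype (Finset.univ.filter fun x : E ≃ₗ[F] E =>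
      x • D = D) (p := fun x => x ∈ H) (fun x => by simp [H])
      (fun x => ψ (phaseAt D x) * LinearMap.trace ℂ V (ρ x))]
    exact Fintype.sum_congr _ _ fun x => rfl
  · obtain ⟨s, hs, hsx⟩ := exists_inverting h
    have hsinv : s⁻¹ = s := inv_eq_of_mul_eq_one_left hs
    let σ : H ≃ H :=
      { toFun := fun x => ⟨s * x * s⁻¹, (hsx x (hH x)).1⟩
        invFun := fun x => ⟨s * x * s⁻¹, (hsx x (hH x)).1⟩
        left_inv := fun x => Subtype.ext (by
          change s * (s * x * s⁻¹) * s⁻¹ = x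
          rw [hsinv, mul_assoc, mul_assoc, hs, mul_one, ← mul_assoc, hs, one_mul])
        right_inv := fun x => Subtype.ext (by
          change s * (s * x * s⁻¹) * s⁻¹ = x
          rw [hsinv, mul_assoc, mul_assoc, hs, mul_one, ← mul_assoc, hs, one_mul]) }
    refine hev b hb (fun x => hinv x) hskew (ρ s) σ (fun v => ?_) (hinv s) (fun x v => ?_)
      fun x => ?_
    · rw [← Module.End.mul_apply, ← map_mul, hs, map_one]; rfl
    · change ρ s (ρ x v) = ρ (s * x * s⁻¹) (ρ s v)
      rw [← Module.End.mul_apply, ← Module.End.mul_apply, ← map_mul, ← map_mul,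
        inv_mul_cancel_right]
    · have h1 : θ (σ x) * θ x = 1 := by
        rw [hθ, hθ]
        change ψ (phaseAt D (s * x * s⁻¹)) * _ = 1
        rw [(hsx x (hH x)).2, ← AddChar.map_add_eq_mul, neg_add_cancel, AddChar.map_zero_eq_one]
      have h2 : θ x * θ x⁻¹ = 1 := by rw [← map_mul, mul_inv_cancel, map_one]
      calc θ (σ x) = θ (σ x) * (θ x * θ x⁻¹) := by rw [h2, mul_one]
        _ = θ x⁻¹ := by rw [← mul_assoc, h1, one_mul]

lemma sum_stabilizer_smul (ρ : Representation ℂ (E ≃ₗ[F] E) V) (ψ : AddChar F ℂ)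
    {m : ℕ} (D : (Fin m → E → F) × (E → E → F)) (h : IsTower m ⊤ D.1 D.2) (g : E ≃ₗ[F] E) :
    (∑ x : E ≃ₗ[F] E, if x • g • D = g • D then
      ψ (phaseAt (g • D) x) * LinearMap.trace ℂ V (ρ x) else 0) =
    ∑ x : E ≃ₗ[F] E, if x • D = D then ψ (phaseAt D x) * LinearMap.trace ℂ V (ρ x) else 0 := by
  rw [← Equiv.sum_comp (MulAut.conj g).toEquiv]
  refine Finset.sum_congr rfl fun x _ => ?_
  have h1 : (MulAut.conj g).toEquiv x = g * x * g⁻¹ := rfl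
  rw [h1]
  have h2 : (g * x * g⁻¹) • g • D = g • D ↔ x • D = D := by
    rw [mul_smul, inv_smul_smul, mul_smul]
    exact (MulAction.injective g).eq_iff
  simp only [h2]
  split_ifs with hx
  · rw [phaseAt_smul h g hx]
    congr 1
    exact Representation.char_conj ρ x g
  · rfl

/-- If `ρ` carries an invariant symplectic form, the twisted forms, weighted by the character,
have even total count relative to the order of the group. -/
theorem exists_sum_numTwNondeg_eq (ρ : Representation ℂ (E ≃ₗ[F] E) V) (h2 : (2 : F) ≠ 0)
    {ψ : AddChar F ℂ} (hψ : ψ ≠ 1)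
    (b : V →ₗ[ℂ] V →ₗ[ℂ] ℂ) (hb : LinearMap.ker b = ⊥)
    (hinv : ∀ x v w, b (ρ x v) (ρ x w) = b v w) (hskew : ∀ v w, b w v = -b v w) :
    ∃ N : ℕ, ∑ x : E ≃ₗ[F] E, LinearMap.trace ℂ V (ρ x) * ((numTwNondeg (subOne x) : ℚ) : ℂ) =
      2 * N * Nat.card (E ≃ₗ[F] E) := by
  have key : ∀ m : ℕ, ∃ N : ℕ, ∑ x : E ≃ₗ[F] E, LinearMap.trace ℂ V (ρ x) *
      towerSum (subOne x) ψ m ⊤ 0 = 2 * N * Nat.card (E ≃ₗ[F] E) := by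
    intro m
    let T : (Fin m → E → F) × (E → E → F) → ℂ := fun D => ∑ x : E ≃ₗ[F] E, if x • D = D then
      ψ (phaseAt D x) * LinearMap.trace ℂ V (ρ x) else 0
    have hT : ∀ D : (Fin m → E → F) × (E → E → F), ∃ k : ℕ, IsTower m ⊤ D.1 D.2 →
        T D = Nat.card (MulAction.stabilizer (E ≃ₗ[F] E) D) * ((2 * k : ℕ) : ℂ) := by
      intro D
      by_cases h : IsTower m ⊤ D.1 D.2
      · obtain ⟨k, hk, hev⟩ := exists_tower_multiplicity ρ ψ D h
        obtain ⟨l, rfl⟩ := (hev b hb hinv hskew).two_dvd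
        exact ⟨l, fun _ => hk⟩
      · exact ⟨0, fun h' => absurd h' h⟩
    choose k hk using hT
    let φ : (Fin m → E → F) × (E → E → F) → ℕ := fun D => if IsTower m ⊤ D.1 D.2 then k D else 0
    have hφ : ∀ (g : E ≃ₗ[F] E) D, φ (g • D) = φ D := by
      intro g D
      simp only [φ, isTower_smul_iff]
      split_ifs with h
      · have h1 := hk _ (isTower_smul g h)
        have h3 : T (g • D) = T D := sum_stabilizer_smul ρ ψ D h g
        rw [h3, hk D h] at h1
        have h4 : Nat.card (MulAction.stabilizer (E ≃ₗ[F] E) (g • D)) =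
            Nat.card (MulAction.stabilizer (E ≃ₗ[F] E) D) :=
          (Nat.card_congr (MulAction.stabilizerEquivStabilizer (g := g) rfl).toEquiv).symm
        rw [h4] at h1
        have h5 : (Nat.card (MulAction.stabilizer (E ≃ₗ[F] E) D) : ℂ) ≠ 0 :=
          Nat.cast_ne_zero.2 Nat.card_pos.ne'
        have h6 := mul_left_cancel₀ h5 h1
        rw [Nat.cast_inj] at h6
        omega
      · rfl
    obtain ⟨N, hN⟩ := card_dvd_sum_card_stabilizer φ hφ
    refine ⟨N, ?_⟩
    have h3 : ∑ x : E ≃ₗ[F] E, LinearMap.trace ℂ V (ρ x) * towerSum (subOne x) ψ m ⊤ 0 =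
        ∑ D : (Fin m → E → F) × (E → E → F), if IsTower m ⊤ D.1 D.2 then T D else 0 := by
      have h4 : ∀ x : E ≃ₗ[F] E, LinearMap.trace ℂ V (ρ x) * towerSum (subOne x) ψ m ⊤ 0 =
          ∑ D : (Fin m → E → F) × (E → E → F), if IsTower m ⊤ D.1 D.2 then
            (if x • D = D then ψ (phaseAt D x) * LinearMap.trace ℂ V (ρ x) else 0) else 0 := by
        intro x
        rw [towerSum, Fintype.sum_prod_type, Finset.mul_sum]
        refine Finset.sum_congr rfl fun ξ _ => ?_
        rw [Finset.mul_sum]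
        refine Finset.sum_congr rfl fun a _ => ?_
        have hiff := smul_tower_eq_iff x (ξ, a) (ξ, a)
        simp only [add_subOne]
        by_cases h : IsTower m ⊤ ξ a
        · by_cases h' : x • (ξ, a) = (ξ, a)
          · rw [if_pos ⟨h, hiff.1 h'⟩, if_pos h, if_pos h', mul_comm]
            rfl
          · rw [if_neg fun h6 => h' (hiff.2 h6.2), if_pos h, if_neg h', mul_zero]
        · rw [if_neg fun h6 => h h6.1, if_neg h, mul_zero]
      rw [Finset.sum_congr rfl fun x _ => h4 x, Finset.sum_comm]
      refine Finset.sum_congr rfl fun D _ => ?_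
      split_ifs
      · rfl
      · simp
    have h5 : ∀ D : (Fin m → E → F) × (E → E → F), (if IsTower m ⊤ D.1 D.2 then T D else 0) =
        2 * ((Nat.card (MulAction.stabilizer (E ≃ₗ[F] E) D) * φ D : ℕ) : ℂ) := by
      intro D
      simp only [φ]
      split_ifs with h
      · rw [hk D h]
        push_cast
        ring
      · simp
    rw [h3, Finset.sum_congr rfl fun D _ => h5 D, ← Finset.mul_sum, ← Nat.cast_sum, hN]
    push_cast
    ring
  choose N hN using key
  refine ⟨∑ m ∈ Finset.range (finrank F E + 1), N m, ?_⟩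
  have h1 : ∀ x : E ≃ₗ[F] E, ((numTwNondeg (subOne x) : ℚ) : ℂ) =
      ∑ m ∈ Finset.range (finrank F E + 1), towerSum (subOne x) ψ m ⊤ 0 := fun x =>
    numTwNondeg_eq_sum_towerSum (subOne x) h2 (fun v hv => by
      rw [add_subOne] at hv
      exact x.map_eq_zero_iff.1 hv) hψ
  simp only [h1, Finset.mul_sum]
  rw [Finset.sum_comm, Finset.sum_congr rfl fun m _ => hN m, ← Finset.sum_mul, ← Finset.mul_sum,
    Nat.cast_sum]

end GroupAction

section SelfAdjoint

open Polynomial DirectSum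

variable {F : Type*} [Field F]

/-- A functional on `F[X] ⧸ (f)` whose kernel contains no nonzero ideal. -/
lemma exists_nondegenerate_functional {f : F[X]} (hf : f ≠ 0) :
    ∃ l : (F[X] ⧸ Ideal.span {f}) →ₗ[F] F, ∀ s, s ≠ 0 → ∃ r, l (r * s) ≠ 0 := by
  let g : F[X] := f * C f.leadingCoeff⁻¹
  have hg : g.Monic := monic_mul_leadingCoeff_inv hf
  have hC : IsUnit (C f.leadingCoeff⁻¹) :=
    isUnit_C.2 (inv_ne_zero (leadingCoeff_ne_zero.2 hf)).isUnit
  have hdvd : ∀ r, f ∣ r ↔ g ∣ r := fun r => (hC.mul_right_dvd).symm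
  let l0 : F[X] →ₗ[F] F := lcoeff F (g.natDegree - 1) ∘ₗ modByMonicHom g
  have hl0 : ∀ r, l0 r = (r %ₘ g).coeff (g.natDegree - 1) := fun r => rfl
  let l : (F[X] ⧸ Ideal.span {f}) →ₗ[F] F :=
    Submodule.liftQ ((Ideal.span {f}).restrictScalars F) l0 (fun r hr => by
      have h1 : f ∣ r := Ideal.mem_span_singleton.1 hr
      rw [LinearMap.mem_ker, hl0, (modByMonic_eq_zero_iff_dvd hg).2 ((hdvd r).1 h1), coeff_zero])
  have hl : ∀ r : F[X], l (Ideal.Quotient.mk _ r) = l0 r := fun r => rfl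
  refine ⟨l, fun s hs => ?_⟩
  obtain ⟨s, rfl⟩ := Ideal.Quotient.mk_surjective s
  have hs0 : s %ₘ g ≠ 0 := by
    rw [Ne, modByMonic_eq_zero_iff_dvd hg, ← hdvd, ← Ideal.mem_span_singleton,
      ← Ideal.Quotient.eq_zero_iff_mem]
    exact hs
  have hdeg : (s %ₘ g).natDegree < g.natDegree :=
    natDegree_lt_natDegree hs0 (degree_modByMonic_lt s hg)
  have heq : Ideal.Quotient.mk (Ideal.span {f}) s = Ideal.Quotient.mk (Ideal.span {f}) (s %ₘ g) := by
    rw [Ideal.Quotient.eq, Ideal.mem_span_singleton, hdvd]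
    exact ⟨s /ₘ g, by rw [sub_eq_iff_eq_add', modByMonic_add_div s g]⟩
  refine ⟨Ideal.Quotient.mk _ (X ^ (g.natDegree - 1 - (s %ₘ g).natDegree)), ?_⟩
  rw [heq, ← map_mul, hl, hl0, (modByMonic_eq_self_iff hg).2]
  · have h1 : g.natDegree - 1 = (s %ₘ g).natDegree + (g.natDegree - 1 - (s %ₘ g).natDegree) := by
      omega
    conv_lhs => rw [h1]
    rw [add_tsub_cancel_left, coeff_X_pow_mul]
    exact leadingCoeff_ne_zero.2 hs0
  · refine degree_lt_degree ?_
    rw [natDegree_X_pow_mul _ hs0]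
    omega

/-- Every endomorphism is self-adjoint for some nondegenerate bilinear form. -/
theorem exists_form_selfAdjoint {E : Type*} [AddCommGroup E] [Module F E] [FiniteDimensional F E]
    (g : E →ₗ[F] E) : ∃ B : E →ₗ[F] E →ₗ[F] F, LinearMap.ker B = ⊥ ∧
      ∀ v w, B (g v) w = B v (g w) := by
  obtain ⟨ι, _, p, hp, e, ⟨φ⟩⟩ := Module.equiv_directSum_of_isTorsion
    (Module.AEval.isTorsion_of_finiteDimensional F E g)
  choose l hl using fun i => exists_nondegenerate_functional (pow_ne_zero (e i) (hp i).ne_zero)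
  let c : E → ∀ i, F[X] ⧸ Ideal.span {p i ^ e i} := fun v i => φ (AEval.of F E g v) i
  have hadd : ∀ v w i, c (v + w) i = c v i + c w i := fun v w i => by
    simp only [c, map_add]; rfl
  have hX : ∀ v i, c (g v) i = Ideal.Quotient.mk _ X * c v i := fun v i => by
    have h : AEval.of F E g (g v) = (X : F[X]) • AEval.of F E g v := (AEval.X_smul_of g v).symm
    simp only [c, h, map_smul]
    rfl
  have hsmul : ∀ (a : F) v i, c (a • v) i = a • c v i := fun a v i => by
    have h : AEval.of F E g (a • v) = (C a : F[X]) • AEval.of F E g v := by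
      rw [map_smul, AEval.C_smul]
    simp only [c, h, map_smul]
    rw [Algebra.smul_def]
    rfl
  let B : E →ₗ[F] E →ₗ[F] F := LinearMap.mk₂ F (fun v w => ∑ i, l i (c v i * c w i))
    (fun v v' w => by simp only [hadd, add_mul, map_add, Finset.sum_add_distrib])
    (fun a v w => by simp only [hsmul, smul_mul_assoc, map_smul, Finset.smul_sum])
    (fun v w w' => by simp only [hadd, mul_add, map_add, Finset.sum_add_distrib])
    (fun a v w => by simp only [hsmul, mul_smul_comm, map_smul, Finset.smul_sum])
  have hB : ∀ v w, B v w = ∑ i, l i (c v i * c w i) := fun v w => rfl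
  refine ⟨B, LinearMap.ker_eq_bot'.2 fun v hv => ?_, fun v w => ?_⟩
  · by_contra hv0
    have h1 : ∃ i, c v i ≠ 0 := by
      by_contra! h
      refine hv0 ((AEval.of F E g).map_eq_zero_iff.1 (φ.map_eq_zero_iff.1 ?_))
      exact DFinsupp.ext h
    obtain ⟨i, hi⟩ := h1
    obtain ⟨r, hr⟩ := hl i _ hi
    let w : E := (AEval.of F E g).symm (φ.symm (DirectSum.of (fun i => F[X] ⧸ F[X] ∙ p i ^ e i) i r))
    have hw : ∀ j, c w j = DirectSum.of (fun i => F[X] ⧸ F[X] ∙ p i ^ e i) i r j := fun j => by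
      simp only [c, w, LinearEquiv.apply_symm_apply]
    refine hr ?_
    have h2 := LinearMap.congr_fun hv w
    rw [hB, Finset.sum_eq_single i (fun j _ hj => ?_) (by simp), hw, DirectSum.of_eq_same,
      mul_comm] at h2
    · exact h2
    · rw [hw, DirectSum.of_eq_of_ne _ _ _ hj]
      exact (congrArg (l j) (mul_zero _)).trans (map_zero _)
  · rw [hB, hB]
    simp only [hX]
    refine Finset.sum_congr rfl fun i _ => congrArg (l i) ?_
    ring

end SelfAdjoint

open Module Matrix

section Matrices

variable {F : Type*} [Field F] {n : ℕ}

/-- Invertible matrices as linear automorphisms of the space of column vectors. -/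
noncomputable def autEquiv (F : Type*) [Field F] (n : ℕ) :
    GL (Fin n) F ≃* ((Fin n → F) ≃ₗ[F] (Fin n → F)) :=
  GeneralLinearGroup.toLin.trans (LinearMap.GeneralLinearGroup.generalLinearEquiv F (Fin n → F))

/-- The inverse transpose. -/
def contragredient : GL (Fin n) F →* GL (Fin n) F where
  toFun g := ⟨(g⁻¹.val)ᵀ, g.valᵀ, by rw [← transpose_mul, Units.mul_inv, transpose_one],
    by rw [← transpose_mul, Units.inv_mul, transpose_one]⟩
  map_one' := Units.ext (by simp)
  map_mul' g h := Units.ext (by simp)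

lemma coe_contragredient (g : GL (Fin n) F) :
    (contragredient g).val = (g⁻¹.val)ᵀ := rfl

lemma contragredient_contragredient (g : GL (Fin n) F) : contragredient (contragredient g) = g :=
  Units.ext (transpose_transpose _)

/-- The bilinear form with a given Gram matrix. -/
noncomputable def gramForm (F : Type*) [Field F] (n : ℕ) :
    Matrix (Fin n) (Fin n) F ≃ₗ[F] ((Fin n → F) →ₗ[F] (Fin n → F) →ₗ[F] F) :=
  toLinearMap₂' F

lemma gramForm_apply (M : Matrix (Fin n) (Fin n) F) (v w : Fin n → F) :
    gramForm F n M v w = v ⬝ᵥ M *ᵥ w :=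
  toLinearMap₂'_apply' M v w

lemma ker_gramForm_eq_bot_iff (M : Matrix (Fin n) (Fin n) F) :
    LinearMap.ker (gramForm F n M) = ⊥ ↔ IsUnit M := by
  rw [← vecMul_injective_iff_isUnit, ← coe_vecMulLinear, ← LinearMap.ker_eq_bot,
    LinearMap.ker_eq_bot', LinearMap.ker_eq_bot']
  refine forall_congr' fun v => imp_congr_left ⟨fun h => ?_, fun h => ?_⟩
  · refine dotProduct_eq_zero _ fun w => ?_
    rw [vecMulLinear_apply, ← dotProduct_mulVec, ← gramForm_apply, h]
    rfl
  · refine LinearMap.ext fun w => ?_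
    rw [gramForm_apply, dotProduct_mulVec, ← vecMulLinear_apply, h, zero_dotProduct]
    rfl

lemma eq_of_dotProduct_mulVec {M N : Matrix (Fin n) (Fin n) F}
    (h : ∀ v w, v ⬝ᵥ M *ᵥ w = v ⬝ᵥ N *ᵥ w) : M = N := by
  refine (gramForm F n).injective (LinearMap.ext₂ fun v w => ?_)
  rw [gramForm_apply, gramForm_apply, h]

/-- An invertible matrix is conjugate to its transpose. -/
theorem exists_conj_transpose (g : GL (Fin n) F) :
    ∃ b : GL (Fin n) F, contragredient g⁻¹ = b * g * b⁻¹ := by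
  obtain ⟨B, hB, hg⟩ := exists_form_selfAdjoint (autEquiv F n g).toLinearMap
  obtain ⟨M, rfl⟩ := (gramForm F n).surjective B
  obtain ⟨b, rfl⟩ := (ker_gramForm_eq_bot_iff M).1 hB
  refine ⟨b, eq_mul_inv_of_mul_eq (Units.ext (eq_of_dotProduct_mulVec fun v w => ?_))⟩
  have h := hg v w
  rw [gramForm_apply, gramForm_apply] at h
  change (g.val *ᵥ v) ⬝ᵥ b.val *ᵥ w = v ⬝ᵥ b.val *ᵥ (g.val *ᵥ w) at h
  rw [Units.val_mul, Units.val_mul, coe_contragredient, inv_inv, ← mulVec_mulVec, ← mulVec_mulVec,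
    ← h, dotProduct_mulVec, vecMul_transpose]

variable [Finite F]

lemma mem_twistForms_iff (M x : GL (Fin n) F) :
    gramForm F n M.val ∈ twistForms (subOne (autEquiv F n x)) ↔
      M⁻¹ * contragredient M⁻¹ = x := by
  have h1 : M⁻¹ * contragredient M⁻¹ = x ↔ M.valᵀ = M.val * x.val := by
    rw [inv_mul_eq_iff_eq_mul, Units.ext_iff, coe_contragredient, inv_inv, Units.val_mul]
  have h2 : ∀ v w : Fin n → F, v ⬝ᵥ M.valᵀ *ᵥ w = w ⬝ᵥ M.val *ᵥ v := fun v w => by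
    rw [mulVec_transpose, ← dotProduct_comm, dotProduct_mulVec]
  rw [h1]
  have h3 : ∀ v, v + subOne (autEquiv F n x) v = x.val *ᵥ v := fun v => add_subOne _ v
  change (∀ v w, _ = gramForm F n M.val w (v + subOne (autEquiv F n x) v)) ↔ _
  simp only [gramForm_apply, h3]
  constructor
  · intro h
    refine eq_of_dotProduct_mulVec fun v w => ?_
    rw [h2, h, mulVec_mulVec]
  · intro h v w
    rw [mulVec_mulVec, ← h, h2]

variable [Fintype (GL (Fin n) F)]

lemma numTwNondeg_eq_card (x : GL (Fin n) F) :
    numTwNondeg (subOne (autEquiv F n x)) =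
      (Finset.univ.filter fun g : GL (Fin n) F => g * contragredient g = x).card := by
  rw [numTwNondeg, ← Fintype.card_subtype, ← Nat.card_eq_fintype_card, Nat.cast_inj]
  symm
  refine Nat.card_eq_of_bijective (fun g => ⟨gramForm F n (g.1⁻¹).val,
    (mem_twistForms_iff g.1⁻¹ x).2 (by rw [inv_inv]; exact g.2),
    (ker_gramForm_eq_bot_iff _).2 (g.1⁻¹).isUnit⟩) ⟨fun g h hgh => ?_, fun a => ?_⟩
  · have h1 := (gramForm F n).injective (Subtype.ext_iff.1 hgh)
    exact Subtype.ext (inv_injective (Units.ext h1))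
  · obtain ⟨a, ha, hk⟩ := a
    obtain ⟨M, rfl⟩ := (gramForm F n).surjective a
    obtain ⟨b, rfl⟩ := (ker_gramForm_eq_bot_iff M).1 hk
    refine ⟨⟨b⁻¹, (mem_twistForms_iff b x).1 ha⟩, Subtype.ext ?_⟩
    simp only [inv_inv]

lemma sum_mul_numTwNondeg (f : GL (Fin n) F → ℂ) :
    ∑ x : GL (Fin n) F, f x * ((numTwNondeg (subOne (autEquiv F n x)) : ℚ) : ℂ) =
      ∑ g : GL (Fin n) F, f (g * contragredient g) := by
  symm
  rw [← Finset.sum_fiberwise_of_maps_to (g := fun g : GL (Fin n) F => g * contragredient g)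
    (t := Finset.univ) (fun _ _ => Finset.mem_univ _)]
  refine Finset.sum_congr rfl fun x _ => ?_
  rw [numTwNondeg_eq_card, Finset.sum_congr rfl fun g hg => congrArg f (Finset.mem_filter.1 hg).2,
    Finset.sum_const, nsmul_eq_mul, mul_comm, Rat.cast_natCast]

end Matrices

section Main

open CategoryTheory

variable {F : Type} [Field F] [Finite F] {n : ℕ}

local instance : Finite ((Fin n → F) ≃ₗ[F] (Fin n → F)) := DFunLike.finite _
noncomputable local instance : Fintype ((Fin n → F) ≃ₗ[F] (Fin n → F)) := Fintype.ofFinite _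

/-- The Frobenius–Schur indicator of a self-dual irreducible representation of a general linear
group over a finite field of odd characteristic is one. -/
theorem sum_character_sq [Fintype (GL (Fin n) F)] (h2 : (2 : F) ≠ 0)
    (V : FDRep ℂ (GL (Fin n) F)) (hV : Simple V)
    (hsd : ∀ g : GL (Fin n) F, V.character g⁻¹ = V.character g) :
    ∑ g : GL (Fin n) F, V.character (g ^ 2) = (Nat.card (GL (Fin n) F) : ℂ) := by
  have hirr := stable_of_simple V hV
  have hnorm : ∑ g, LinearMap.trace ℂ V (V.ρ g) * LinearMap.trace ℂ V (V.ρ g⁻¹) =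
      Nat.card (GL (Fin n) F) := V.simple_iff_char_is_norm_one.1 hV
  have hconj : ∀ g, LinearMap.trace ℂ V (V.ρ (contragredient g)) =
      LinearMap.trace ℂ V (V.ρ g⁻¹) := fun g => by
    obtain ⟨b, hb⟩ := exists_conj_transpose g⁻¹
    rw [inv_inv] at hb
    rw [hb]
    exact V.char_conj g⁻¹ b
  obtain ⟨ε, hε, ⟨b, hb, hinv, hsymm⟩, hsum⟩ := twisted_frobeniusSchur V.ρ (MonoidHom.id _)
    (fun _ => rfl) hirr hnorm (fun g => (hsd g).symm)
  obtain ⟨δ, hδ, -, hsum'⟩ := twisted_frobeniusSchur V.ρ contragredient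
    contragredient_contragredient hirr hnorm hconj
  have hG : (Nat.card (GL (Fin n) F) : ℂ) ≠ 0 := Nat.cast_ne_zero.2 Nat.card_pos.ne'
  rcases hε with rfl | rfl
  · rw [one_mul] at hsum
    rw [← hsum]
    exact Finset.sum_congr rfl fun g _ => by rw [sq]; rfl
  · exfalso
    obtain ⟨ψ, hψ⟩ : ∃ ψ : AddChar F ℂ, ψ ≠ 1 :=
      ⟨_, by simpa using AddChar.FiniteField.primitiveChar_to_Complex_isPrimitive F one_ne_zero⟩
    obtain ⟨N, hN⟩ := exists_sum_numTwNondeg_eq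
      (V.ρ.comp (autEquiv F n).symm.toMonoidHom) h2 hψ b hb
      (fun x => hinv _) (fun v w => by rw [hsymm, neg_one_mul])
    rw [← Nat.card_congr (autEquiv F n).toEquiv, ← Equiv.sum_comp (autEquiv F n).toEquiv] at hN
    have h3 := sum_mul_numTwNondeg fun g : GL (Fin n) F => LinearMap.trace ℂ V (V.ρ g)
    have h4 : (2 * N * Nat.card (GL (Fin n) F) : ℂ) = δ * Nat.card (GL (Fin n) F) := by
      rw [← hN, ← hsum', ← h3]
      refine Finset.sum_congr rfl fun x _ => ?_
      have h5 : (V.ρ.comp (autEquiv F n).symm.toMonoidHom) ((autEquiv F n).toEquiv x) = V.ρ x :=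
        congrArg V.ρ ((autEquiv F n).symm_apply_apply x)
      rw [h5]
      rfl
    have h5 := mul_right_cancel₀ hG h4
    rcases hδ with rfl | rfl
    · have h6 : 2 * N = 1 := by exact_mod_cast h5
      omega
    · have h6 : (2 * N : ℤ) = -1 := by exact_mod_cast h5
      omega

end Main

end GLOrthogonal

open CategoryTheory Matrix

/-- Every self-dual irreducible complex character of `GL_n(𝔽_q)` (`q` odd) has
Frobenius–Schur indicator `1`: `∑_{g ∈ G} χ(g²) = |G|`. -/
theorem stmt14 (q : ℕ) (hq : Odd q) (hqpp : IsPrimePow q)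
    (F : Type) [Field F] [Fintype F] [DecidableEq F] (hF : Fintype.card F = q)
    (n : ℕ) (hn : 1 ≤ n)
    (V : FDRep ℂ (GL (Fin n) F)) (hV : Simple V)
    (hsd : ∀ g : GL (Fin n) F, V.character g⁻¹ = V.character g) :
    ∑ g : GL (Fin n) F, V.character (g ^ 2) = (Nat.card (GL (Fin n) F) : ℂ) := by
  refine GLOrthogonal.sum_character_sq (fun h => ?_) V hV hsd
  have h1 : ringChar F = 2 := (ringChar.eq_iff.2 ((CharTwo.of_one_ne_zero_of_two_eq_zero
    one_ne_zero h)))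
  have h3 := FiniteField.even_card_of_char_two h1
  rw [hF] at h3
  rw [Nat.odd_iff] at hq
  omega
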